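/- There exist constants ε₀, C, c > 0, depending only on C₀ and c₀, with the following property. Let n ≥ 2, let μ be an even Borel probability measure on ℝⁿ with ψ₁ marginals with constants C₀, c₀, let T ≥ 1 and 0 < ε < ε₀, and suppose that (1-ε)·(1-Φ(t)) ≤ ∫_{S^{n-1}} (1 - F^η(t)) dσ(η) ≤ (1+ε)·(1-Φ(t)) for all t ∈ [0,T]. Then σ{ξ ∈ S^{n-1} : ∃ t ∈ [0,T] with |(1 - F^ξ(t))/(1 - Φ(t)) - 1| > 10ε} ≤ (C·T⁸/(n·ε⁴))·exp(-c·n·ε²·T^{-6}). -/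

import Mathlib

open MeasureTheory Real
open scoped RealInnerProductSpace

/-- The standard Gaussian density `φ(t) = (2π)^{-1/2} e^{-t²/2}`. -/
noncomputable def gaussDensity (t : ℝ) : ℝ := Real.exp (-t ^ 2 / 2) / Real.sqrt (2 * Real.pi)

/-- The standard Gaussian distribution function `Φ(t) = ∫_{-∞}^t φ(s) ds`. -/
noncomputable def gaussCDF (t : ℝ) : ℝ := ∫ s in Set.Iic t, gaussDensity s

/-- The marginal distribution function `F^ξ(t) = μ{x : ⟨x, ξ⟩ < t}`. -/
noncomputable def marginalCDF {n : ℕ} (μ : Measure (EuclideanSpace ℝ (Fin n)))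
    (ξ : EuclideanSpace ℝ (Fin n)) (t : ℝ) : ℝ :=
  (μ {x | ⟪x, ξ⟫ < t}).toReal

/-- `σ` is the rotation-invariant probability measure on the unit sphere `S^{n-1}`,
viewed as a measure on the ambient space supported on the sphere. -/
structure IsUniformSphereMeasure {n : ℕ} (σ : Measure (EuclideanSpace ℝ (Fin n))) : Prop where
  prob : IsProbabilityMeasure σ
  sphere : σ (Metric.sphere (0 : EuclideanSpace ℝ (Fin n)) 1) = 1
  rotInv : ∀ O : EuclideanSpace ℝ (Fin n) ≃ₗᵢ[ℝ] EuclideanSpace ℝ (Fin n),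
    Measure.map O σ = σ

/-- `μ` has `ψ₁` marginals with constants `C₀, c₀`:
`μ{x : ⟨x, θ⟩ > s} ≤ C₀ exp(-c₀ s)` for all `s ≥ 0` and unit vectors `θ`. -/
def HasPsiOneMarginals {n : ℕ} (μ : Measure (EuclideanSpace ℝ (Fin n))) (C₀ c₀ : ℝ) : Prop :=
  ∀ θ : EuclideanSpace ℝ (Fin n), ‖θ‖ = 1 → ∀ s : ℝ, 0 ≤ s →
    (μ {x | s < ⟪x, θ⟫}).toReal ≤ C₀ * Real.exp (-c₀ * s)

/-- `μ` is an even measure. -/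
def Measure.IsEven {n : ℕ} (μ : Measure (EuclideanSpace ℝ (Fin n))) : Prop :=
  Measure.map (fun x => -x) μ = μ

/-- The `δ`-extension of a subset `A` of the unit sphere `S^{n-1}`. -/
def sphExt {n : ℕ} (A : Set (EuclideanSpace ℝ (Fin n))) (δ : ℝ) :
    Set (EuclideanSpace ℝ (Fin n)) :=
  {ξ | ‖ξ‖ = 1 ∧ ∃ η ∈ A, ‖ξ - η‖ ≤ δ}

section

open MeasureTheory Real ProbabilityTheory Set Filter Topology
open scoped RealInnerProductSpace ENNReal NNReal

/-- The Gaussian tail `1 - Φ`. -/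
noncomputable def gaussTail (t : ℝ) : ℝ := 1 - gaussCDF t

lemma gaussDensity_eq_pdf : gaussDensity = gaussianPDFReal 0 1 := by
  ext t
  simp [gaussDensity, gaussianPDFReal, div_eq_inv_mul]

lemma gaussDensity_pos (t : ℝ) : 0 < gaussDensity t := by
  unfold gaussDensity; positivity

lemma continuous_gaussDensity : Continuous gaussDensity := by
  unfold gaussDensity; fun_prop

lemma integrable_gaussDensity : Integrable gaussDensity := by
  rw [gaussDensity_eq_pdf]; exact integrable_gaussianPDFReal 0 1

lemma integral_gaussDensity : ∫ t, gaussDensity t = 1 := by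
  rw [gaussDensity_eq_pdf]; exact integral_gaussianPDFReal_eq_one 0 one_ne_zero

lemma gaussDensity_neg (t : ℝ) : gaussDensity (-t) = gaussDensity t := by
  simp [gaussDensity]

lemma gaussTail_eq_integral (t : ℝ) : gaussTail t = ∫ s in Ioi t, gaussDensity s := by
  unfold gaussTail gaussCDF
  have h := integral_add_compl (measurableSet_Iic (a := t)) integrable_gaussDensity
  rw [integral_gaussDensity, compl_Iic] at h
  linarith

lemma gaussTail_eq_measure (t : ℝ) : gaussTail t = (gaussianReal 0 1).real (Ici t) := by
  rw [gaussTail_eq_integral, measureReal_def, gaussianReal_apply_eq_integral 0 one_ne_zero,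
    ENNReal.toReal_ofReal (setIntegral_nonneg measurableSet_Ici
      fun _ _ => gaussianPDFReal_nonneg _ _ _), integral_Ici_eq_integral_Ioi, gaussDensity_eq_pdf]

lemma gaussTail_neg (t : ℝ) : gaussTail (-t) = 1 - gaussTail t := by
  have h : gaussCDF t = gaussTail (-t) := by
    rw [gaussTail_eq_integral, gaussCDF, ← integral_comp_neg_Iic]
    simp [gaussDensity_neg]
  rw [← h, gaussTail]; ring

lemma gaussTail_zero : gaussTail 0 = 1 / 2 := by
  have := gaussTail_neg 0
  rw [neg_zero] at this; linarith

lemma hasDerivAt_gaussTail (t : ℝ) : HasDerivAt gaussTail (-gaussDensity t) t := by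
  have h : ∀ s, gaussTail s = 1 - ((∫ u in Iic 0, gaussDensity u) + ∫ u in (0:ℝ)..s, gaussDensity u) := by
    intro s
    rw [gaussTail, gaussCDF, ← intervalIntegral.integral_Iic_sub_Iic
      integrable_gaussDensity.integrableOn integrable_gaussDensity.integrableOn]
    ring
  rw [funext h]
  have := (intervalIntegral.integral_hasDerivAt_right (a := 0) (b := t)
    integrable_gaussDensity.intervalIntegrable
    (continuous_gaussDensity.stronglyMeasurableAtFilter _ _) continuous_gaussDensity.continuousAt)
  simpa using (this.const_add (∫ u in Iic 0, gaussDensity u)).const_sub 1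

lemma gaussTail_strictAnti : StrictAnti gaussTail :=
  strictAnti_of_hasDerivAt_neg hasDerivAt_gaussTail fun t => neg_neg_of_pos (gaussDensity_pos t)

lemma gaussTail_nonneg (t : ℝ) : 0 ≤ gaussTail t := by
  rw [gaussTail_eq_measure]; exact measureReal_nonneg

lemma gaussTail_pos (t : ℝ) : 0 < gaussTail t :=
  (gaussTail_nonneg (t + 1)).trans_lt (gaussTail_strictAnti (by linarith))

lemma gaussTail_le_half {t : ℝ} (ht : 0 ≤ t) : gaussTail t ≤ 1 / 2 :=
  gaussTail_zero ▸ gaussTail_strictAnti.antitone ht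

lemma tendsto_gaussTail_atTop : Tendsto gaussTail atTop (𝓝 0) := by
  have h := tendsto_setIntegral_of_antitone (μ := volume) (f := gaussDensity)
    (s := fun t : ℝ => Ioi t) (fun t => measurableSet_Ioi) (fun a b h => Ioi_subset_Ioi h)
    ⟨0, integrable_gaussDensity.integrableOn⟩
  have e : ⋂ t : ℝ, Ioi t = ∅ := by
    ext x; simp only [mem_iInter, mem_Ioi, mem_empty_iff_false, iff_false, not_forall]
    exact ⟨x, lt_irrefl x⟩
  rw [e] at h
  simpa [← gaussTail_eq_integral] using h

lemma gaussDensity_hasDerivAt (t : ℝ) : HasDerivAt gaussDensity (-t * gaussDensity t) t := by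
  unfold gaussDensity
  have h : HasDerivAt (fun t : ℝ => -t ^ 2 / 2) (-t) t := by
    refine (((hasDerivAt_pow 2 t).neg).div_const 2).congr_deriv ?_
    simp; ring
  refine ((h.exp).div_const (√(2 * π))).congr_deriv ?_
  rw [mul_comm (rexp _), mul_div_assoc]

lemma gaussDensity_le_one (t : ℝ) : gaussDensity t ≤ 2 / 5 := by
  unfold gaussDensity
  have h : (5 / 2 : ℝ) ≤ √(2 * π) := by
    apply Real.le_sqrt_of_sq_le; nlinarith [pi_gt_d2]
  rw [div_le_iff₀ (by positivity)]
  have : rexp (-t ^ 2 / 2) ≤ 1 := exp_le_one_iff.2 (by nlinarith [sq_nonneg t])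
  linarith

lemma tendsto_gaussDensity_atTop : Tendsto gaussDensity atTop (𝓝 0) := by
  unfold gaussDensity
  rw [← zero_div (√(2 * π))]
  refine Tendsto.div_const (tendsto_exp_atBot.comp ?_) _
  have : Tendsto (fun t : ℝ => t ^ 2 / 2) atTop atTop :=
    (tendsto_pow_atTop (by norm_num)).atTop_div_const (by norm_num)
  refine (tendsto_neg_atTop_atBot.comp this).congr fun t => ?_
  simp only [Function.comp]; ring

/-- Mills-ratio bound `φ(t) ≤ (t+1)(1-Φ(t))`. -/
lemma gaussDensity_le_mul_gaussTail {t : ℝ} (ht : 0 ≤ t) :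
    gaussDensity t ≤ (t + 1) * gaussTail t := by
  have hd : ∀ s ∈ Ici (0:ℝ), HasDerivAt (fun s => gaussTail s - gaussDensity s / (s + 1))
      (-(gaussDensity s * s / (s + 1) ^ 2)) s := by
    intro s hs
    have hs' : s + 1 ≠ 0 := by have : (0:ℝ) ≤ s := hs; positivity
    have := (hasDerivAt_gaussTail s).sub
      ((gaussDensity_hasDerivAt s).div ((hasDerivAt_id s).add_const 1) hs')
    refine this.congr_deriv ?_
    simp only [id]
    field_simp
    ring
  have hanti : AntitoneOn (fun s => gaussTail s - gaussDensity s / (s + 1)) (Ici 0) := by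
    apply antitoneOn_of_deriv_nonpos (convex_Ici 0)
    · exact fun s hs => (hd s hs).continuousAt.continuousWithinAt
    · exact fun s hs => (hd s (interior_subset hs)).differentiableAt.differentiableWithinAt
    · intro s hs
      have hs0 : (0:ℝ) ≤ s := interior_subset hs
      rw [(hd s hs0).deriv]
      have := gaussDensity_pos s
      exact neg_nonpos_of_nonneg (by positivity)
  have hlim : Tendsto (fun s => gaussTail s - gaussDensity s / (s + 1)) atTop (𝓝 0) := by
    have : Tendsto (fun s : ℝ => gaussDensity s / (s + 1)) atTop (𝓝 0) :=
      tendsto_gaussDensity_atTop.div_atTop (tendsto_atTop_add_const_right _ _ tendsto_id)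
    simpa using tendsto_gaussTail_atTop.sub this
  have h0 : 0 ≤ gaussTail t - gaussDensity t / (t + 1) := by
    refine le_of_tendsto hlim ?_
    filter_upwards [eventually_ge_atTop t] with s hs
    exact hanti (mem_Ici.2 ht) (mem_Ici.2 (ht.trans hs)) hs
  have : gaussDensity t / (t + 1) ≤ gaussTail t := by linarith
  rw [div_le_iff₀ (by linarith)] at this
  linarith

lemma gaussTail_le_exp_mul {s t : ℝ} (hs : 0 ≤ s) (hst : s ≤ t) :
    gaussTail s ≤ gaussTail t * rexp ((t - s) * (t + 1)) := by
  have hd : ∀ u, HasDerivAt (fun u => gaussTail u * rexp ((u + 1) ^ 2 / 2))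
      (((u + 1) * gaussTail u - gaussDensity u) * rexp ((u + 1) ^ 2 / 2)) u := by
    intro u
    have h1 : HasDerivAt (fun u : ℝ => (u + 1) ^ 2 / 2) (u + 1) u := by
      have := ((((hasDerivAt_id u).add_const 1).pow 2).div_const 2)
      refine this.congr_deriv ?_
      simp
    refine ((hasDerivAt_gaussTail u).mul h1.exp).congr_deriv ?_
    ring
  have hmono : MonotoneOn (fun u => gaussTail u * rexp ((u + 1) ^ 2 / 2)) (Ici 0) := by
    apply monotoneOn_of_deriv_nonneg (convex_Ici 0)
    · exact fun s _ => (hd s).continuousAt.continuousWithinAt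
    · exact fun s _ => (hd s).differentiableAt.differentiableWithinAt
    · intro u hu
      have hu0 : (0:ℝ) ≤ u := interior_subset hu
      rw [(hd u).deriv]
      exact mul_nonneg (sub_nonneg.2 (gaussDensity_le_mul_gaussTail hu0)) (exp_pos _).le
  have h := hmono (mem_Ici.2 hs) (mem_Ici.2 (hs.trans hst)) hst
  simp only at h
  have e : gaussTail s ≤ gaussTail t * rexp ((t + 1) ^ 2 / 2 - (s + 1) ^ 2 / 2) := by
    rw [exp_sub, ← mul_div_assoc, le_div_iff₀ (exp_pos _)]; exact h
  refine e.trans (mul_le_mul_of_nonneg_left (exp_le_exp.2 ?_) (gaussTail_nonneg t))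
  nlinarith [sq_nonneg (t - s)]

lemma gaussTail_lower {t : ℝ} (ht : 0 ≤ t) : rexp (-(t ^ 2 + t)) / 2 ≤ gaussTail t := by
  have h := gaussTail_le_exp_mul le_rfl ht
  rw [gaussTail_zero, sub_zero] at h
  have h2 : rexp (-(t ^ 2 + t)) * rexp (t * (t + 1)) = 1 := by
    rw [← exp_add]; ring_nf; simp
  have h3 := mul_le_mul_of_nonneg_left h (exp_pos (-(t ^ 2 + t))).le
  have : rexp (-(t ^ 2 + t)) * (gaussTail t * rexp (t * (t + 1))) = gaussTail t := by
    rw [mul_left_comm, h2, mul_one]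
  linarith

lemma gaussTail_sub_le {s t : ℝ} (hst : s ≤ t) : gaussTail s - gaussTail t ≤ 2 / 5 * (t - s) := by
  have h : MonotoneOn (fun u => gaussTail u + 2 / 5 * u) univ := by
    have hd : ∀ u, HasDerivAt (fun u => gaussTail u + 2 / 5 * u) (-gaussDensity u + 2 / 5 * 1) u :=
      fun u => (hasDerivAt_gaussTail u).add ((hasDerivAt_id u).const_mul _)
    apply monotoneOn_of_deriv_nonneg convex_univ
    · exact fun s _ => (hd s).continuousAt.continuousWithinAt
    · exact fun s _ => (hd s).differentiableAt.differentiableWithinAt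
    · intro u _
      rw [(hd u).deriv]
      linarith [gaussDensity_le_one u]
  have := h (mem_univ s) (mem_univ t) hst
  simp only at this
  linarith

lemma gaussTail_le_exp {t : ℝ} (ht : 0 ≤ t) : gaussTail t ≤ rexp (-t ^ 2 / 2) := by
  have := measure_ge_le_exp_mul_mgf (μ := gaussianReal 0 1) (X := id) t ht (by
    simpa using integrable_exp_mul_gaussianReal (μ := 0) (v := 1) t)
  rw [mgf_id_gaussianReal] at this
  rw [gaussTail_eq_measure]
  refine (le_of_eq rfl).trans (this.trans (le_of_eq ?_))
  rw [← exp_add]; congr 1; simp; ring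

/-- The Euclidean space `ℝⁿ`. -/
abbrev Euc (n : ℕ) := EuclideanSpace ℝ (Fin n)

/-- The centred Gaussian measure on `ℝⁿ` with covariance `n⁻¹ • 1`. -/
noncomputable def gaussN (n : ℕ) : Measure (Euc n) :=
  (stdGaussian (Euc n)).map (fun x => (√n)⁻¹ • x)

instance (n : ℕ) : IsProbabilityMeasure (gaussN n) :=
  Measure.isProbabilityMeasure_map (Measurable.aemeasurable (by fun_prop))

lemma charFun_gaussN (n : ℕ) (t : Euc n) :
    charFun (gaussN n) t = Complex.exp (-(‖t‖ ^ 2 / (2 * n) : ℝ)) := by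
  rw [gaussN, charFun_map_smul, charFun_stdGaussian, norm_smul, norm_inv, norm_of_nonneg (sqrt_nonneg _)]
  congr 1
  have : ((√n)⁻¹ : ℝ) ^ 2 = (n : ℝ)⁻¹ := by rw [inv_pow, sq_sqrt (Nat.cast_nonneg n)]
  rw [← Complex.ofReal_pow, mul_pow, this]
  push_cast
  ring

instance (n : ℕ) : IsGaussian (gaussN n) := by
  unfold gaussN
  have : (fun x : Euc n => (√n)⁻¹ • x) = ⇑((√n)⁻¹ • ContinuousLinearMap.id ℝ (Euc n)) := by
    ext; simp
  rw [this]; infer_instance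

lemma integral_id_gaussN (n : ℕ) : (gaussN n)[id] = 0 := by
  rw [gaussN, integral_map (by fun_prop) (by fun_prop)]
  simp only [id]
  rw [integral_smul, integral_id_stdGaussian, smul_zero]

lemma gaussN_map_rotation (n : ℕ) (θ : ℝ) :
    ((gaussN n).prod (gaussN n)).map (fun p => (cos θ • p.1 + sin θ • p.2, -sin θ • p.1 + cos θ • p.2))
      = (gaussN n).prod (gaussN n) := by
  have := IsGaussian.map_rotation_eq_self (integral_id_gaussN n) θ
  convert this using 2
  ext p <;> simp [ContinuousLinearMap.rotation_apply]

lemma gaussN_map_isometry (n : ℕ) (O : Euc n ≃ₗᵢ[ℝ] Euc n) :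
    (gaussN n).map O = gaussN n := by
  have h : O ∘ (fun x => (√n)⁻¹ • x) = (fun x => (√n)⁻¹ • x) ∘ O := by ext; simp
  rw [gaussN, Measure.map_map (by fun_prop) (by fun_prop), h,
    ← Measure.map_map (by fun_prop) (by fun_prop), stdGaussian_map]

lemma gaussN_map_inner (n : ℕ) (x : Euc n) :
    (gaussN n).map (fun z => ⟪x, z⟫) = (gaussianReal 0 1).map (fun s => ‖x‖ / √n * s) := by
  have : IsProbabilityMeasure ((gaussN n).map (fun z => ⟪x, z⟫)) :=
    Measure.isProbabilityMeasure_map (Measurable.aemeasurable (by fun_prop))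
  have : IsProbabilityMeasure ((gaussianReal 0 1).map (fun s => ‖x‖ / √n * s)) :=
    Measure.isProbabilityMeasure_map (Measurable.aemeasurable (by fun_prop))
  apply Measure.ext_of_charFun
  ext t
  rw [charFun_map_mul, charFun_gaussianReal, charFun_apply, integral_map (by fun_prop) (by fun_prop)]
  have h := charFun_gaussN n (t • x)
  rw [charFun_apply] at h
  simp only [RCLike.inner_apply, conj_trivial]
  have e : ∀ z : Euc n, ((t * ⟪x, z⟫ : ℝ) : ℂ) = ((⟪z, t • x⟫ : ℝ) : ℂ) := fun z => by
    rw [inner_smul_right, real_inner_comm]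
  simp_rw [e]
  rw [h]
  congr 1
  rw [norm_smul, norm_eq_abs, mul_pow, sq_abs]
  have hn : ((√n : ℝ) : ℂ) ^ 2 = n := by rw [← Complex.ofReal_pow, sq_sqrt (Nat.cast_nonneg n)]; simp
  push_cast
  rw [mul_pow, div_pow, hn]
  ring

lemma gaussN_semigroup (n : ℕ) {a b c : ℝ} (h : a ^ 2 + b ^ 2 = c ^ 2) :
    ((gaussN n).prod (gaussN n)).map (fun p => a • p.1 + b • p.2) =
      (gaussN n).map (fun z => c • z) := by
  have e : (fun p : Euc n × Euc n => a • p.1 + b • p.2) =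
    (fun p => p.1 + p.2) ∘ (Prod.map (fun z => a • z) (fun z => b • z)) := rfl
  have : ∀ r : ℝ, IsProbabilityMeasure ((gaussN n).map (fun z => r • z)) := fun r =>
    Measure.isProbabilityMeasure_map (Measurable.aemeasurable (by fun_prop))
  rw [e, ← Measure.map_map (by fun_prop) (by fun_prop), ← Measure.map_prod_map _ _ (by fun_prop) (by fun_prop)]
  have : IsProbabilityMeasure ((((gaussN n).map (fun z => a • z)).prod ((gaussN n).map (fun z => b • z))).map
      (fun p => p.1 + p.2)) := Measure.isProbabilityMeasure_map (Measurable.aemeasurable (by fun_prop))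
  apply Measure.ext_of_charFun
  rw [charFun_map_add_prod_eq_mul]
  ext t
  rw [Pi.mul_apply, charFun_map_smul, charFun_map_smul, charFun_map_smul, charFun_gaussN, charFun_gaussN,
    charFun_gaussN, ← Complex.exp_add]
  congr 1
  simp only [norm_smul, norm_eq_abs, mul_pow, sq_abs, ← h]
  push_cast
  ring

lemma integral_gaussN_inner (n : ℕ) (x : Euc n) {f : ℝ → ℝ} (hf : Measurable f) :
    ∫ z, f ⟪x, z⟫ ∂(gaussN n) = ∫ s, f (‖x‖ / √n * s) ∂(gaussianReal 0 1) := by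
  have h := gaussN_map_inner n x
  rw [← integral_map (φ := fun z => ⟪x, z⟫) (by fun_prop) hf.aestronglyMeasurable, h,
    integral_map (by fun_prop) hf.aestronglyMeasurable]

lemma pi_absolutelyContinuous {n : ℕ} {μ ν : Fin n → Measure ℝ} [∀ i, IsProbabilityMeasure (μ i)]
    [∀ i, SigmaFinite (ν i)] (h : ∀ i, μ i ≪ ν i) : Measure.pi μ ≪ Measure.pi ν := by
  induction n with
  | zero =>
    intro s hs
    rw [Measure.pi_of_empty] at hs ⊢
    exact hs
  | succ n ih =>
    have h1 := (measurePreserving_piFinSuccAbove μ 0).symm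
    have h2 := (measurePreserving_piFinSuccAbove ν 0).symm
    rw [← h1.map_eq, ← h2.map_eq]
    exact ((h 0).prod (ih fun j => h _)).map (MeasurableEquiv.measurable _)

lemma gaussN_absolutelyContinuous {n : ℕ} (hn : n ≠ 0) : gaussN n ≪ volume := by
  have h1 : stdGaussian (Euc n) ≪ volume := by
    rw [← map_pi_eq_stdGaussian, ← (PiLp.volume_preserving_toLp (Fin n)).map_eq]
    refine (pi_absolutelyContinuous fun i => gaussianReal_absolutelyContinuous 0 one_ne_zero).map ?_
    fun_prop
  have hc : (√n : ℝ)⁻¹ ≠ 0 := by positivity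
  refine (h1.map (f := fun x => (√n)⁻¹ • x) (by fun_prop)).trans ?_
  rw [Measure.map_addHaar_smul _ hc]
  exact Measure.smul_absolutelyContinuous

lemma integrable_exp_norm_gaussN (n : ℕ) (c : ℝ) :
    Integrable (fun z => rexp (c * ‖z‖)) (gaussN n) := by
  obtain ⟨C, hC, h⟩ := IsGaussian.exists_integrable_exp_sq (gaussN n)
  refine (h.const_mul (rexp (c ^ 2 / (4 * C)))).mono' (by fun_prop) (ae_of_all _ fun z => ?_)
  rw [norm_of_nonneg (exp_pos _).le, ← exp_add]
  apply exp_le_exp.2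
  have : 0 ≤ (2 * C * ‖z‖ - c) ^ 2 / (4 * C) := by positivity
  have e : (2 * C * ‖z‖ - c) ^ 2 / (4 * C) = C * ‖z‖ ^ 2 - c * ‖z‖ + c ^ 2 / (4 * C) := by
    field_simp; ring
  linarith

lemma lintegral_exp_inner_gaussN (n : ℕ) (x : Euc n) :
    ∫⁻ z, ENNReal.ofReal (rexp ⟪x, z⟫) ∂(gaussN n) = ENNReal.ofReal (rexp (‖x‖ ^ 2 / (2 * n))) := by
  rw [← lintegral_map (μ := gaussN n) (f := fun s => ENNReal.ofReal (rexp s)) (g := fun z => ⟪x, z⟫)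
    (by fun_prop) (by fun_prop), gaussN_map_inner, lintegral_map (by fun_prop) (by fun_prop),
    ← ofReal_integral_eq_lintegral_ofReal (integrable_exp_mul_gaussianReal _)
      (ae_of_all _ fun _ => (exp_pos _).le)]
  have := congrFun (mgf_id_gaussianReal (μ := 0) (v := 1)) (‖x‖ / √n)
  rw [mgf] at this
  simp only [id] at this
  rw [this, zero_mul, zero_add, div_pow, sq_sqrt (Nat.cast_nonneg n)]
  congr 2
  simp; ring

lemma exp_sum_le_mean {M : ℕ} (hM : M ≠ 0) (d : ℕ → ℝ) :
    rexp (∑ k ∈ Finset.range M, d k) ≤ ∑ k ∈ Finset.range M, (M : ℝ)⁻¹ * rexp (M * d k) := by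
  have hM' : (M : ℝ) ≠ 0 := by exact_mod_cast hM
  have := convexOn_exp.map_sum_le (t := Finset.range M) (w := fun _ => (M : ℝ)⁻¹)
    (p := fun k => M * d k) (fun _ _ => by positivity) (by simp [hM']) (fun _ _ => mem_univ _)
  simpa [hM'] using this

lemma maurey_pisier_step {n : ℕ} {f : Euc n → ℝ} (hf : Measurable f) (M : ℕ) (hM : M ≠ 0) :
    ∫⁻ p, ENNReal.ofReal (rexp (f p.2 - f p.1)) ∂((gaussN n).prod (gaussN n)) ≤
    ∫⁻ p, ENNReal.ofReal (rexp (M * (f (cos (π / 2 / M) • p.1 + sin (π / 2 / M) • p.2) - f p.1)))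
      ∂((gaussN n).prod (gaussN n)) := by
  set δ := π / 2 / M with hδ
  have hM' : (M : ℝ) ≠ 0 := by exact_mod_cast hM
  set X : ℝ → Euc n × Euc n → Euc n := fun θ p => cos θ • p.1 + sin θ • p.2 with hX
  set G : Euc n × Euc n → ℝ≥0∞ := fun p =>
    ENNReal.ofReal (rexp (M * (f (cos δ • p.1 + sin δ • p.2) - f p.1))) with hG
  have hGm : Measurable G := by fun_prop
  have key : ∀ k : ℕ, ∫⁻ p, ENNReal.ofReal (rexp (M * (f (X ((k + 1 : ℕ) * δ) p) - f (X (k * δ) p))))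
      ∂((gaussN n).prod (gaussN n)) = ∫⁻ p, G p ∂((gaussN n).prod (gaussN n)) := by
    intro k
    conv_rhs => rw [← gaussN_map_rotation n (k * δ), lintegral_map hGm (by fun_prop)]
    refine lintegral_congr fun p => ?_
    simp only [hG, hX]
    congr 5
    push_cast
    rw [add_mul, one_mul, cos_add, sin_add]
    module
  have hsum : ∀ p, f p.2 - f p.1 = ∑ k ∈ Finset.range M, (f (X ((k + 1 : ℕ) * δ) p) - f (X (k * δ) p)) := by
    intro p
    rw [Finset.sum_range_sub (fun k : ℕ => f (X (k * δ) p))]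
    have : M * δ = π / 2 := by rw [hδ]; field_simp
    simp [hX, this]
  calc _ ≤ ∫⁻ p, ∑ k ∈ Finset.range M, ENNReal.ofReal (M : ℝ)⁻¹ * ENNReal.ofReal
        (rexp (M * (f (X ((k + 1 : ℕ) * δ) p) - f (X (k * δ) p)))) ∂((gaussN n).prod (gaussN n)) := by
        refine lintegral_mono fun p => ?_
        rw [hsum p]
        refine (ENNReal.ofReal_le_ofReal (exp_sum_le_mean hM _)).trans ?_
        rw [ENNReal.ofReal_sum_of_nonneg (fun _ _ => by positivity)]
        refine Finset.sum_le_sum fun k _ => ?_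
        rw [ENNReal.ofReal_mul (by positivity)]
    _ = ∑ k ∈ Finset.range M, ENNReal.ofReal (M : ℝ)⁻¹ * ∫⁻ p, G p ∂((gaussN n).prod (gaussN n)) := by
        rw [lintegral_finsetSum _ (fun k _ => by fun_prop)]
        refine Finset.sum_congr rfl fun k _ => ?_
        rw [lintegral_const_mul _ (by fun_prop), key k]
    _ = _ := by
        rw [Finset.sum_const, Finset.card_range, nsmul_eq_mul, ← mul_assoc,
          show (M : ℝ≥0∞) = ENNReal.ofReal M by simp, ← ENNReal.ofReal_mul (by positivity),
          mul_inv_cancel₀ hM', ENNReal.ofReal_one, one_mul]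

lemma tendsto_scaled_rotation_diff {n : ℕ} {f : Euc n → ℝ} {x : Euc n}
    (hx : DifferentiableAt ℝ f x) (y : Euc n) :
    Tendsto (fun M : ℕ => (M : ℝ) * (f (cos (π / 2 / M) • x + sin (π / 2 / M) • y) - f x)) atTop
      (𝓝 (π / 2 * fderiv ℝ f x y)) := by
  have hc : HasDerivAt (fun u : ℝ => cos (π / 2 * u) • x + sin (π / 2 * u) • y) ((π / 2) • y) 0 := by
    have h0 : HasDerivAt (fun u : ℝ => π / 2 * u) (π / 2) 0 := by
      simpa using (hasDerivAt_id (0:ℝ)).const_mul (π / 2)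
    have h1 := (h0.cos.smul_const x).add (h0.sin.smul_const y)
    refine h1.congr_deriv ?_
    simp
  have hf : HasFDerivAt f (fderiv ℝ f x) (cos (π / 2 * 0) • x + sin (π / 2 * 0) • y) := by
    simpa using hx.hasFDerivAt
  have h := hf.comp_hasDerivAt (0:ℝ) hc
  rw [hasDerivAt_iff_tendsto_slope_zero] at h
  have hM : Tendsto (fun M : ℕ => ((M : ℝ))⁻¹) atTop (𝓝[≠] 0) := by
    refine tendsto_nhdsWithin_iff.2 ⟨tendsto_inv_atTop_nhds_zero_nat, ?_⟩
    filter_upwards [eventually_ne_atTop 0] with M hM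
    simpa using hM
  have := h.comp hM
  simpa [Function.comp_def, div_eq_mul_inv] using this

lemma norm_rotation_sub_le {E : Type*} [NormedAddCommGroup E] [NormedSpace ℝ E] (x y : E) (δ : ℝ) :
    ‖cos δ • x + sin δ • y - x‖ ≤ |δ| * (‖x‖ + ‖y‖) := by
  have h1 : cos δ • x + sin δ • y - x = (cos δ - 1) • x + sin δ • y := by module
  have h2 : |cos δ - 1| ≤ |δ| := by simpa using abs_cos_sub_cos_le δ 0
  have h3 : |sin δ| ≤ |δ| := abs_sin_le_abs
  rw [h1, mul_add]
  refine (norm_add_le _ _).trans ?_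
  rw [norm_smul, norm_smul, norm_eq_abs, norm_eq_abs]
  gcongr

/-- The Maurey–Pisier exponential inequality for Lipschitz functions. -/
theorem maurey_pisier {n : ℕ} (hn : n ≠ 0) {f : Euc n → ℝ} {L : ℝ≥0} (hf : LipschitzWith L f) :
    ∫⁻ p, ENNReal.ofReal (rexp (f p.2 - f p.1)) ∂((gaussN n).prod (gaussN n)) ≤
      ENNReal.ofReal (rexp (π ^ 2 * L ^ 2 / (8 * n))) := by
  have hfm : Measurable f := hf.continuous.measurable
  have hDm : Measurable fun p : Euc n × Euc n => fderiv ℝ f p.1 p.2 := by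
    have h1 : Measurable fun p : Euc n × Euc n => fderiv ℝ f p.1 :=
      (measurable_fderiv ℝ f).comp measurable_fst
    exact isBoundedBilinearMap_apply.continuous.measurable.comp (h1.prodMk measurable_snd)
  have hae : ∀ᵐ p ∂((gaussN n).prod (gaussN n)), DifferentiableAt ℝ f p.1 := by
    have h := (gaussN_absolutelyContinuous hn).ae_le hf.ae_differentiableAt
    exact (measurePreserving_fst (μ := gaussN n) (ν := gaussN n)).quasiMeasurePreserving.ae h
  have hint : ∀ c : ℝ, ∫⁻ z, ENNReal.ofReal (rexp (c * ‖z‖)) ∂(gaussN n) < ∞ := fun c => by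
    rw [← ofReal_integral_eq_lintegral_ofReal (integrable_exp_norm_gaussN n c)
      (ae_of_all _ fun _ => (exp_pos _).le)]
    exact ENNReal.ofReal_lt_top
  set c : ℝ := L * (π / 2) with hc
  have hlim : Tendsto (fun M : ℕ => ∫⁻ p, ENNReal.ofReal (rexp (M *
      (f (cos (π / 2 / M) • p.1 + sin (π / 2 / M) • p.2) - f p.1))) ∂((gaussN n).prod (gaussN n))) atTop
      (𝓝 (∫⁻ p, ENNReal.ofReal (rexp (π / 2 * fderiv ℝ f p.1 p.2)) ∂((gaussN n).prod (gaussN n)))) := by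
    refine tendsto_lintegral_of_dominated_convergence
      (fun p => ENNReal.ofReal (rexp (c * ‖p.1‖)) * ENNReal.ofReal (rexp (c * ‖p.2‖)))
      (fun M => by fun_prop) (fun M => ae_of_all _ fun p => ?_) ?_ ?_
    · beta_reduce
      rw [← ENNReal.ofReal_mul (exp_pos _).le, ← exp_add, ← mul_add]
      refine ENNReal.ofReal_le_ofReal (exp_le_exp.2 ?_)
      rcases Nat.eq_zero_or_pos M with rfl | hM
      · simp; positivity
      have hM' : (0:ℝ) < M := by exact_mod_cast hM
      have h1 := hf.dist_le_mul (cos (π / 2 / M) • p.1 + sin (π / 2 / M) • p.2) p.1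
      rw [dist_eq_norm, dist_eq_norm, norm_eq_abs] at h1
      have h2 := norm_rotation_sub_le p.1 p.2 (π / 2 / M)
      rw [abs_of_nonneg (by positivity : 0 ≤ π / 2 / M)] at h2
      calc _ ≤ (M : ℝ) * (L * (π / 2 / M * (‖p.1‖ + ‖p.2‖))) := by
            gcongr
            exact (le_abs_self _).trans (h1.trans (by gcongr))
        _ = _ := by rw [hc]; field_simp
    · have hm : AEMeasurable (fun z => ENNReal.ofReal (rexp (c * ‖z‖))) (gaussN n) := by fun_prop
      rw [lintegral_prod_mul hm hm]
      exact (ENNReal.mul_lt_top (hint c) (hint c)).ne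
    · filter_upwards [hae] with p hp
      exact (ENNReal.continuous_ofReal.comp continuous_exp).continuousAt.tendsto.comp
        (tendsto_scaled_rotation_diff hp p.2)
  refine (ge_of_tendsto hlim ?_).trans ?_
  · filter_upwards [eventually_ne_atTop 0] with M hM
    exact maurey_pisier_step hfm M hM
  · rw [lintegral_prod _ (by fun_prop)]
    calc _ ≤ ∫⁻ _ : Euc n, ENNReal.ofReal (rexp (π ^ 2 * L ^ 2 / (8 * n))) ∂(gaussN n) := by
          refine lintegral_mono fun x => ?_
          set v := (InnerProductSpace.toDual ℝ (Euc n)).symm (fderiv ℝ f x) with hv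
          have hv1 : ∀ y, π / 2 * fderiv ℝ f x y = ⟪(π / 2) • v, y⟫ := fun y => by
            rw [real_inner_smul_left, hv, InnerProductSpace.toDual_symm_apply]
          have hv2 : ‖v‖ ≤ L := by
            rw [hv, LinearIsometryEquiv.norm_map]; exact norm_fderiv_le_of_lipschitz ℝ hf
          simp_rw [hv1]
          rw [lintegral_exp_inner_gaussN]
          refine ENNReal.ofReal_le_ofReal (exp_le_exp.2 ?_)
          rw [norm_smul, norm_of_nonneg (by positivity), mul_pow]
          have : ‖v‖ ^ 2 ≤ (L : ℝ) ^ 2 := by gcongr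
          calc _ ≤ ((π / 2) ^ 2 * (L : ℝ) ^ 2) / (2 * n) := by gcongr
            _ = _ := by ring
      _ = _ := by simp

/-- Gaussian concentration: two sets at distance at least `δ` cannot both be large. -/
theorem gaussN_mul_le {n : ℕ} (hn : n ≠ 0) {A B : Set (Euc n)} (hA : MeasurableSet A)
    (hB : MeasurableSet B) {δ : ℝ} (hδ : 0 ≤ δ) (h : ∀ w ∈ A, ∀ z ∈ B, δ ≤ dist z w) :
    (gaussN n).real A * (gaussN n).real B ≤ rexp (-(n * δ ^ 2 / 5)) := by
  rcases A.eq_empty_or_nonempty with rfl | hne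
  · simp; positivity
  obtain ⟨l, hl⟩ : ∃ l : ℝ≥0, (l : ℝ) = 4 * n * δ / π ^ 2 := ⟨⟨_, by positivity⟩, rfl⟩
  have hL : LipschitzWith l (fun z => (l : ℝ) * Metric.infDist z A) := by
    refine LipschitzWith.of_dist_le_mul fun x y => ?_
    have := (Metric.lipschitz_infDist_pt A).dist_le_mul x y
    rw [NNReal.coe_one, one_mul] at this
    rw [dist_eq_norm, ← mul_sub, norm_mul, norm_of_nonneg (NNReal.coe_nonneg l), ← dist_eq_norm]
    gcongr
  have h1 := maurey_pisier hn hL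
  have h2 : ENNReal.ofReal (rexp (l * δ)) * (gaussN n A * gaussN n B) ≤
      ENNReal.ofReal (rexp (π ^ 2 * l ^ 2 / (8 * n))) := by
    refine le_trans ?_ h1
    rw [← Measure.prod_prod, ← lintegral_indicator_const (hA.prod hB)]
    refine lintegral_mono fun p => ?_
    refine indicator_le (g := fun p : Euc n × Euc n => ENNReal.ofReal (rexp
      (l * Metric.infDist p.2 A - l * Metric.infDist p.1 A))) (fun p hp => ?_) p
    refine ENNReal.ofReal_le_ofReal (exp_le_exp.2 ?_)
    have ha : Metric.infDist p.1 A = 0 := Metric.infDist_zero_of_mem hp.1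
    have hb : δ ≤ Metric.infDist p.2 A := (Metric.le_infDist hne).2 fun w hw => h w hw _ hp.2
    rw [ha, mul_zero, sub_zero]
    gcongr
  have h3 := ENNReal.toReal_mono ENNReal.ofReal_ne_top h2
  rw [ENNReal.toReal_mul, ENNReal.toReal_mul, ENNReal.toReal_ofReal (exp_pos _).le,
    ENNReal.toReal_ofReal (exp_pos _).le] at h3
  have hnp : (0:ℝ) < n := by positivity
  have h4 : rexp (π ^ 2 * l ^ 2 / (8 * n)) ≤ rexp (l * δ) * rexp (-(n * δ ^ 2 / 5)) := by
    rw [← exp_add]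
    apply exp_le_exp.2
    have e1 : π ^ 2 * (l : ℝ) ^ 2 / (8 * n) = 2 * (n * δ ^ 2) / π ^ 2 := by
      rw [hl]; field_simp; ring
    have e2 : (l : ℝ) * δ = 4 * (n * δ ^ 2) / π ^ 2 := by
      rw [hl]; field_simp
    rw [e1, e2]
    have : n * δ ^ 2 / 5 ≤ 2 * (n * δ ^ 2) / π ^ 2 := by
      rw [div_le_div_iff₀ (by norm_num) (by positivity)]
      have : π ^ 2 ≤ 10 := by nlinarith [pi_lt_d2, pi_pos]
      nlinarith [mul_nonneg hnp.le (sq_nonneg δ)]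
    have e3 : 4 * (n * δ ^ 2) / π ^ 2 = 2 * (n * δ ^ 2) / π ^ 2 + 2 * (n * δ ^ 2) / π ^ 2 := by ring
    linarith
  exact le_of_mul_le_mul_left (h3.trans h4) (exp_pos _)

lemma charFun_eq_of_norm_eq {n : ℕ} {τ : Measure (Euc n)}
    (hτ : ∀ O : Euc n ≃ₗᵢ[ℝ] Euc n, Measure.map O τ = τ) {s t : Euc n} (h : ‖s‖ = ‖t‖) :
    charFun τ s = charFun τ t := by
  set O := (Submodule.reflection (ℝ ∙ (s - t))ᗮ) with hO
  have hs : O s = t := Submodule.reflection_sub h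
  conv_lhs => rw [← hτ O.symm]
  rw [charFun_apply, charFun_apply, integral_map (by fun_prop) (by fun_prop)]
  refine integral_congr_ae (ae_of_all _ fun x => ?_)
  beta_reduce
  rw [← hs, ← LinearIsometryEquiv.inner_map_map O (O.symm x) s, O.apply_symm_apply]

lemma charFun_integral_sphere {n : ℕ} {σ τ : Measure (Euc n)} [IsProbabilityMeasure σ]
    [IsProbabilityMeasure τ] (hσ : ∀ O : Euc n ≃ₗᵢ[ℝ] Euc n, Measure.map O σ = σ)
    (h1 : ∀ᵐ x ∂τ, ‖x‖ = 1) (t : Euc n) :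
    charFun σ t = ∫ y, charFun σ (‖t‖ • y) ∂τ := by
  have : ∀ᵐ y ∂τ, charFun σ (‖t‖ • y) = charFun σ t := by
    filter_upwards [h1] with y hy
    refine charFun_eq_of_norm_eq hσ ?_
    rw [norm_smul, hy, norm_norm, mul_one]
  rw [integral_congr_ae this]
  simp

/-- A rotation invariant probability measure on the sphere is unique. -/
lemma rotation_invariant_unique {n : ℕ} {σ τ : Measure (Euc n)} [IsProbabilityMeasure σ]
    [IsProbabilityMeasure τ] (hσ : ∀ O : Euc n ≃ₗᵢ[ℝ] Euc n, Measure.map O σ = σ)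
    (hτ : ∀ O : Euc n ≃ₗᵢ[ℝ] Euc n, Measure.map O τ = τ)
    (h1 : ∀ᵐ x ∂σ, ‖x‖ = 1) (h2 : ∀ᵐ x ∂τ, ‖x‖ = 1) : σ = τ := by
  apply Measure.ext_of_charFun
  ext t
  rw [charFun_integral_sphere hσ h2, charFun_integral_sphere hτ h1]
  simp only [charFun_apply]
  rw [integral_integral_swap]
  · simp only [inner_smul_right, real_inner_comm]
  · refine (integrable_const (1:ℝ)).mono' (by fun_prop) (ae_of_all _ fun p => ?_)
    simp [Function.uncurry, Complex.norm_exp]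

lemma sphere_eq_map_gaussN {n : ℕ} (hn : n ≠ 0) {σ : Measure (Euc n)}
    (hσ : IsUniformSphereMeasure σ) : σ = (gaussN n).map (fun z => ‖z‖⁻¹ • z) := by
  have := hσ.prob
  have : IsProbabilityMeasure ((gaussN n).map (fun z => ‖z‖⁻¹ • z)) :=
    Measure.isProbabilityMeasure_map (Measurable.aemeasurable (by fun_prop))
  have : Nonempty (Fin n) := ⟨⟨0, Nat.pos_of_ne_zero hn⟩⟩
  refine rotation_invariant_unique hσ.rotInv (fun O => ?_) ?_ ?_
  · have h : O ∘ (fun z => ‖z‖⁻¹ • z) = (fun z => ‖z‖⁻¹ • z) ∘ O := by ext; simp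
    rw [Measure.map_map (by fun_prop) (by fun_prop), h, ← Measure.map_map (by fun_prop) (by fun_prop),
      gaussN_map_isometry]
  · have := (prob_compl_eq_zero_iff (μ := σ) (s := Metric.sphere 0 1) Metric.isClosed_sphere.measurableSet).2 hσ.sphere
    rw [ae_iff]
    simpa [Set.compl_def] using this
  · rw [ae_map_iff (by fun_prop) (measurableSet_eq_fun (by fun_prop) (by fun_prop))]
    have h0 : ∀ᵐ z ∂(gaussN n), z ≠ 0 :=
      (gaussN_absolutelyContinuous hn).ae_le (Measure.ae_ne volume 0)
    filter_upwards [h0] with z hz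
    rw [norm_smul, norm_inv, norm_norm, inv_mul_cancel₀ (norm_ne_zero_iff.2 hz)]

lemma integral_exp_mul_sq_gaussianReal {a : ℝ} (ha : a < 1 / 2) :
    ∫ s, rexp (a * s ^ 2) ∂(gaussianReal 0 1) = (√(1 - 2 * a))⁻¹ := by
  rw [integral_gaussianReal_eq_integral_smul one_ne_zero]
  have : ∀ x : ℝ, gaussianPDFReal 0 1 x • rexp (a * x ^ 2) =
      (√(2 * π))⁻¹ * rexp (-(1 / 2 - a) * x ^ 2) := by
    intro x
    simp only [gaussianPDFReal, smul_eq_mul, NNReal.coe_one, mul_one, sub_zero]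
    rw [mul_assoc, ← exp_add]; congr 2; ring
  simp_rw [this]
  rw [integral_const_mul, integral_gaussian, ← sqrt_inv, ← sqrt_mul (by positivity), ← sqrt_inv]
  congr 1
  have : 1 / 2 - a ≠ 0 := by linarith
  have : 1 - 2 * a ≠ 0 := by linarith
  have := pi_pos
  field_simp

lemma integral_exp_norm_sq_gaussN {n : ℕ} (hn : n ≠ 0) {a : ℝ} (ha : a < 1 / 2) :
    ∫ z, rexp (a * (n * ‖z‖ ^ 2)) ∂(gaussN n) = ((√(1 - 2 * a))⁻¹) ^ n := by
  rw [gaussN, integral_map (by fun_prop) (by fun_prop), ← map_pi_eq_stdGaussian,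
    integral_map (by fun_prop) (by fun_prop)]
  have : ∀ x : Fin n → ℝ, rexp (a * (n * ‖(√n)⁻¹ • WithLp.toLp 2 x‖ ^ 2)) = ∏ i, rexp (a * x i ^ 2) := by
    intro x
    rw [norm_smul, mul_pow, norm_inv, norm_of_nonneg (sqrt_nonneg _), inv_pow, sq_sqrt (Nat.cast_nonneg n),
      ← mul_assoc (n:ℝ), mul_inv_cancel₀ (by exact_mod_cast hn), one_mul, EuclideanSpace.real_norm_sq_eq, ← exp_sum,
      Finset.mul_sum]
  simp_rw [this]
  rw [integral_fintype_prod_eq_prod (f := fun _ s => rexp (a * s ^ 2))]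
  simp [integral_exp_mul_sq_gaussianReal ha]

lemma mgf_norm_sq_gaussN {n : ℕ} (hn : n ≠ 0) {a : ℝ} (ha : |a| ≤ 1 / 4) :
    Integrable (fun z => rexp (a * (n * ‖z‖ ^ 2))) (gaussN n) ∧
    mgf (fun z => n * ‖z‖ ^ 2) (gaussN n) a ≤ rexp (n * (a + 2 * a ^ 2)) := by
  obtain ⟨h1, h2⟩ := abs_le.1 ha
  have hI := integral_exp_norm_sq_gaussN hn (show a < 1 / 2 by linarith)
  have hpos : 0 < 1 - 2 * a := by linarith
  refine ⟨?_, ?_⟩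
  · by_contra h
    rw [integral_undef h] at hI
    have : 0 < ((√(1 - 2 * a))⁻¹) ^ n := by positivity
    linarith
  · rw [mgf, hI, exp_nat_mul]
    refine pow_le_pow_left₀ (by positivity) ?_ n
    rw [inv_le_comm₀ (sqrt_pos.2 hpos) (exp_pos _), ← exp_neg]
    apply Real.le_sqrt_of_sq_le
    rw [← exp_nat_mul]
    have h3 : rexp (2 * (a + 2 * a ^ 2)) * (1 - 2 * a) ≥ 1 := by
      rcases le_or_gt 0 a with h | h
      · have := quadratic_le_exp_of_nonneg (show 0 ≤ 2 * (a + 2 * a ^ 2) by positivity)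
        have h4 : (1 + 2 * (a + 2 * a ^ 2) + (2 * (a + 2 * a ^ 2)) ^ 2 / 2) * (1 - 2 * a) ≥ 1 := by
          have : (1 + 2 * (a + 2 * a ^ 2) + (2 * (a + 2 * a ^ 2)) ^ 2 / 2) * (1 - 2 * a) - 1
            = 2 * a ^ 2 * (1 - 2 * a - 4 * a ^ 2 - 8 * a ^ 3) := by ring
          have h5 : 0 ≤ 1 - 2 * a - 4 * a ^ 2 - 8 * a ^ 3 := by
            have e1 : a ^ 2 ≤ 1 / 16 := by nlinarith
            have e2 : a ^ 3 ≤ 1 / 64 := by nlinarith [sq_nonneg a]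
            linarith
          have := mul_nonneg (mul_nonneg (zero_le_two (α := ℝ)) (sq_nonneg a)) h5
          linarith
        nlinarith
      · have := add_one_le_exp (2 * (a + 2 * a ^ 2))
        have h4 : (1 + 2 * (a + 2 * a ^ 2)) * (1 - 2 * a) ≥ 1 := by
          have : (1 + 2 * (a + 2 * a ^ 2)) * (1 - 2 * a) - 1 = 8 * a ^ 2 * (-a) := by ring
          have := mul_nonneg (mul_nonneg (show (0:ℝ) ≤ 8 by norm_num) (sq_nonneg a)) (neg_nonneg.2 h.le)
          linarith
        nlinarith
    have h5 : rexp ((2 : ℕ) * -(a + 2 * a ^ 2)) * rexp (2 * (a + 2 * a ^ 2)) = 1 := by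
      rw [← exp_add]; push_cast; ring_nf; simp
    have h6 := exp_pos ((2 : ℕ) * -(a + 2 * a ^ 2))
    have h7 := mul_le_mul_of_nonneg_left h3 h6.le
    rw [← mul_assoc, h5] at h7
    linarith

/-- Concentration of the Euclidean norm of a Gaussian vector. -/
lemma gaussN_norm_conc {n : ℕ} (hn : n ≠ 0) {u : ℝ} (hu : 0 ≤ u) (hu1 : u ≤ 1) :
    (gaussN n).real {z | u < |‖z‖ - 1|} ≤ 2 * rexp (-(n * u ^ 2 / 8)) := by
  have hn' : (0:ℝ) < n := by positivity
  obtain ⟨i1, m1⟩ := mgf_norm_sq_gaussN hn (a := u / 4) (by rw [abs_of_nonneg] <;> linarith)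
  obtain ⟨i2, m2⟩ := mgf_norm_sq_gaussN hn (a := -(u / 4)) (by rw [abs_neg, abs_of_nonneg] <;> linarith)
  have b1 := measure_ge_le_exp_mul_mgf (μ := gaussN n) (X := fun z => n * ‖z‖ ^ 2) (n * (1 + u))
    (show 0 ≤ u / 4 by linarith) i1
  have b2 := measure_le_le_exp_mul_mgf (μ := gaussN n) (X := fun z => n * ‖z‖ ^ 2) (n * (1 - u))
    (show -(u / 4) ≤ 0 by linarith) i2
  have c1 : rexp (-(u / 4) * (n * (1 + u))) * mgf (fun z => n * ‖z‖ ^ 2) (gaussN n) (u / 4) ≤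
      rexp (-(n * u ^ 2 / 8)) := by
    refine (mul_le_mul_of_nonneg_left m1 (exp_pos _).le).trans ?_
    rw [← exp_add]
    exact exp_le_exp.2 (le_of_eq (by ring))
  have c2 : rexp (-(-(u / 4)) * (n * (1 - u))) * mgf (fun z => n * ‖z‖ ^ 2) (gaussN n) (-(u / 4)) ≤
      rexp (-(n * u ^ 2 / 8)) := by
    refine (mul_le_mul_of_nonneg_left m2 (exp_pos _).le).trans ?_
    rw [← exp_add]
    exact exp_le_exp.2 (le_of_eq (by ring))
  have hsub : {z : Euc n | u < |‖z‖ - 1|} ⊆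
      {z | n * (1 + u) ≤ n * ‖z‖ ^ 2} ∪ {z | n * ‖z‖ ^ 2 ≤ n * (1 - u)} := by
    intro z hz
    simp only [mem_ofPred_eq, mem_union] at hz ⊢
    have h0 := norm_nonneg z
    rcases lt_abs.1 hz with h | h
    · left
      apply mul_le_mul_of_nonneg_left _ hn'.le
      nlinarith
    · right
      apply mul_le_mul_of_nonneg_left _ hn'.le
      nlinarith
  calc _ ≤ _ := measureReal_mono hsub
    _ ≤ _ := measureReal_union_le _ _
    _ ≤ _ := by linarith

/-- The upper tail `μ{x : t ≤ ⟨x, z⟩}` of the marginal of `μ` in the direction `z`. -/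
noncomputable def upTail {n : ℕ} (μ : Measure (Euc n)) (t : ℝ) (z : Euc n) : ℝ :=
  μ.real {x | t ≤ ⟪x, z⟫}

section
variable {n : ℕ} {μ : Measure (Euc n)}

lemma measurableSet_le_inner (t : ℝ) (z : Euc n) : MeasurableSet {x : Euc n | t ≤ ⟪x, z⟫} :=
  measurableSet_le measurable_const (by fun_prop)

lemma measurable_upTail [SFinite μ] (t : ℝ) : Measurable (upTail μ t) := by
  have : MeasurableSet {p : Euc n × Euc n | t ≤ ⟪p.2, p.1⟫} :=
    measurableSet_le measurable_const (by fun_prop)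
  exact (measurable_measure_prodMk_left (ν := μ) this).ennreal_toReal

lemma upTail_nonneg (t : ℝ) (z : Euc n) : 0 ≤ upTail μ t z := measureReal_nonneg

lemma upTail_le_one [IsProbabilityMeasure μ] (t : ℝ) (z : Euc n) : upTail μ t z ≤ 1 :=
  measureReal_le_one

lemma upTail_antitone [IsFiniteMeasure μ] (z : Euc n) {s t : ℝ} (h : s ≤ t) :
    upTail μ t z ≤ upTail μ s z :=
  measureReal_mono fun _ hx => h.trans hx

lemma integrable_upTail [IsFiniteMeasure μ] {ν : Measure (Euc n)} [IsFiniteMeasure ν] (t : ℝ) :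
    Integrable (upTail μ t) ν :=
  Integrable.of_bound (measurable_upTail t).aestronglyMeasurable (μ.real univ)
    (ae_of_all _ fun z => by
      rw [norm_of_nonneg (upTail_nonneg t z)]; exact measureReal_mono (subset_univ _))

lemma one_sub_marginalCDF [IsProbabilityMeasure μ] (t : ℝ) (z : Euc n) :
    1 - marginalCDF μ z t = upTail μ t z := by
  have : {x : Euc n | t ≤ ⟪x, z⟫} = {x | ⟪x, z⟫ < t}ᶜ := by ext; simp
  rw [upTail, this, probReal_compl_eq_one_sub (measurableSet_lt (by fun_prop) measurable_const)]
  rfl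

lemma upTail_smul {c : ℝ} (hc : 0 < c) (t : ℝ) (z : Euc n) :
    upTail μ t (c • z) = upTail μ (t / c) z := by
  unfold upTail
  congr 1
  ext x
  simp only [mem_ofPred_eq, inner_smul_right]
  rw [div_le_iff₀' hc]

lemma Measure.IsEven.real_preimage_neg (hμ : Measure.IsEven μ) {s : Set (Euc n)}
    (hs : MeasurableSet s) : μ.real ((fun x => -x) ⁻¹' s) = μ.real s := by
  rw [← map_measureReal_apply measurable_neg hs, hμ]

lemma Measure.IsEven.real_inner_le_neg (hμ : Measure.IsEven μ) (t : ℝ) (z : Euc n) :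
    μ.real {x | ⟪x, z⟫ ≤ -t} = upTail μ t z := by
  rw [upTail, ← hμ.real_preimage_neg (measurableSet_le_inner t z)]
  congr 1
  ext x
  simp only [mem_ofPred_eq, mem_preimage, inner_neg_left]
  constructor <;> intro h <;> linarith

lemma upTail_zero_add_le [IsProbabilityMeasure μ] (hμ : Measure.IsEven μ) {t : ℝ} (ht : 0 < t) (z : Euc n) :
    upTail μ 0 z + upTail μ t z ≤ 1 := by
  rw [← hμ.real_inner_le_neg t z, upTail, ← measureReal_union _
    (measurableSet_le (by fun_prop) measurable_const)]
  · exact measureReal_le_one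
  · rw [Set.disjoint_left]
    intro x hx hx'
    simp only [mem_ofPred_eq] at hx hx'
    linarith

lemma measureReal_lt_inner_le {C₀ c₀ : ℝ} [IsFiniteMeasure μ] (hC₀ : 0 < C₀) (hc₀ : 0 < c₀)
    (hψ : HasPsiOneMarginals μ C₀ c₀) {v : Euc n} {δ s : ℝ} (hv : ‖v‖ ≤ δ) (hs : 0 ≤ s) :
    μ.real {x | s < ⟪x, v⟫} ≤ C₀ * exp (-(c₀ * s / δ)) := by
  rcases eq_or_ne v 0 with rfl | h0
  · have : {x : Euc n | s < ⟪x, (0 : Euc n)⟫} = ∅ := by ext; simp [hs]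
    rw [this]; simp; positivity
  have hv0 : 0 < ‖v‖ := norm_pos_iff.2 h0
  have h1 : {x : Euc n | s < ⟪x, v⟫} = {x | s / ‖v‖ < ⟪x, ‖v‖⁻¹ • v⟫} := by
    ext x
    simp only [mem_ofPred_eq, inner_smul_right]
    rw [div_lt_iff₀ hv0, mul_comm _ ‖v‖, mul_inv_cancel_left₀ hv0.ne']
  have := hψ (‖v‖⁻¹ • v) (by rw [norm_smul, norm_inv, norm_norm, inv_mul_cancel₀ hv0.ne']) (s / ‖v‖)
    (by positivity)
  rw [h1]
  refine this.trans ?_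
  gcongr
  rw [neg_mul, neg_le_neg_iff, mul_div_assoc]
  gcongr

lemma upTail_shift_le {C₀ c₀ : ℝ} [IsFiniteMeasure μ] (hC₀ : 0 < C₀) (hc₀ : 0 < c₀)
    (hψ : HasPsiOneMarginals μ C₀ c₀) {z w : Euc n} {δ h t : ℝ} (hv : ‖w - z‖ ≤ δ)
    (hh : 0 ≤ h) : upTail μ t w ≤ upTail μ (t - h) z + C₀ * exp (-(c₀ * h / δ)) := by
  refine le_trans ?_ (add_le_add_right (measureReal_lt_inner_le hC₀ hc₀ hψ hv hh) _)
  refine le_trans (measureReal_mono ?_) (measureReal_union_le _ _)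
  intro x hx
  simp only [mem_ofPred_eq, mem_union, inner_sub_right] at hx ⊢
  by_contra! hcon
  linarith [hcon.1, hcon.2]

lemma integral_exp_abs_inner_le {C₀ c₀ : ℝ} [IsProbabilityMeasure μ] (hC₀ : 0 < C₀) (hc₀ : 0 < c₀)
    (hψ : HasPsiOneMarginals μ C₀ c₀) {θ : Euc n} (hθ : ‖θ‖ = 1) :
    Integrable (fun x => exp (c₀ / 2 * |⟪x, θ⟫|)) μ ∧
      ∫ x, exp (c₀ / 2 * |⟪x, θ⟫|) ∂μ ≤ 1 + 2 * C₀ := by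
  have hint : ∀ s : ℝ, ∫ t in (0:ℝ)..s, (c₀ / 2) * exp (c₀ / 2 * t) = exp (c₀ / 2 * s) - 1 := by
    intro s
    have : ∀ x ∈ uIcc 0 s, HasDerivAt (fun t => exp (c₀ / 2 * t)) ((c₀ / 2) * exp (c₀ / 2 * x)) x := by
      intro x _
      have := ((hasDerivAt_id x).const_mul (c₀ / 2)).exp
      simpa [mul_comm] using this
    rw [intervalIntegral.integral_eq_sub_of_hasDerivAt this
      (Continuous.intervalIntegrable (by fun_prop) _ _)]
    simp
  have hlc := lintegral_comp_eq_lintegral_meas_lt_mul μ (f := fun x => |⟪x, θ⟫|)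
    (g := fun t => c₀ / 2 * exp (c₀ / 2 * t)) (ae_of_all _ fun x => abs_nonneg _)
    (Measurable.aemeasurable (by fun_prop)) (fun t _ => Continuous.intervalIntegrable (by fun_prop) _ _)
    (ae_of_all _ fun t => by positivity)
  have hbd : ∀ t ∈ Ioi (0:ℝ), μ {x | t < |⟪x, θ⟫|} * ENNReal.ofReal (c₀ / 2 * exp (c₀ / 2 * t))
      ≤ ENNReal.ofReal (C₀ * c₀ * exp (-(c₀ / 2) * t)) := by
    intro t ht
    have h1 := measureReal_lt_inner_le hC₀ hc₀ hψ hθ.le (le_of_lt ht)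
    have h2 := measureReal_lt_inner_le (v := -θ) hC₀ hc₀ hψ ((norm_neg θ).trans hθ).le (le_of_lt ht)
    have h3 : μ.real {x | t < |⟪x, θ⟫|} ≤ 2 * C₀ * exp (-(c₀ * t)) := by
      have : {x : Euc n | t < |⟪x, θ⟫|} = {x | t < ⟪x, θ⟫} ∪ {x | t < ⟪x, -θ⟫} := by
        ext x; simp [lt_abs]
      rw [this]
      refine (measureReal_union_le _ _).trans ?_
      rw [div_one] at h1 h2
      linarith
    rw [← ofReal_measureReal, ← ENNReal.ofReal_mul measureReal_nonneg]
    apply ENNReal.ofReal_le_ofReal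
    calc _ ≤ 2 * C₀ * exp (-(c₀ * t)) * (c₀ / 2 * exp (c₀ / 2 * t)) := by gcongr
      _ = C₀ * c₀ * (exp (-(c₀ * t)) * exp (c₀ / 2 * t)) := by ring
      _ = _ := by rw [← exp_add]; ring_nf
  have hfin : ∫⁻ t in Ioi (0:ℝ), ENNReal.ofReal (C₀ * c₀ * exp (-(c₀ / 2) * t)) = ENNReal.ofReal (2 * C₀) := by
    rw [← ofReal_integral_eq_lintegral_ofReal]
    · rw [integral_const_mul, integral_exp_mul_Ioi (by linarith)]
      congr 1
      simp; field_simp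
    · exact (integrableOn_exp_mul_Ioi (by linarith) 0).const_mul _
    · exact ae_of_all _ fun t => by positivity
  have hL : ∫⁻ x, ENNReal.ofReal (exp (c₀ / 2 * |⟪x, θ⟫|) - 1) ∂μ ≤ ENNReal.ofReal (2 * C₀) := by
    simp_rw [hint] at hlc
    rw [hlc, ← hfin]
    exact setLIntegral_mono' measurableSet_Ioi hbd
  have hnn : 0 ≤ᵐ[μ] fun x => exp (c₀ / 2 * |⟪x, θ⟫|) - 1 := ae_of_all _ fun x => by
    have : 0 ≤ c₀ / 2 * |⟪x, θ⟫| := by positivity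
    simpa using this
  have hI : Integrable (fun x => exp (c₀ / 2 * |⟪x, θ⟫|) - 1) μ := by
    refine ⟨Measurable.aestronglyMeasurable (by fun_prop), ?_⟩
    rw [hasFiniteIntegral_iff_ofReal hnn]
    exact hL.trans_lt ENNReal.ofReal_lt_top
  have hI2 : Integrable (fun x => exp (c₀ / 2 * |⟪x, θ⟫|)) μ := by
    refine (hI.add (integrable_const (1:ℝ))).congr (ae_of_all _ fun x => ?_)
    simp
  refine ⟨hI2, ?_⟩
  have : ∫ x, (exp (c₀ / 2 * |⟪x, θ⟫|) - 1) ∂μ ≤ 2 * C₀ := by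
    rw [integral_eq_lintegral_of_nonneg_ae hnn hI.aestronglyMeasurable]
    exact ENNReal.toReal_le_of_le_ofReal (by positivity) hL
  rw [integral_sub hI2 (integrable_const _)] at this
  simp at this
  linarith

/-- The bound on the second moments of the marginals that follows from the `ψ₁` condition. -/
lemma integral_inner_sq_le {C₀ c₀ : ℝ} [IsProbabilityMeasure μ] (hC₀ : 0 < C₀) (hc₀ : 0 < c₀)
    (hψ : HasPsiOneMarginals μ C₀ c₀) (v : Euc n) :
    Integrable (fun x => ⟪x, v⟫ ^ 2) μ ∧
    ∫ x, ⟪x, v⟫ ^ 2 ∂μ ≤ 8 * (1 + 2 * C₀) / c₀ ^ 2 * ‖v‖ ^ 2 := by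
  rcases eq_or_ne v 0 with rfl | h0
  · simp
  have hv0 : 0 < ‖v‖ := norm_pos_iff.2 h0
  obtain ⟨h1, h2⟩ := integral_exp_abs_inner_le (θ := ‖v‖⁻¹ • v) hC₀ hc₀ hψ (by rw [norm_smul, norm_inv, norm_norm, inv_mul_cancel₀ hv0.ne'])
  have hp : ∀ x : Euc n, ⟪x, v⟫ ^ 2 ≤ 8 / c₀ ^ 2 * ‖v‖ ^ 2 * exp (c₀ / 2 * |⟪x, ‖v‖⁻¹ • v⟫|) := by
    intro x
    have e : ⟪x, v⟫ = ‖v‖ * ⟪x, ‖v‖⁻¹ • v⟫ := by rw [inner_smul_right, mul_inv_cancel_left₀ hv0.ne']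
    rw [e, mul_pow]
    set y := ⟪x, ‖v‖⁻¹ • v⟫
    have := quadratic_le_exp_of_nonneg (show 0 ≤ c₀ / 2 * |y| by positivity)
    have h3 : (c₀ / 2 * |y|) ^ 2 / 2 ≤ exp (c₀ / 2 * |y|) := by nlinarith [show 0 ≤ c₀ / 2 * |y| by positivity]
    have h4 : y ^ 2 ≤ 8 / c₀ ^ 2 * exp (c₀ / 2 * |y|) := by
      rw [mul_pow, sq_abs] at h3
      calc y ^ 2 = 8 / c₀ ^ 2 * ((c₀ / 2) ^ 2 * y ^ 2 / 2) := by field_simp; ring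
        _ ≤ _ := by gcongr
    calc _ ≤ ‖v‖ ^ 2 * (8 / c₀ ^ 2 * exp (c₀ / 2 * |y|)) := by gcongr
      _ = _ := by ring
  have hI : Integrable (fun x => ⟪x, v⟫ ^ 2) μ :=
    (h1.const_mul (8 / c₀ ^ 2 * ‖v‖ ^ 2)).mono' (Measurable.aestronglyMeasurable (by fun_prop))
      (ae_of_all _ fun x => by rw [norm_of_nonneg (by positivity)]; exact hp x)
  refine ⟨hI, (integral_mono hI (h1.const_mul _) hp).trans ?_⟩
  rw [integral_const_mul]
  calc _ ≤ 8 / c₀ ^ 2 * ‖v‖ ^ 2 * (1 + 2 * C₀) := by gcongr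
    _ = _ := by ring

/-- Tail of the first moment: `E |W|` over `|W| > A` is exponentially small in `A`. -/
lemma setIntegral_abs_inner_le {C₀ c₀ : ℝ} [IsProbabilityMeasure μ] (hC₀ : 0 < C₀) (hc₀ : 0 < c₀)
    (hψ : HasPsiOneMarginals μ C₀ c₀) {θ : Euc n} (hθ : ‖θ‖ = 1) (A : ℝ) :
    Integrable (fun x => |⟪x, θ⟫|) μ ∧
    ∫ x in {x | A < |⟪x, θ⟫|}, |⟪x, θ⟫| ∂μ ≤ 4 * (1 + 2 * C₀) / c₀ * exp (-(c₀ * A / 4)) := by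
  obtain ⟨h1, h2⟩ := integral_exp_abs_inner_le hC₀ hc₀ hψ hθ
  have hp : ∀ x : Euc n, A < |⟪x, θ⟫| → |⟪x, θ⟫| ≤ 4 / c₀ * exp (-(c₀ * A / 4)) * exp (c₀ / 2 * |⟪x, θ⟫|) := by
    intro x hx
    have h3 := add_one_le_exp (c₀ / 4 * |⟪x, θ⟫|)
    have h4 : exp (c₀ / 4 * |⟪x, θ⟫|) ≤ exp (-(c₀ * A / 4)) * exp (c₀ / 2 * |⟪x, θ⟫|) := by
      rw [← exp_add]
      apply exp_le_exp.2
      nlinarith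
    calc |⟪x, θ⟫| = 4 / c₀ * (c₀ / 4 * |⟪x, θ⟫|) := by field_simp
      _ ≤ 4 / c₀ * (exp (-(c₀ * A / 4)) * exp (c₀ / 2 * |⟪x, θ⟫|)) :=
        mul_le_mul_of_nonneg_left (by linarith) (by positivity)
      _ = _ := by ring
  have hp0 : ∀ x : Euc n, |⟪x, θ⟫| ≤ 2 / c₀ * exp (c₀ / 2 * |⟪x, θ⟫|) := by
    intro x
    have h3 := add_one_le_exp (c₀ / 2 * |⟪x, θ⟫|)
    calc |⟪x, θ⟫| = 2 / c₀ * (c₀ / 2 * |⟪x, θ⟫|) := by field_simp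
      _ ≤ _ := by gcongr; linarith
  have hI : Integrable (fun x => |⟪x, θ⟫|) μ :=
    (h1.const_mul (2 / c₀)).mono' (Measurable.aestronglyMeasurable (by fun_prop))
      (ae_of_all _ fun x => by rw [norm_of_nonneg (by positivity)]; exact hp0 x)
  refine ⟨hI, ?_⟩
  have hm : MeasurableSet {x : Euc n | A < |⟪x, θ⟫|} := measurableSet_lt measurable_const (by fun_prop)
  calc ∫ x in {x | A < |⟪x, θ⟫|}, |⟪x, θ⟫| ∂μ
      ≤ ∫ x in {x | A < |⟪x, θ⟫|}, 4 / c₀ * exp (-(c₀ * A / 4)) * exp (c₀ / 2 * |⟪x, θ⟫|) ∂μ :=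
        setIntegral_mono_on hI.integrableOn (h1.const_mul _).integrableOn hm hp
    _ ≤ ∫ x, 4 / c₀ * exp (-(c₀ * A / 4)) * exp (c₀ / 2 * |⟪x, θ⟫|) ∂μ :=
        setIntegral_le_integral (h1.const_mul _) (ae_of_all _ fun x => by positivity)
    _ ≤ 4 / c₀ * exp (-(c₀ * A / 4)) * (1 + 2 * C₀) := by
        rw [integral_const_mul]; gcongr
    _ = _ := by ring

lemma memLp_id_of_psiOne {C₀ c₀ : ℝ} [IsProbabilityMeasure μ] (hC₀ : 0 < C₀) (hc₀ : 0 < c₀)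
    (hψ : HasPsiOneMarginals μ C₀ c₀) : MemLp (fun x : Euc n => x) 3 μ := by
  apply MemLp.of_eval_piLp
  intro i
  obtain ⟨h1, h2⟩ := integral_exp_abs_inner_le (θ := EuclideanSpace.single i 1) hC₀ hc₀ hψ (by simp)
  have h3 := integrable_pow_abs_of_integrable_exp_mul (X := fun x : Euc n => |x i|) (t := c₀ / 2) (by positivity)
    (by simpa [EuclideanSpace.inner_single_right] using h1) (by
      refine (integrable_const (1:ℝ)).mono' (Measurable.aestronglyMeasurable (by fun_prop)) (ae_of_all _ fun x => ?_)
      rw [norm_of_nonneg (exp_pos _).le, exp_le_one_iff]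
      have : 0 ≤ c₀ / 2 * |x i| := by positivity
      linarith) 3
  have : MemLp (fun x : Euc n => x i) ((3:ℕ):ℝ≥0∞) μ := by
    rw [← integrable_norm_rpow_iff (Measurable.aestronglyMeasurable (by fun_prop)) (by norm_num) (by norm_num)]
    simpa using h3
  exact_mod_cast this

end

/-- The norm of a vector of `ℝⁿ`, divided by `√n`. -/
noncomputable def rad {n : ℕ} (x : Euc n) : ℝ := ‖x‖ / √n

/-- The average of the upper tails over a Gaussian direction. -/
noncomputable def meanTail {n : ℕ} (μ : Measure (Euc n)) (t : ℝ) : ℝ :=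
  ∫ z, upTail μ t z ∂(gaussN n)

lemma convexOn_gaussTail_sqrt : ConvexOn ℝ (Ioi 0) (fun s => gaussTail √s) := by
  have hd : ∀ s ∈ Ioi (0:ℝ), HasDerivAt (fun s => gaussTail √s) (-gaussDensity √s * (1 / (2 * √s))) s := by
    intro s hs
    exact (hasDerivAt_gaussTail √s).comp s (hasDerivAt_sqrt (ne_of_gt hs))
  apply MonotoneOn.convexOn_of_deriv (convex_Ioi 0)
  · exact fun s hs => (hd s hs).continuousAt.continuousWithinAt
  · rw [interior_Ioi]; exact fun s hs => (hd s hs).differentiableAt.differentiableWithinAt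
  · rw [interior_Ioi]
    intro s hs t ht hst
    rw [(hd s hs).deriv, (hd t ht).deriv, neg_mul, neg_mul, neg_le_neg_iff]
    have hs0 : 0 < √s := sqrt_pos.2 hs
    have h1 : √s ≤ √t := sqrt_le_sqrt hst
    have h2 : gaussDensity √t ≤ gaussDensity √s := by
      unfold gaussDensity
      gcongr
    have := gaussDensity_pos √t
    have := gaussDensity_pos √s
    gcongr

section
variable {n : ℕ} {μ : Measure (Euc n)}

lemma rad_nonneg (x : Euc n) : 0 ≤ rad x := by unfold rad; positivity

@[fun_prop]
lemma measurable_rad : Measurable (rad (n := n)) := by unfold rad; fun_prop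

lemma integral_inner_swap [IsFiniteMeasure μ] {f : ℝ → ℝ} (hf : Measurable f) {C : ℝ} (hC : ∀ y, |f y| ≤ C) :
    ∫ z, ∫ x, f ⟪x, z⟫ ∂μ ∂(gaussN n) = ∫ x, ∫ s, f (rad x * s) ∂(gaussianReal 0 1) ∂μ := by
  rw [integral_integral_swap]
  · simp_rw [integral_gaussN_inner n _ hf]
    rfl
  · apply Integrable.of_bound (C := C)
    · exact Measurable.aestronglyMeasurable (hf.comp (by fun_prop))
    · exact ae_of_all _ fun p => hC _

lemma upTail_eq_integral (t : ℝ) (z : Euc n) :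
    upTail μ t z = ∫ x, (Ici t).indicator (fun _ => (1:ℝ)) ⟪x, z⟫ ∂μ := by
  have : (fun x : Euc n => (Ici t).indicator (fun _ => (1:ℝ)) ⟪x, z⟫) =
    {x : Euc n | t ≤ ⟪x, z⟫}.indicator 1 := by
    ext x; simp [indicator]
  rw [this, integral_indicator_one (measurableSet_le_inner t z)]
  rfl

/-- The Gaussian tail of a centered normal variable with standard deviation `r`. -/
noncomputable def scaledTail (r t : ℝ) : ℝ := (gaussianReal 0 1).real {s | t ≤ r * s}

lemma scaledTail_eq {r : ℝ} (hr : 0 < r) (t : ℝ) : scaledTail r t = gaussTail (t / r) := by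
  rw [scaledTail, gaussTail_eq_measure]
  congr 1
  ext s
  simp [div_le_iff₀' hr]

lemma scaledTail_zero {t : ℝ} (ht : 0 < t) : scaledTail 0 t = 0 := by
  have : {s : ℝ | t ≤ 0 * s} = ∅ := by ext s; simp [ht]
  rw [scaledTail, this, measureReal_empty]

lemma meanTail_eq_integral_scaledTail [IsFiniteMeasure μ] (t : ℝ) : meanTail μ t = ∫ x, scaledTail (rad x) t ∂μ := by
  unfold meanTail
  simp_rw [upTail_eq_integral]
  rw [integral_inner_swap (measurable_const.indicator measurableSet_Ici) (C := 1)]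
  · congr 1
    ext x
    have : (fun s : ℝ => (Ici t).indicator (fun _ => (1:ℝ)) (rad x * s)) =
      {s : ℝ | t ≤ rad x * s}.indicator 1 := by
      ext x; simp [indicator]
    rw [this, integral_indicator_one (measurableSet_le measurable_const (by fun_prop))]
    rfl
  · intro y
    by_cases h : y ∈ Ici t <;> simp [h]

lemma measurable_scaledTail (t : ℝ) : Measurable (fun r => scaledTail r t) := by
  have : MeasurableSet {p : ℝ × ℝ | t ≤ p.1 * p.2} :=
    measurableSet_le measurable_const (by fun_prop)
  exact (measurable_measure_prodMk_left (ν := gaussianReal 0 1) this).ennreal_toReal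

lemma integrable_scaledTail [IsFiniteMeasure μ] (t : ℝ) : Integrable (fun x : Euc n => scaledTail (rad x) t) μ :=
  Integrable.of_bound ((measurable_scaledTail t).comp measurable_rad).aestronglyMeasurable 1
    (ae_of_all _ fun z => by
      unfold scaledTail; rw [norm_of_nonneg measureReal_nonneg]; exact measureReal_le_one)

lemma meanTail_antitone [IsFiniteMeasure μ] {s t : ℝ} (h : s ≤ t) : meanTail μ t ≤ meanTail μ s :=
  integral_mono (integrable_upTail t) (integrable_upTail s) fun z => upTail_antitone z h

/-- Convexity of the mean tail as a function of `t²`. -/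
lemma meanTail_convex [IsFiniteMeasure μ] {a b c : ℝ} (ha : 0 < a) (hab : a < b) (hbc : b < c) :
    (c ^ 2 - a ^ 2) * meanTail μ b ≤ (c ^ 2 - b ^ 2) * meanTail μ a + (b ^ 2 - a ^ 2) * meanTail μ c := by
  simp_rw [meanTail_eq_integral_scaledTail, ← integral_const_mul]
  rw [← integral_add ((integrable_scaledTail _).const_mul _) ((integrable_scaledTail _).const_mul _)]
  refine integral_mono ((integrable_scaledTail _).const_mul _)
    (((integrable_scaledTail _).const_mul _).add ((integrable_scaledTail _).const_mul _)) fun x => ?_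
  rcases (rad_nonneg x).eq_or_lt with h0 | h0
  · simp only [← h0]
    rw [scaledTail_zero ha, scaledTail_zero (ha.trans hab), scaledTail_zero (ha.trans (hab.trans hbc))]
    simp
  · simp only [scaledTail_eq h0]
    set r := rad x
    have hca : 0 < c ^ 2 - a ^ 2 := by nlinarith
    have hc : 0 < c := ha.trans (hab.trans hbc)
    have := convexOn_gaussTail_sqrt.2 (show (a / r) ^ 2 ∈ Ioi 0 from mem_Ioi.2 (by positivity))
      (show (c / r) ^ 2 ∈ Ioi 0 from mem_Ioi.2 (by positivity))
      (div_nonneg (by nlinarith) hca.le : 0 ≤ (c ^ 2 - b ^ 2) / (c ^ 2 - a ^ 2))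
      (div_nonneg (by nlinarith) hca.le : 0 ≤ (b ^ 2 - a ^ 2) / (c ^ 2 - a ^ 2)) (by field_simp; ring)
    have e : (c ^ 2 - b ^ 2) / (c ^ 2 - a ^ 2) * (a / r) ^ 2 + (b ^ 2 - a ^ 2) / (c ^ 2 - a ^ 2) * (c / r) ^ 2
      = (b / r) ^ 2 := by field_simp; ring
    simp only [smul_eq_mul] at this
    have hb : 0 < b := ha.trans hab
    rw [e, sqrt_sq (show 0 ≤ b / r by positivity), sqrt_sq (show 0 ≤ a / r by positivity),
      sqrt_sq (show 0 ≤ c / r by positivity)] at this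
    calc _ ≤ (c ^ 2 - a ^ 2) * ((c ^ 2 - b ^ 2) / (c ^ 2 - a ^ 2) * gaussTail (a / r) + (b ^ 2 - a ^ 2) / (c ^ 2 - a ^ 2) * gaussTail (c / r)) := by gcongr
      _ = _ := by field_simp

lemma upTail_le_sphere [IsFiniteMeasure μ] {t e : ℝ} (ht : 0 ≤ t) (he1 : e < 1) {z : Euc n}
    (hz : |‖z‖ - 1| ≤ e) : upTail μ t z ≤ upTail μ (t / (1 + e)) (‖z‖⁻¹ • z) := by
  have hz' := abs_le.1 hz
  have hz0 : 0 < ‖z‖ := by linarith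
  have : z = ‖z‖ • (‖z‖⁻¹ • z) := by rw [smul_smul, mul_inv_cancel₀ hz0.ne', one_smul]
  nth_rw 1 [this]
  rw [upTail_smul hz0]
  apply upTail_antitone
  gcongr
  linarith

lemma sphere_le_upTail [IsFiniteMeasure μ] {t e : ℝ} (ht : 0 ≤ t) (he1 : e < 1) {z : Euc n}
    (hz : |‖z‖ - 1| ≤ e) : upTail μ (t / (1 - e)) (‖z‖⁻¹ • z) ≤ upTail μ t z := by
  have hz' := abs_le.1 hz
  have hz0 : 0 < ‖z‖ := by linarith
  have : z = ‖z‖ • (‖z‖⁻¹ • z) := by rw [smul_smul, mul_inv_cancel₀ hz0.ne', one_smul]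
  calc upTail μ (t / (1 - e)) (‖z‖⁻¹ • z) ≤ upTail μ (t / ‖z‖) (‖z‖⁻¹ • z) := ?_
    _ = upTail μ t z := by rw [← upTail_smul hz0, ← this]
  apply upTail_antitone
  apply div_le_div_of_nonneg_left ht <;> linarith

lemma measurableSet_norm_dev (e : ℝ) : MeasurableSet {z : Euc n | e < |‖z‖ - 1|} :=
  measurableSet_lt measurable_const (by fun_prop)

lemma integral_sphere_upTail [IsProbabilityMeasure μ] (hn : n ≠ 0) {σ : Measure (Euc n)}
    (hσ : IsUniformSphereMeasure σ) (t : ℝ) :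
    ∫ η, (1 - marginalCDF μ η t) ∂σ = ∫ z, upTail μ t (‖z‖⁻¹ • z) ∂(gaussN n) := by
  simp_rw [one_sub_marginalCDF]
  rw [sphere_eq_map_gaussN hn hσ, integral_map (Measurable.aemeasurable (by fun_prop))
    (measurable_upTail t).aestronglyMeasurable]

lemma integrable_upTail_sphere [IsProbabilityMeasure μ] (t : ℝ) :
    Integrable (fun z => upTail μ t (‖z‖⁻¹ • z)) (gaussN n) :=
  Integrable.of_bound ((measurable_upTail t).comp (by fun_prop)).aestronglyMeasurable 1
    (ae_of_all _ fun z => by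
      rw [norm_of_nonneg (upTail_nonneg t _)]; exact upTail_le_one t _)

lemma meanTail_le_sphere [IsProbabilityMeasure μ] {t e : ℝ} (ht : 0 ≤ t) (he1 : e < 1) :
    meanTail μ t ≤ ∫ z, upTail μ (t / (1 + e)) (‖z‖⁻¹ • z) ∂(gaussN n) +
      (gaussN n).real {z | e < |‖z‖ - 1|} := by
  rw [← integral_indicator_one (measurableSet_norm_dev e)]
  simp only [Pi.one_def]
  rw [← integral_add (integrable_upTail_sphere _)
    ((integrable_const (1:ℝ)).indicator (measurableSet_norm_dev e))]
  refine integral_mono (integrable_upTail t) ((integrable_upTail_sphere _).add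
    ((integrable_const (1:ℝ)).indicator (measurableSet_norm_dev e))) fun z => ?_
  by_cases h : e < |‖z‖ - 1|
  · have h1 := upTail_le_one (μ := μ) t z
    have h2 := upTail_nonneg (μ := μ) (t / (1 + e)) (‖z‖⁻¹ • z)
    simp [h]; linarith
  · simp [h]; exact upTail_le_sphere ht he1 (not_lt.1 h)

lemma sphere_le_meanTail [IsProbabilityMeasure μ] {t e : ℝ} (ht : 0 ≤ t) (he1 : e < 1) :
    ∫ z, upTail μ (t / (1 - e)) (‖z‖⁻¹ • z) ∂(gaussN n) ≤ meanTail μ t +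
      (gaussN n).real {z | e < |‖z‖ - 1|} := by
  unfold meanTail
  rw [← integral_indicator_one (measurableSet_norm_dev e)]
  simp only [Pi.one_def]
  rw [← integral_add (integrable_upTail t)
    ((integrable_const (1:ℝ)).indicator (measurableSet_norm_dev e))]
  refine integral_mono (integrable_upTail_sphere _) ((integrable_upTail t).add
    ((integrable_const (1:ℝ)).indicator (measurableSet_norm_dev e))) fun z => ?_
  by_cases h : e < |‖z‖ - 1|
  · have h1 := upTail_nonneg (μ := μ) t z
    have h2 := upTail_le_one (μ := μ) (t / (1 - e)) (‖z‖⁻¹ • z)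
    simp [h]; linarith
  · simp [h]; exact sphere_le_upTail ht he1 (not_lt.1 h)

end

lemma exp_le_one_add_two_mul {x : ℝ} (h0 : 0 ≤ x) (h1 : x ≤ 1 / 2) : exp x ≤ 1 + 2 * x := by
  have h2 := add_one_le_exp (-x)
  have h3 : exp x * exp (-x) = 1 := by rw [← exp_add]; simp
  have h4 := exp_pos x
  have h5 : exp x * (1 - x) ≤ 1 := by nlinarith
  nlinarith

/-- The Gaussian tail changes by a factor close to one under small shifts. -/
lemma gaussTail_sub_le_mul {t h u : ℝ} (hh : 0 ≤ h) (hht : h ≤ t) (hu : h * (t + 1) ≤ u) (hu1 : u ≤ 1 / 2) :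
    gaussTail (t - h) ≤ (1 + 2 * u) * gaussTail t := by
  have h1 := gaussTail_le_exp_mul (s := t - h) (t := t) (by linarith) (by linarith)
  have h3 : 0 ≤ h * (t + 1) := mul_nonneg hh (by linarith)
  have h2 : exp ((t - (t - h)) * (t + 1)) ≤ 1 + 2 * u := by
    rw [sub_sub_cancel]
    exact (exp_le_one_add_two_mul h3 (by linarith)).trans (by linarith)
  have := gaussTail_pos t
  nlinarith

section
variable {n : ℕ} {μ : Measure (Euc n)}

set_option maxHeartbeats 1000000 in
lemma meanTail_bounds [IsProbabilityMeasure μ] (hn : n ≠ 0) {σ : Measure (Euc n)}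
    (hσ : IsUniformSphereMeasure σ) {T ε : ℝ} (hT : 1 ≤ T) (hε : 0 < ε) (hε1 : ε ≤ 1 / 100)
    (hS : ∀ t ∈ Set.Icc (0:ℝ) T,
        (1 - ε) * (1 - gaussCDF t) ≤ (∫ η, (1 - marginalCDF μ η t) ∂σ) ∧
        (∫ η, (1 - marginalCDF μ η t) ∂σ) ≤ (1 + ε) * (1 - gaussCDF t))
    (hβ : (gaussN n).real {z | ε / (10000 * T ^ 2) < |‖z‖ - 1|} ≤ ε / 10000 * gaussTail (2 * T)) :
    ∀ t, 0 ≤ t → t ≤ T + ε / (2000 * T) → (1 - 6 / 5 * ε) * gaussTail t ≤ meanTail μ t ∧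
      meanTail μ t ≤ (1 + 6 / 5 * ε) * gaussTail t := by
  simp_rw [integral_sphere_upTail hn hσ] at hS
  have hS' : ∀ t, 0 ≤ t → t ≤ T → (1 - ε) * gaussTail t ≤ ∫ z, upTail μ t (‖z‖⁻¹ • z) ∂(gaussN n) ∧
    ∫ z, upTail μ t (‖z‖⁻¹ • z) ∂(gaussN n) ≤ (1 + ε) * gaussTail t := fun t h1 h2 => hS t ⟨h1, h2⟩
  clear hS
  have hT0 : 0 < T := by linarith
  set e := ε / (10000 * T ^ 2) with he
  set β := (gaussN n).real {z | e < |‖z‖ - 1|}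
  have he0 : 0 < e := by positivity
  have heT2 : e * T ^ 2 = ε / 10000 := by rw [he]; field_simp
  have hTT : T ≤ T ^ 2 := by nlinarith
  have heT : e * T ≤ ε / 10000 := by rw [← heT2]; gcongr
  have he1 : e ≤ ε / 10000 := by nlinarith
  have hs : ε / (2000 * T) * T = ε / 2000 := by field_simp
  have hs1 : ε / (2000 * T) ≤ ε / 2000 := by
    have : 0 < ε / (2000 * T) := by positivity
    nlinarith
  have hβQ : ∀ t, t ≤ 2 * T → β ≤ ε / 10000 * gaussTail t := fun t ht =>
    hβ.trans (by gcongr; exact gaussTail_strictAnti.antitone ht)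
  -- upper bound on `[0, T]`
  have hup : ∀ t, 0 ≤ t → t ≤ T → meanTail μ t ≤ (1 + 11 / 10 * ε) * gaussTail t := by
    intro t h0 h1
    have h2 := meanTail_le_sphere (μ := μ) (e := e) h0 (by linarith)
    have h3 := (hS' (t / (1 + e)) (by positivity) ((div_le_self h0 (by linarith)).trans h1)).2
    have hd : t - t / (1 + e) ≤ t * e := by
      have : t - t / (1 + e) = t * e / (1 + e) := by field_simp; ring
      rw [this]; exact div_le_self (by positivity) (by linarith)
    have hd0 : 0 ≤ t - t / (1 + e) := by
      have := div_le_self h0 (show 1 ≤ 1 + e by linarith)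
      linarith
    have h4 := gaussTail_sub_le_mul (t := t) (h := t - t / (1 + e)) (u := ε / 5000) hd0
      (by have : 0 ≤ t / (1 + e) := by positivity
          linarith) (by
        have : (t - t / (1 + e)) * (t + 1) ≤ (t * e) * (T + 1) := by gcongr
        have : t * e * (T + 1) ≤ T * e * (T + 1) := by gcongr
        nlinarith) (by linarith)
    rw [sub_sub_cancel] at h4
    have h5 := hβQ t (by linarith)
    have hQ := gaussTail_pos t
    calc meanTail μ t ≤ (1 + ε) * gaussTail (t / (1 + e)) + β := by linarith
      _ ≤ (1 + ε) * ((1 + 2 * (ε / 5000)) * gaussTail t) + ε / 10000 * gaussTail t := by gcongr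
      _ = ((1 + ε) * (1 + 2 * (ε / 5000)) + ε / 10000) * gaussTail t := by ring
      _ ≤ _ := mul_le_mul_of_nonneg_right (by nlinarith) hQ.le
  have hlo : ∀ t, 0 ≤ t → t ≤ T * (1 - e) → (1 - 11 / 10 * ε) * gaussTail t ≤ meanTail μ t := by
    intro t h0 h1
    have h1e : 0 < 1 - e := by linarith
    have h2 := sphere_le_meanTail (μ := μ) (e := e) h0 (by linarith)
    have hle : t / (1 - e) ≤ T := by rw [div_le_iff₀ h1e]; exact h1
    have h00 : 0 ≤ t / (1 - e) := by positivity
    have h3 := (hS' (t / (1 - e)) h00 hle).1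
    have hd : t / (1 - e) - t = e * (t / (1 - e)) := by field_simp; ring
    have h4 := gaussTail_sub_le_mul (t := t / (1 - e)) (h := t / (1 - e) - t) (u := ε / 5000)
      (by rw [hd]; positivity) (by linarith) (by
        rw [hd]
        have : e * (t / (1 - e)) * (t / (1 - e) + 1) ≤ e * T * (T + 1) := by gcongr
        nlinarith) (by linarith)
    rw [sub_sub_cancel] at h4
    have h5 := hβQ t (by nlinarith)
    have hQ := gaussTail_pos t
    have hQ' := gaussTail_pos (t / (1 - e))
    have h6 : (1 - 2 * (ε / 5000)) * gaussTail t ≤ gaussTail (t / (1 - e)) := by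
      have : (1 - 2 * (ε / 5000)) * gaussTail t ≤ (1 - 2 * (ε / 5000)) * ((1 + 2 * (ε / 5000)) * gaussTail (t / (1 - e))) := by
        gcongr; linarith
      nlinarith [sq_nonneg ε]
    have h7 : (1 - ε) * ((1 - 2 * (ε / 5000)) * gaussTail t) ≤ (1 - ε) * gaussTail (t / (1 - e)) := by
      gcongr; linarith
    have h8 : (1 - 11 / 10 * ε) * gaussTail t ≤ ((1 - ε) * (1 - 2 * (ε / 5000)) - ε / 10000) * gaussTail t :=
      mul_le_mul_of_nonneg_right (by nlinarith) hQ.le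
    linarith
  intro t h0 ht
  have hQ := gaussTail_pos t
  constructor
  · rcases le_or_gt t (T * (1 - e)) with h | h
    · exact le_trans (mul_le_mul_of_nonneg_right (by linarith) hQ.le) (hlo t h0 h)
    set b := T * (1 - e) with hb
    have hb' : b = T - e * T := by rw [hb]; ring
    have hb1 : 99 / 100 ≤ b := by linarith
    set a := √(b ^ 2 - 1 / 4) with ha
    have ha2 : a ^ 2 = b ^ 2 - 1 / 4 := by rw [ha]; exact sq_sqrt (by nlinarith only [hb1])
    have hapos : 0 < a := sqrt_pos.2 (by nlinarith only [hb1])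
    have hab : a < b := by
      by_contra! hcon
      nlinarith only [hcon, ha2, hapos, hb1]
    have hbT : b ≤ T := by
      have : 0 < e * T := by positivity
      linarith
    have hcv := meanTail_convex (μ := μ) hapos hab h
    have hDa := hup a hapos.le (by linarith)
    have hQa : gaussTail a ≤ 2 * gaussTail b := by
      have h1 := gaussTail_le_exp_mul hapos.le hab.le
      have h2 : (b - a) * (b + 1) ≤ 6 / 10 := by
        have h3 : (b - a) * (b + a) = 1 / 4 := by linear_combination -ha2
        have h4 : (b - a) * (b + 1) ≤ (b - a) * (12 / 5 * (b + a)) :=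
          mul_le_mul_of_nonneg_left (by linarith) (by linarith)
        linarith
      have h5 : exp ((b - a) * (b + 1)) ≤ 2 := by
        refine (exp_le_exp.2 h2).trans ?_
        have := Real.exp_one_lt_d9
        have h6 : exp (6 / 10 : ℝ) ^ 5 = exp 1 ^ 3 := by
          rw [← exp_nat_mul, ← exp_nat_mul]; norm_num
        by_contra! hcon
        have h7 : (2:ℝ) ^ 5 < exp (6 / 10 : ℝ) ^ 5 := by gcongr
        have h8 : exp 1 ^ 3 < (2.7182818286:ℝ) ^ 3 := by gcongr
        have h9 : (2.7182818286:ℝ) ^ 3 < 2 ^ 5 := by norm_num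
        rw [h6] at h7
        linarith only [h7, h8, h9]
      have := mul_le_mul_of_nonneg_left h5 (gaussTail_pos b).le
      linarith
    have hDb := hlo b (by linarith) le_rfl
    have hQb := gaussTail_pos b
    have hbt : gaussTail t ≤ gaussTail b := gaussTail_strictAnti.antitone h.le
    have hDa' : meanTail μ a ≤ 3 * gaussTail b := by
      refine hDa.trans ?_
      calc _ ≤ (1 + 11 / 10 * ε) * (2 * gaussTail b) := by gcongr
        _ = (1 + 11 / 10 * ε) * 2 * gaussTail b := by ring
        _ ≤ _ := mul_le_mul_of_nonneg_right (by linarith) hQb.le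
    have hdt : t ^ 2 - b ^ 2 ≤ 19 / 10000 * ε := by
      have h1 : t - b ≤ ε / (2000 * T) + e * T := by linarith
      have h2 : t + b ≤ 3 * T := by linarith
      have h3 : (t - b) * (t + b) ≤ (ε / (2000 * T) + e * T) * (3 * T) := by
        gcongr
      have h4 : (ε / (2000 * T) + e * T) * (3 * T) = 3 * (ε / 2000 + ε / 10000) := by
        rw [← hs, ← heT2]; ring
      have h5 : t ^ 2 - b ^ 2 = (t - b) * (t + b) := by ring
      linarith
    have hdt0 : 0 < t ^ 2 - b ^ 2 := by nlinarith only [h, hb1]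
    set d := t ^ 2 - b ^ 2 with hd
    have e1 : t ^ 2 - a ^ 2 = d + 1 / 4 := by rw [ha2, hd]; ring
    have e2 : b ^ 2 - a ^ 2 = 1 / 4 := by rw [ha2]; ring
    rw [e1, e2] at hcv
    have h9 : d * meanTail μ a ≤ d * (3 * gaussTail b) := by gcongr
    have h10 : d * ((1 - 11 / 10 * ε) * gaussTail b) ≤ d * meanTail μ b := by gcongr
    have h10' : 0 ≤ d * ((1 - 11 / 10 * ε) * gaussTail b) := by
      have : 0 ≤ 1 - 11 / 10 * ε := by linarith
      positivity
    have h11 : d * (3 * gaussTail b) ≤ (19 / 10000 * ε) * (3 * gaussTail b) := by gcongr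
    have h12 : (1 - 6 / 5 * ε) * gaussTail b ≤ meanTail μ t := by
      have : 0 ≤ ε * gaussTail b := by positivity
      nlinarith only [h9, h10, h10', h11, hcv, hDb, this]
    refine le_trans ?_ h12
    exact mul_le_mul_of_nonneg_left hbt (by linarith)
  · rcases le_or_gt t T with h | h
    · exact (hup t h0 h).trans (mul_le_mul_of_nonneg_right (by linarith) hQ.le)
    have h1 := hup T hT0.le le_rfl
    have h2 := gaussTail_sub_le_mul (t := t) (h := t - T) (u := ε / 600) (by linarith) (by linarith) (by
      have h3 : (t - T) * (t + 1) ≤ (ε / (2000 * T)) * (3 * T) := by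
        gcongr <;> linarith
      linarith) (by linarith)
    rw [sub_sub_cancel] at h2
    calc meanTail μ t ≤ meanTail μ T := meanTail_antitone h.le
      _ ≤ (1 + 11 / 10 * ε) * gaussTail T := h1
      _ ≤ (1 + 11 / 10 * ε) * ((1 + 2 * (ε / 600)) * gaussTail t) := by gcongr
      _ = (1 + 11 / 10 * ε) * (1 + 2 * (ε / 600)) * gaussTail t := by ring
      _ ≤ _ := mul_le_mul_of_nonneg_right (by nlinarith only [hε, hε1]) hQ.le

end

section
variable {n : ℕ} {μ : Measure (Euc n)}

lemma gaussN_real_le_of_far (hn : n ≠ 0) {A B : Set (Euc n)} (hA : MeasurableSet A)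
    (hB : MeasurableSet B) {δ α : ℝ} (hδ : 0 ≤ δ) (h : ∀ z ∈ A, ∀ w ∈ B, δ ≤ dist w z) (hα : 0 < α)
    (hαA : α ≤ (gaussN n).real A) :
    (gaussN n).real B ≤ α⁻¹ * exp (-(n * δ ^ 2 / 5)) := by
  have h1 := gaussN_mul_le hn hA hB hδ h
  have h2 : α * (gaussN n).real B ≤ exp (-(n * δ ^ 2 / 5)) := by
    refine le_trans ?_ h1
    gcongr
  rwa [inv_mul_eq_div, le_div_iff₀' hα]

/-- Markov's inequality for the upper tails. -/
lemma upTail_markov [IsFiniteMeasure μ] (t : ℝ) {a : ℝ} (ha : 0 < a) :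
    1 - meanTail μ t / a ≤ (gaussN n).real {z | upTail μ t z ≤ a} := by
  have h1 := mul_meas_ge_le_integral_of_nonneg (μ := gaussN n) (f := upTail μ t)
    (ae_of_all _ (upTail_nonneg t)) (integrable_upTail t) a
  have h2 : {z | upTail μ t z ≤ a}ᶜ ⊆ {z | a ≤ upTail μ t z} := by
    intro z hz; simp only [mem_compl_iff, mem_ofPred_eq, not_le] at hz ⊢; exact hz.le
  have h3 := measureReal_mono (μ := gaussN n) h2
  rw [probReal_compl_eq_one_sub (measurableSet_le (measurable_upTail t) measurable_const)] at h3
  have h4 : (gaussN n).real {z | a ≤ upTail μ t z} ≤ meanTail μ t / a := by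
    rw [le_div_iff₀' ha]; exact h1
  linarith

lemma dist_ge_of_upTail_lt {C₀ c₀ : ℝ} [IsFiniteMeasure μ] (hC₀ : 0 < C₀) (hc₀ : 0 < c₀)
    (hψ : HasPsiOneMarginals μ C₀ c₀) {z w : Euc n} {δ h t : ℝ}
    (hh : 0 ≤ h) (hlt : upTail μ (t - h) z + C₀ * exp (-(c₀ * h / δ)) < upTail μ t w) :
    δ ≤ dist w z := by
  by_contra! hcon
  rw [dist_eq_norm] at hcon
  exact absurd (upTail_shift_le (t := t) hC₀ hc₀ hψ hcon.le hh) (not_le.2 hlt)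

/-- Crude large deviation bound for the upper tails. -/
lemma upTail_large_le {C₀ c₀ : ℝ} [IsProbabilityMeasure μ] (hn : n ≠ 0) (hC₀ : 0 < C₀) (hc₀ : 0 < c₀)
    (hψ : HasPsiOneMarginals μ C₀ c₀) {T T' A t : ℝ} (hT : 1 ≤ T) (hA0 : 0 < A)
    (hT' : T' ≤ 101 / 100 * T)
    (hD : ∀ t, 0 ≤ t → t ≤ T' → meanTail μ t ≤ 5 / 4 * gaussTail t)
    (hA : C₀ * exp (-(c₀ * (A * T ^ 2))) ≤ gaussTail T') (ht0 : 0 ≤ t) (ht : t ≤ T') (u : ℕ) (hu : 1 ≤ u) :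
    (gaussN n).real {z | 4 * exp (3 * u) * gaussTail t < upTail μ t z} ≤
      2 * exp (-(u * (n / (5 * A ^ 2 * T ^ 6)))) := by
  have hu1 : (1:ℝ) ≤ u := by exact_mod_cast hu
  have hT0 : 0 < T := by linarith
  rcases lt_or_ge t (u / T) with h | h
  · have : {z : Euc n | 4 * exp (3 * u) * gaussTail t < upTail μ t z} = ∅ := by
      rw [Set.eq_empty_iff_forall_notMem]
      intro z hz
      have h1 := hz.trans_le (upTail_le_one t z)
      have h2 := gaussTail_lower ht0
      have h3 : t * T < u := by rwa [lt_div_iff₀ hT0] at h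
      have h4 : 1 ≤ exp (3 * u) * exp (-(t ^ 2 + t)) := by
        rw [← exp_add]
        apply one_le_exp
        nlinarith
      have h5 : exp (3 * u) * (exp (-(t ^ 2 + t)) / 2) ≤ exp (3 * u) * gaussTail t := by gcongr
      nlinarith
    rw [this, measureReal_empty]; positivity
  · set h' : ℝ := u / T with hh'
    have hh0 : 0 < h' := by positivity
    have hQ := gaussTail_pos t
    have hQ' := gaussTail_pos (t - h')
    have hα : (1 / 2 : ℝ) ≤ (gaussN n).real {z | upTail μ (t - h') z ≤ 5 / 2 * gaussTail (t - h')} := by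
      refine le_trans ?_ (upTail_markov _ (by positivity))
      have := hD (t - h') (by linarith) (by linarith)
      have h2 : meanTail μ (t - h') / (5 / 2 * gaussTail (t - h')) ≤ 1 / 2 := by
        rw [div_le_iff₀ (by positivity)]; linarith
      linarith
    have key := gaussN_real_le_of_far (δ := h' / (A * T ^ 2)) hn (measurableSet_le (measurable_upTail (μ := μ) (t - h')) measurable_const)
      (measurableSet_lt measurable_const (measurable_upTail t) : MeasurableSet {z | 4 * exp (3 * u) * gaussTail t < upTail μ t z}) (by positivity) ?_ (by norm_num) hα
    · refine key.trans ?_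
      rw [one_div, inv_inv]
      gcongr
      have : (n:ℝ) * (h' / (A * T ^ 2)) ^ 2 / 5 = u ^ 2 * (n / (5 * A ^ 2 * T ^ 6)) := by
        rw [hh']; field_simp
      rw [this]
      gcongr
      nlinarith
    · intro z hz w hw
      apply dist_ge_of_upTail_lt hC₀ hc₀ hψ hh0.le (t := t)
      refine lt_of_le_of_lt ?_ hw
      have e1 : c₀ * h' / (h' / (A * T ^ 2)) = c₀ * (A * T ^ 2) := by field_simp
      rw [e1]
      have h1 := gaussTail_le_exp_mul (s := t - h') (t := t) (by linarith) (by linarith)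
      have h2 : (t - (t - h')) * (t + 1) ≤ 201 / 100 * u := by
        rw [sub_sub_cancel, hh']
        calc u / T * (t + 1) ≤ u / T * (201 / 100 * T) := by gcongr; linarith
          _ = _ := by field_simp
      have h3 : gaussTail (t - h') ≤ gaussTail t * exp (201 / 100 * u) := h1.trans (by gcongr)
      have h4 : gaussTail T' ≤ gaussTail t := gaussTail_strictAnti.antitone ht
      have h5 : exp (201 / 100 * (u:ℝ)) ≤ exp (3 * u) := by gcongr; norm_num
      have h6 : 1 ≤ exp (3 * (u:ℝ)) := one_le_exp (by positivity)
      have hz' : upTail μ (t - h') z ≤ 5 / 2 * gaussTail (t - h') := hz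
      calc _ ≤ 5 / 2 * (gaussTail t * exp (3 * u)) + exp (3 * u) * gaussTail t := by
            refine add_le_add (hz'.trans ?_) (hA.trans (h4.trans ?_))
            · gcongr; exact h3.trans (by gcongr)
            · exact le_mul_of_one_le_left hQ.le h6
        _ ≤ _ := by nlinarith [mul_pos hQ (exp_pos (3 * (u:ℝ)))]

lemma exists_level {N q : ℝ} (hq : 0 < q) (hN : exp 3 * q < N) :
    ∃ k : ℕ, exp (3 * ((k + 1 : ℕ) : ℝ)) * q < N ∧ N ≤ exp (3 * ((k + 2 : ℕ) : ℝ)) * q := by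
  have hex : ∃ k : ℕ, N ≤ exp (3 * ((k + 2 : ℕ) : ℝ)) * q := by
    obtain ⟨k, hk⟩ := exists_nat_ge (N / q)
    refine ⟨k, ?_⟩
    rw [← div_le_iff₀ hq]
    refine hk.trans ?_
    have := add_one_le_exp (3 * ((k + 2 : ℕ) : ℝ))
    push_cast at this ⊢
    have : (0:ℝ) ≤ k := Nat.cast_nonneg k
    linarith
  classical
  refine ⟨Nat.find hex, ?_, Nat.find_spec hex⟩
  rcases Nat.eq_zero_or_pos (Nat.find hex) with h | h
  · rw [h]; simpa using hN
  · have := Nat.find_min hex (Nat.sub_lt h one_pos)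
    rw [not_le] at this
    have e : Nat.find hex - 1 + 2 = Nat.find hex + 1 := by omega
    rwa [e] at this

/-- The contribution of the directions with abnormally large upper tail to the mean is small. -/
lemma setIntegral_upTail_large_le {C₀ c₀ : ℝ} [IsProbabilityMeasure μ] (hn : n ≠ 0) (hC₀ : 0 < C₀) (hc₀ : 0 < c₀)
    (hψ : HasPsiOneMarginals μ C₀ c₀) {T T' A t : ℝ} (hT : 1 ≤ T) (hA0 : 0 < A)
    (hT' : T' ≤ 101 / 100 * T)
    (hD : ∀ t, 0 ≤ t → t ≤ T' → meanTail μ t ≤ 5 / 4 * gaussTail t)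
    (hA : C₀ * exp (-(c₀ * (A * T ^ 2))) ≤ gaussTail T') (ht0 : 0 ≤ t) (ht : t ≤ T')
    (hG : 7 ≤ n / (5 * A ^ 2 * T ^ 6)) :
    ∫ z in {z | 4 * exp 3 * gaussTail t < upTail μ t z}, upTail μ t z ∂(gaussN n) ≤
      16 * exp (6 - n / (5 * A ^ 2 * T ^ 6)) * gaussTail t := by
  set G := n / (5 * A ^ 2 * T ^ 6) with hGdef
  set q := 4 * gaussTail t with hq
  have hq0 : 0 < q := by have := gaussTail_pos t; positivity
  obtain ⟨K, hK⟩ := exists_nat_ge (1 / q)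
  have hms : ∀ k : ℕ, MeasurableSet {z : Euc n | exp (3 * ((k + 1 : ℕ) : ℝ)) * q < upTail μ t z} := fun k =>
    measurableSet_lt measurable_const (measurable_upTail t)
  have hm : MeasurableSet {z : Euc n | 4 * exp 3 * gaussTail t < upTail μ t z} :=
    measurableSet_lt measurable_const (measurable_upTail t)
  have hint : ∀ k : ℕ, Integrable ({z : Euc n | exp (3 * ((k + 1 : ℕ) : ℝ)) * q < upTail μ t z}.indicator
      (fun _ => exp (3 * ((k + 2 : ℕ) : ℝ)) * q)) (gaussN n) := fun k => (integrable_const _).indicator (hms k)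
  have hpt : ∀ z : Euc n, {z : Euc n | 4 * exp 3 * gaussTail t < upTail μ t z}.indicator (upTail μ t) z ≤
      ∑ k ∈ Finset.range K, {z : Euc n | exp (3 * ((k + 1 : ℕ) : ℝ)) * q < upTail μ t z}.indicator
        (fun _ => exp (3 * ((k + 2 : ℕ) : ℝ)) * q) z := by
    intro z
    have hnn : ∀ k : ℕ, 0 ≤ {z : Euc n | exp (3 * ((k + 1 : ℕ) : ℝ)) * q < upTail μ t z}.indicator
        (fun _ => exp (3 * ((k + 2 : ℕ) : ℝ)) * q) z := fun k => indicator_nonneg (fun _ _ => by positivity) _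
    by_cases hz : z ∈ {z : Euc n | 4 * exp 3 * gaussTail t < upTail μ t z}
    · rw [indicator_of_mem hz]
      obtain ⟨k, hk1, hk2⟩ := exists_level (N := upTail μ t z) hq0 (by
        have : 4 * exp 3 * gaussTail t < upTail μ t z := hz
        rw [hq]; linarith)
      have hkK : k < K := by
        by_contra! hcon
        have h1 : exp (3 * ((k + 1 : ℕ) : ℝ)) * q < 1 := hk1.trans_le (upTail_le_one t z)
        have h2 := add_one_le_exp (3 * ((k + 1 : ℕ) : ℝ))
        have h3 : (K:ℝ) ≤ k := by exact_mod_cast hcon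
        rw [div_le_iff₀ hq0] at hK
        have h4 : (K:ℝ) * q ≤ exp (3 * ((k + 1 : ℕ) : ℝ)) * q := by
          gcongr
          push_cast at h2 ⊢
          have : (0:ℝ) ≤ k := Nat.cast_nonneg k
          linarith
        linarith
      refine le_trans ?_ (Finset.single_le_sum (f := fun k : ℕ => {z : Euc n | exp (3 * ((k + 1 : ℕ) : ℝ)) * q < upTail μ t z}.indicator
        (fun _ => exp (3 * ((k + 2 : ℕ) : ℝ)) * q) z) (fun k _ => hnn k) (Finset.mem_range.2 hkK))
      rw [indicator_of_mem (show z ∈ {z : Euc n | exp (3 * ((k + 1 : ℕ) : ℝ)) * q < upTail μ t z} from hk1)]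
      exact hk2
    · rw [indicator_of_notMem hz]
      exact Finset.sum_nonneg fun k _ => hnn k
  rw [← integral_indicator hm]
  calc _ ≤ ∫ z, ∑ k ∈ Finset.range K, {z : Euc n | exp (3 * ((k + 1 : ℕ) : ℝ)) * q < upTail μ t z}.indicator
        (fun _ => exp (3 * ((k + 2 : ℕ) : ℝ)) * q) z ∂(gaussN n) :=
        integral_mono ((integrable_upTail t).indicator hm) (integrable_finsetSum _ fun k _ => hint k) hpt
    _ = ∑ k ∈ Finset.range K, (gaussN n).real {z : Euc n | exp (3 * ((k + 1 : ℕ) : ℝ)) * q < upTail μ t z} *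
          (exp (3 * ((k + 2 : ℕ) : ℝ)) * q) := by
        rw [integral_finsetSum _ fun k _ => hint k]
        refine Finset.sum_congr rfl fun k _ => ?_
        rw [integral_indicator_const _ (hms k), smul_eq_mul]
    _ ≤ ∑ k ∈ Finset.range K, (2 * q * exp (6 - G)) * (1 / 2) ^ k := by
        refine Finset.sum_le_sum fun k _ => ?_
        have h1 := upTail_large_le (t := t) hn hC₀ hc₀ hψ hT hA0 hT' hD hA ht0 ht (k + 1) (by omega)
        have e : 4 * exp (3 * ((k + 1 : ℕ) : ℝ)) * gaussTail t = exp (3 * ((k + 1 : ℕ) : ℝ)) * q := by rw [hq]; ring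
        rw [e, ← hGdef] at h1
        have h2 : exp (3 * ((k + 2 : ℕ) : ℝ)) * exp (-(((k + 1 : ℕ) : ℝ) * G)) ≤ exp (6 - G) * (1 / 2) ^ k := by
          have e2 : exp (3 * ((k + 2 : ℕ) : ℝ)) * exp (-(((k + 1 : ℕ) : ℝ) * G)) = exp (6 - G) * exp (3 - G) ^ k := by
            rw [← exp_nat_mul, ← exp_add, ← exp_add]
            congr 1; push_cast; ring
          rw [e2]
          gcongr
          have h3 : exp (3 - G) ≤ exp (-1) := exp_le_exp.2 (by linarith)
          have h4 := Real.exp_neg_one_lt_d9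
          linarith
        calc _ ≤ 2 * exp (-(((k + 1 : ℕ) : ℝ) * G)) * (exp (3 * ((k + 2 : ℕ) : ℝ)) * q) := by gcongr
          _ = 2 * q * (exp (3 * ((k + 2 : ℕ) : ℝ)) * exp (-(((k + 1 : ℕ) : ℝ) * G))) := by ring
          _ ≤ 2 * q * (exp (6 - G) * (1 / 2) ^ k) := by gcongr
          _ = _ := by ring
    _ ≤ 2 * q * exp (6 - G) * 2 := by
        rw [← Finset.mul_sum]
        gcongr
        exact sum_geometric_two_le K
    _ = _ := by rw [hq]; ring

end

section
variable {n : ℕ} {μ : Measure (Euc n)}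

/-- A lower bound for the Gaussian measure of an upper level set of an upper tail. -/
lemma le_measure_upTail_ge [IsProbabilityMeasure μ] {t a b r : ℝ} (ha : 0 ≤ a) (hb : 0 ≤ b)
    (hlarge : ∫ z in {z | b < upTail μ t z}, upTail μ t z ∂(gaussN n) ≤ r) :
    meanTail μ t ≤ a + (gaussN n).real {z : Euc n | a ≤ upTail μ t z} * b + r := by
  set E := {z : Euc n | b < upTail μ t z} with hE
  have hEm : MeasurableSet E := measurableSet_lt measurable_const (measurable_upTail t)
  set S := {z : Euc n | a ≤ upTail μ t z} with hS
  have hSm : MeasurableSet S := measurableSet_le measurable_const (measurable_upTail t)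
  have hpt : ∀ z : Euc n, upTail μ t z ≤ a +
      S.indicator (fun _ => b) z + E.indicator (upTail μ t) z := by
    intro z
    have h16 : 0 ≤ S.indicator (fun _ => b) z := indicator_nonneg (fun _ _ => hb) _
    by_cases hz : z ∈ E
    · rw [indicator_of_mem hz (upTail μ t)]; linarith
    · rw [indicator_of_notMem hz]
      by_cases hz' : z ∈ S
      · rw [indicator_of_mem hz']
        have : upTail μ t z ≤ b := not_lt.1 hz
        linarith
      · have : upTail μ t z < a := not_le.1 hz'
        linarith
  have i1 : Integrable (fun _ : Euc n => a) (gaussN n) := integrable_const _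
  have i2 : Integrable (S.indicator (fun _ : Euc n => b)) (gaussN n) :=
    (integrable_const _).indicator hSm
  have i3 : Integrable (E.indicator (upTail μ t)) (gaussN n) := (integrable_upTail t).indicator hEm
  have i12 : Integrable (fun z : Euc n => a + S.indicator (fun _ : Euc n => b) z) (gaussN n) := i1.add i2
  refine (integral_mono (integrable_upTail t) (i12.add i3) hpt).trans ?_
  change ∫ z, (a + S.indicator (fun _ => b) z + E.indicator (upTail μ t) z) ∂(gaussN n) ≤ _
  rw [integral_add i12 i3, integral_add i1 i2, integral_indicator hEm, integral_indicator_const _ hSm]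
  simpa using hlarge

set_option maxHeartbeats 1000000 in
/-- Concentration of the upper tails when `ε` is not too small compared with `exp (-T²)`. -/
lemma upTail_concentration_moderate {C₀ c₀ : ℝ} [IsProbabilityMeasure μ] (hn : n ≠ 0) (hC₀ : 0 < C₀) (hc₀ : 0 < c₀)
    (hψ : HasPsiOneMarginals μ C₀ c₀) {T ε A : ℝ} (hT : 1 ≤ T) (hε : 0 < ε) (hε1 : ε ≤ 1 / 100) (hA0 : 0 < A)
    (hD : ∀ t, 0 ≤ t → t ≤ T + ε / (2000 * T) → (1 - 6 / 5 * ε) * gaussTail t ≤ meanTail μ t ∧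
      meanTail μ t ≤ (1 + 6 / 5 * ε) * gaussTail t)
    (hA : C₀ * exp (-(c₀ * (A * T ^ 2))) ≤ ε / 10000 * gaussTail (T + ε / (2000 * T)))
    (hG : 16 * exp (6 - n / (5 * A ^ 2 * T ^ 6)) ≤ ε)
    {τ : ℝ} (hτ0 : ε / (10000 * T) ≤ τ) (hτ : τ ≤ T + ε / (5000 * T)) :
    (gaussN n).real {z | (1 + 8 * ε) * gaussTail τ < upTail μ τ z} ≤
      30 / ε * exp (-(n * ε ^ 2 / (5 * 10 ^ 8 * A ^ 2 * T ^ 6))) ∧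
    (gaussN n).real {z | upTail μ τ z < (1 - 8 * ε) * gaussTail τ} ≤
      30 / ε * exp (-(n * ε ^ 2 / (5 * 10 ^ 8 * A ^ 2 * T ^ 6))) := by
  have hT0 : 0 < T := by linarith
  set h := ε / (10000 * T) with hh
  have hh0 : 0 < h := by positivity
  have hhT : h * T = ε / 10000 := by rw [hh]; field_simp
  have e5 : ε / (2000 * T) = 5 * h := by rw [hh]; field_simp; norm_num
  have e2 : ε / (5000 * T) = 2 * h := by rw [hh]; field_simp; norm_num
  rw [e5] at hD hA
  rw [e2] at hτ
  have hh1 : h ≤ ε / 10000 := by nlinarith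
  set δ := h / (A * T ^ 2) with hδ
  have hδ0 : 0 < δ := by positivity
  have eδ : c₀ * h / δ = c₀ * (A * T ^ 2) := by rw [hδ]; field_simp
  have eδ2 : (n:ℝ) * δ ^ 2 / 5 = n * ε ^ 2 / (5 * 10 ^ 8 * A ^ 2 * T ^ 6) := by
    rw [hδ, hh]; field_simp; norm_num
  have hQτ := gaussTail_pos τ
  have hQ5 : gaussTail (T + 5 * h) ≤ gaussTail τ := gaussTail_strictAnti.antitone (by linarith)
  have hA' : C₀ * exp (-(c₀ * h / δ)) ≤ ε / 10000 * gaussTail τ := by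
    rw [eδ]; exact hA.trans (by gcongr)
  have hshift : ∀ t, h ≤ t → t ≤ T + 3 * h → gaussTail (t - h) ≤ (1 + ε / 1000) * gaussTail t := by
    intro t h1 h2
    have h3 := gaussTail_sub_le_mul (t := t) (h := h) (u := ε / 2000) hh0.le h1 (by
      have : h * (t + 1) ≤ h * (T + 3 * h + 1) := by gcongr
      nlinarith) (by linarith)
    refine h3.trans_eq ?_
    ring
  constructor
  · have hQ := gaussTail_pos (τ - h)
    have hDτ := (hD (τ - h) (by linarith) (by linarith)).2
    have hα : ε ≤ (gaussN n).real {z | upTail μ (τ - h) z ≤ (1 + 3 * ε) * gaussTail (τ - h)} := by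
      refine le_trans ?_ (upTail_markov _ (by positivity))
      rw [le_sub_comm, div_le_iff₀ (by positivity)]
      have : (1 + 6 / 5 * ε) * gaussTail (τ - h) ≤ ((1 - ε) * (1 + 3 * ε)) * gaussTail (τ - h) := by
        refine mul_le_mul_of_nonneg_right ?_ hQ.le
        nlinarith
      linarith
    have key := gaussN_real_le_of_far (δ := δ) hn (measurableSet_le (measurable_upTail (μ := μ) (τ - h)) measurable_const)
      (measurableSet_lt measurable_const (measurable_upTail τ) : MeasurableSet {z | (1 + 8 * ε) * gaussTail τ < upTail μ τ z}) hδ0.le ?_ hε hα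
    · rw [eδ2] at key
      refine key.trans ?_
      gcongr
      rw [inv_eq_one_div]
      gcongr
      norm_num
    · intro z hz w hw
      apply dist_ge_of_upTail_lt hC₀ hc₀ hψ hh0.le (t := τ)
      refine lt_of_le_of_lt ?_ hw
      have hz' : upTail μ (τ - h) z ≤ (1 + 3 * ε) * gaussTail (τ - h) := hz
      have h1 := hshift τ hτ0 (by linarith)
      calc upTail μ (τ - h) z + C₀ * exp (-(c₀ * h / δ)) ≤ (1 + 3 * ε) * ((1 + ε / 1000) * gaussTail τ) +
            ε / 10000 * gaussTail τ := add_le_add (hz'.trans (by gcongr)) hA'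
        _ = ((1 + 3 * ε) * (1 + ε / 1000) + ε / 10000) * gaussTail τ := by ring
        _ ≤ _ := mul_le_mul_of_nonneg_right (by nlinarith) hQτ.le
  · set t := τ + h with ht
    have hQ := gaussTail_pos t
    have hDt := (hD t (by linarith) (by linarith)).1
    have hG7 : 7 ≤ n / (5 * A ^ 2 * T ^ 6) := by
      by_contra! hcon
      have h1 := add_one_le_exp (6 - n / (5 * A ^ 2 * T ^ 6))
      have h2 : exp (-1 : ℝ) ≤ exp (6 - n / (5 * A ^ 2 * T ^ 6)) := exp_le_exp.2 (by linarith)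
      have := Real.exp_neg_one_gt_d9
      linarith
    have hlarge := setIntegral_upTail_large_le (t := t) (T' := T + 5 * h) hn hC₀ hc₀ hψ hT hA0 (by nlinarith)
      (fun s hs hs' => (hD s hs hs').2.trans (mul_le_mul_of_nonneg_right (by linarith) (gaussTail_pos s).le))
      (hA.trans (mul_le_of_le_one_left (gaussTail_pos _).le (by linarith))) (by linarith) (by linarith) hG7
    set S := {z : Euc n | (1 - 5 * ε) * gaussTail t ≤ upTail μ t z} with hS
    have hSm : MeasurableSet S := measurableSet_le measurable_const (measurable_upTail t)
    have hα : ε / 30 ≤ (gaussN n).real S := by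
      have hI2 := le_measure_upTail_ge (a := (1 - 5 * ε) * gaussTail t) (mul_nonneg (by linarith) hQ.le)
        (by positivity) hlarge
      rw [← hS] at hI2
      have h6 : 16 * exp (6 - n / (5 * A ^ 2 * T ^ 6)) * gaussTail t ≤ ε * gaussTail t := by gcongr
      have h7 : (1 - 6 / 5 * ε) * gaussTail t - (1 - 5 * ε) * gaussTail t - ε * gaussTail t ≤
        (gaussN n).real S * (4 * exp 3) * gaussTail t := by linarith
      have h8 : 14 / 5 * ε ≤ (gaussN n).real S * (4 * exp 3) := by
        have : (14 / 5 * ε) * gaussTail t ≤ ((gaussN n).real S * (4 * exp 3)) * gaussTail t := by linarith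
        exact le_of_mul_le_mul_right this hQ
      have h9 : 4 * exp 3 ≤ 84 := by
        have := Real.exp_one_lt_d9
        have h10 : exp 1 ^ 3 ≤ (2.7182818286:ℝ) ^ 3 := by gcongr
        have h11 : exp 1 ^ 3 = exp 3 := by rw [← exp_nat_mul]; norm_num
        rw [← h11]
        refine (mul_le_mul_of_nonneg_left h10 (by norm_num)).trans ?_
        norm_num
      have h12 : 0 ≤ (gaussN n).real S := measureReal_nonneg
      nlinarith
    have key := gaussN_real_le_of_far (δ := δ) hn hSm
      (measurableSet_lt (measurable_upTail τ) measurable_const : MeasurableSet {z | upTail μ τ z < (1 - 8 * ε) * gaussTail τ}) hδ0.le ?_ (by positivity) hα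
    · rw [eδ2] at key
      refine key.trans_eq ?_
      rw [inv_div]
    · intro z hz w hw
      rw [dist_comm]
      apply dist_ge_of_upTail_lt hC₀ hc₀ hψ hh0.le (t := t)
      have hz' : (1 - 5 * ε) * gaussTail t ≤ upTail μ t z := hz
      refine lt_of_lt_of_le ?_ hz'
      have hw' : upTail μ τ w < (1 - 8 * ε) * gaussTail τ := hw
      have h1 := hshift t (by linarith) (by linarith)
      rw [ht, add_sub_cancel_right, ← ht] at h1
      rw [ht, add_sub_cancel_right, ← ht]
      calc upTail μ τ w + C₀ * exp (-(c₀ * h / δ)) < (1 - 8 * ε) * gaussTail τ + ε / 10000 * gaussTail τ :=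
            add_lt_add_of_lt_of_le hw' hA'
        _ = (1 - 8 * ε + ε / 10000) * gaussTail τ := by ring
        _ ≤ (1 - 8 * ε + ε / 10000) * ((1 + ε / 1000) * gaussTail t) := by
            refine mul_le_mul_of_nonneg_left h1 (by linarith)
        _ = ((1 - 8 * ε + ε / 10000) * (1 + ε / 1000)) * gaussTail t := by ring
        _ ≤ _ := mul_le_mul_of_nonneg_right (by nlinarith) hQ.le

end

lemma exp_le_cubic (x : ℝ) : exp x ≤ 1 + x + x ^ 2 / 2 + |x| ^ 3 * exp |x| := by
  have h := Complex.norm_exp_sub_sum_le_norm_mul_exp (x : ℂ) 3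
  have e : (Complex.exp x - ∑ m ∈ Finset.range 3, (x : ℂ) ^ m / (m.factorial : ℂ)) =
      ((exp x - (1 + x + x ^ 2 / 2) : ℝ) : ℂ) := by
    simp [Finset.sum_range_succ, Nat.factorial]
  rw [e, Complex.norm_real, Complex.norm_real, norm_eq_abs, norm_eq_abs] at h
  linarith [(abs_le.1 h).2]

lemma integral_exp_le_of_bounded {Ω : Type*} [MeasurableSpace Ω] {P : Measure Ω} [IsProbabilityMeasure P]
    {X : Ω → ℝ} (hX : Measurable X) {B : ℝ} (hB : ∀ ω, |X ω| ≤ B) (a : ℝ) :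
    ∫ ω, exp (X ω) ∂P ≤ exp (∫ ω, X ω ∂P) * (1 + (∫ ω, (X ω - a) ^ 2 ∂P) / 2 +
      exp (2 * B) * ∫ ω, |X ω - ∫ ω', X ω' ∂P| ^ 3 ∂P) := by
  have hB' : ∀ ω, -B ≤ X ω ∧ X ω ≤ B := fun ω => abs_le.1 (hB ω)
  have iX : Integrable X P := Integrable.of_bound hX.aestronglyMeasurable B (ae_of_all _ hB)
  set m := ∫ ω, X ω ∂P with hm
  have hmB : |m| ≤ B := by
    have := norm_integral_le_of_norm_le_const (μ := P) (f := X) (C := B) (ae_of_all _ hB)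
    simpa using this
  have hdiff : ∀ ω, |X ω - m| ≤ 2 * B := fun ω => (abs_sub _ _).trans (by linarith [hB ω])
  have i2 : Integrable (fun ω => (X ω - m) ^ 2) P :=
    Integrable.of_bound (by fun_prop) ((2 * B) ^ 2) (ae_of_all _ fun ω => by
      rw [norm_pow, norm_eq_abs]; gcongr; exact hdiff ω)
  have i3 : Integrable (fun ω => |X ω - m| ^ 3) P :=
    Integrable.of_bound (by fun_prop) ((2 * B) ^ 3) (ae_of_all _ fun ω => by
      rw [norm_pow, norm_eq_abs, abs_abs]; gcongr; exact hdiff ω)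
  have iE : Integrable (fun ω => exp (X ω)) P :=
    Integrable.of_bound (by fun_prop) (exp B) (ae_of_all _ fun ω => by
      rw [norm_eq_abs, abs_exp]; exact exp_le_exp.2 (hB' ω).2)
  have i0 : Integrable (fun ω => X ω - m) P := iX.sub (integrable_const _)
  have i1 : Integrable (fun ω => 1 + (X ω - m)) P := (integrable_const _).add i0
  have i12 : Integrable (fun ω => 1 + (X ω - m) + (X ω - m) ^ 2 / 2) P := i1.add (i2.div_const 2)
  have i13 : Integrable (fun ω => |X ω - m| ^ 3 * exp (2 * B)) P := i3.mul_const _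
  have hvar : ∫ ω, (X ω - m) ^ 2 ∂P ≤ ∫ ω, (X ω - a) ^ 2 ∂P := by
    have e : ∫ ω, (X ω - a) ^ 2 ∂P = ∫ ω, (X ω - m) ^ 2 ∂P + (m - a) ^ 2 := by
      have : ∀ ω, (X ω - a) ^ 2 = (X ω - m) ^ 2 + (2 * (m - a) * X ω + (a ^ 2 - m ^ 2)) := fun ω => by ring
      simp_rw [this]
      have j : Integrable (fun ω => 2 * (m - a) * X ω + (a ^ 2 - m ^ 2)) P :=
        (iX.const_mul _).add (integrable_const _)
      rw [integral_add i2 j, integral_add (iX.const_mul _) (integrable_const _),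
        integral_const_mul]
      simp
      ring
    rw [e]; nlinarith [sq_nonneg (m - a)]
  have key : ∫ ω, exp (X ω) ∂P ≤ ∫ ω, exp m * (1 + (X ω - m) + (X ω - m) ^ 2 / 2 + |X ω - m| ^ 3 * exp (2 * B)) ∂P := by
    refine integral_mono iE ((i12.add i13).const_mul _) fun ω => ?_
    have : exp (X ω) = exp m * exp (X ω - m) := by rw [← exp_add]; ring_nf
    simp only [this]
    gcongr
    refine (exp_le_cubic _).trans ?_
    gcongr
    exact hdiff ω
  refine key.trans ?_
  rw [integral_const_mul, integral_add i12 i13, integral_add i1 (i2.div_const 2), integral_add (integrable_const _) i0,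
    integral_sub iX (integrable_const _), integral_div, integral_mul_const]
  simp only [integral_const, probReal_univ, smul_eq_mul, one_mul, ← hm, sub_self, add_zero]
  rw [mul_comm (exp (2 * B))]
  gcongr

lemma le_variance_of_linear_approx {Ω : Type*} [MeasurableSpace Ω] {P : Measure Ω} [IsProbabilityMeasure P]
    {X Y Z : Ω → ℝ} (hX : MemLp X 2 P) (hY : MemLp Y 2 P) (hY0 : ∫ ω, Y ω ∂P = 0)
    (hZ : Integrable Z P) (a : ℝ) (h : ∀ ω, |(X ω - a - Y ω) * Y ω| ≤ Z ω) :
    ∫ ω, Y ω ^ 2 ∂P - 2 * ∫ ω, Z ω ∂P ≤ ∫ ω, X ω ^ 2 ∂P - (∫ ω, X ω ∂P) ^ 2 := by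
  set m := ∫ ω, X ω ∂P with hm
  have iX := hX.integrable one_le_two
  have iY := hY.integrable one_le_two
  have iX2 := hX.integrable_sq
  have iY2 := hY.integrable_sq
  have iXY : Integrable (fun ω => X ω * Y ω) P := hX.integrable_mul hY
  have h0 : 0 ≤ ∫ ω, (X ω - m - Y ω) ^ 2 ∂P := integral_nonneg fun _ => sq_nonneg _
  have e : ∀ ω, (X ω - m - Y ω) ^ 2 = (X ω ^ 2 + (-(2 * m)) * X ω + m ^ 2) + ((-2) * (X ω * Y ω) + (2 * m) * Y ω + Y ω ^ 2) :=
    fun ω => by ring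
  have j1 : Integrable (fun ω => X ω ^ 2 + (-(2 * m)) * X ω) P := iX2.add (iX.const_mul _)
  have j2 : Integrable (fun ω => X ω ^ 2 + (-(2 * m)) * X ω + m ^ 2) P := j1.add (integrable_const _)
  have j3 : Integrable (fun ω => (-2) * (X ω * Y ω) + (2 * m) * Y ω) P := (iXY.const_mul _).add (iY.const_mul _)
  have j4 : Integrable (fun ω => (-2) * (X ω * Y ω) + (2 * m) * Y ω + Y ω ^ 2) P := j3.add iY2
  simp_rw [e] at h0
  rw [integral_add j2 j4, integral_add j1 (integrable_const _), integral_add iX2 (iX.const_mul _),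
    integral_add j3 iY2, integral_add (iXY.const_mul _) (iY.const_mul _), integral_const_mul, integral_const_mul,
    integral_const_mul, hY0] at h0
  simp only [integral_const, probReal_univ, smul_eq_mul, one_mul, ← hm, mul_zero, add_zero] at h0
  have h1 : ∫ ω, Y ω ^ 2 ∂P - ∫ ω, Z ω ∂P ≤ ∫ ω, X ω * Y ω ∂P := by
    have e2 : ∫ ω, X ω * Y ω ∂P = ∫ ω, (X ω * Y ω - a * Y ω) ∂P := by
      rw [integral_sub iXY (iY.const_mul _), integral_const_mul, hY0]; ring
    rw [e2, ← integral_sub iY2 hZ]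
    refine integral_mono (iY2.sub hZ) (iXY.sub (iY.const_mul _)) fun ω => ?_
    have := (abs_le.1 (h ω)).1
    simp only
    nlinarith
  nlinarith

lemma integrable_norm_pow_gaussN (n k : ℕ) : Integrable (fun z : Euc n => ‖z‖ ^ k) (gaussN n) := by
  have h := IsGaussian.memLp_id (gaussN n) (k : ℝ≥0∞) (by simp)
  rcases Nat.eq_zero_or_pos k with rfl | hk
  · simp
  · exact h.integrable_norm_pow hk.ne'

lemma integral_inner_gaussN (n : ℕ) (p : Euc n) : ∫ z, ⟪p, z⟫ ∂(gaussN n) = 0 := by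
  have h := integral_gaussN_inner n p (f := fun y => y) measurable_id
  rw [h, integral_const_mul]
  simp

lemma integral_inner_sq_gaussN {n : ℕ} (p : Euc n) : ∫ z, ⟪p, z⟫ ^ 2 ∂(gaussN n) = ‖p‖ ^ 2 / n := by
  have h := integral_gaussN_inner n p (f := fun y => y ^ 2) (by fun_prop)
  rw [h]
  simp_rw [mul_pow]
  rw [integral_const_mul]
  have e : ∫ x, x ^ 2 ∂(gaussianReal 0 1) = 1 := by
    have h1 := variance_id_gaussianReal (μ := 0) (v := 1)
    rw [variance_of_integral_eq_zero (by fun_prop) (by simp)] at h1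
    simpa using h1
  rw [e, div_pow, sq_sqrt (Nat.cast_nonneg n), mul_one]

lemma integral_exp_le_of_linear_approx (n : ℕ) {B C₁ C₂ : ℝ} (hC₁ : 0 ≤ C₁) (hC₂ : 0 ≤ C₂) :
    ∃ D, 0 ≤ D ∧ ∀ (W : Euc n → ℝ) (p : Euc n) (w δ : ℝ), Measurable W → (∀ z, |W z| ≤ B) → ‖p‖ ≤ C₂ →
      0 < δ → δ ≤ 1 → (∀ z, |W z - w - δ * ⟪p, z⟫| ≤ C₁ * δ ^ 2 * ‖z‖ ^ 2) →
      ∫ z, exp (W z) ∂(gaussN n) ≤ exp (∫ z, W z ∂(gaussN n) + δ ^ 2 * ‖p‖ ^ 2 / (2 * n) + D * δ ^ 3) := by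
  have iG : Integrable (fun z : Euc n => C₂ * ‖z‖ + C₁ * ‖z‖ ^ 2) (gaussN n) := by
    have h1 := integrable_norm_pow_gaussN n 1
    simp only [pow_one] at h1
    exact (h1.const_mul _).add ((integrable_norm_pow_gaussN n 2).const_mul _)
  set I := ∫ z, (C₂ * ‖z‖ + C₁ * ‖z‖ ^ 2) ∂(gaussN n) with hI
  have hI0 : 0 ≤ I := integral_nonneg fun z => by positivity
  have iH : Integrable (fun z : Euc n => 2 * C₂ * C₁ * ‖z‖ ^ 3 + C₁ ^ 2 * ‖z‖ ^ 4) (gaussN n) :=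
    ((integrable_norm_pow_gaussN n 3).const_mul _).add ((integrable_norm_pow_gaussN n 4).const_mul _)
  have iG3 : Integrable (fun z : Euc n => (C₂ * ‖z‖ + C₁ * ‖z‖ ^ 2 + I) ^ 3) (gaussN n) := by
    have e : (fun z : Euc n => (C₂ * ‖z‖ + C₁ * ‖z‖ ^ 2 + I) ^ 3) = fun z : Euc n =>
        C₁ ^ 3 * ‖z‖ ^ 6 + 3 * C₁ ^ 2 * C₂ * ‖z‖ ^ 5 + (3 * C₁ * C₂ ^ 2 + 3 * C₁ ^ 2 * I) * ‖z‖ ^ 4 +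
        (C₂ ^ 3 + 6 * C₁ * C₂ * I) * ‖z‖ ^ 3 + (3 * C₁ * I ^ 2 + 3 * C₂ ^ 2 * I) * ‖z‖ ^ 2 +
        3 * C₂ * I ^ 2 * ‖z‖ ^ 1 + I ^ 3 * ‖z‖ ^ 0 := by
      funext z; ring
    rw [e]
    have i (c : ℝ) (k : ℕ) := (integrable_norm_pow_gaussN n k).const_mul c
    exact ((((((i _ 6).add (i _ 5)).add (i _ 4)).add (i _ 3)).add (i _ 2)).add (i _ 1)).add (i _ 0)
  refine ⟨(∫ z, (2 * C₂ * C₁ * ‖z‖ ^ 3 + C₁ ^ 2 * ‖z‖ ^ 4) ∂(gaussN n)) / 2 +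
    exp (2 * B) * ∫ z, (C₂ * ‖z‖ + C₁ * ‖z‖ ^ 2 + I) ^ 3 ∂(gaussN n), ?_, ?_⟩
  · have h1 : 0 ≤ ∫ z : Euc n, (2 * C₂ * C₁ * ‖z‖ ^ 3 + C₁ ^ 2 * ‖z‖ ^ 4) ∂(gaussN n) :=
      integral_nonneg fun z => by positivity
    have h2 : 0 ≤ ∫ z : Euc n, (C₂ * ‖z‖ + C₁ * ‖z‖ ^ 2 + I) ^ 3 ∂(gaussN n) :=
      integral_nonneg fun z => by positivity
    positivity
  intro W p w δ hW hB hp hδ hδ1 happ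
  have hinner : ∀ z : Euc n, |⟪p, z⟫| ≤ C₂ * ‖z‖ := fun z =>
    (abs_real_inner_le_norm p z).trans (by gcongr)
  have iW : Integrable W (gaussN n) := Integrable.of_bound hW.aestronglyMeasurable B (ae_of_all _ hB)
  have ip : Integrable (fun z => ⟪p, z⟫ ^ 2) (gaussN n) := by
    refine ((integrable_norm_pow_gaussN n 2).const_mul (C₂ ^ 2)).mono' (by fun_prop) (ae_of_all _ fun z => ?_)
    rw [norm_pow, norm_eq_abs, ← mul_pow]
    gcongr
    exact hinner z
  have hdev : ∀ z, |W z - w| ≤ δ * (C₂ * ‖z‖ + C₁ * ‖z‖ ^ 2) := by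
    intro z
    have h1 := happ z
    have h2 : |W z - w| ≤ |W z - w - δ * ⟪p, z⟫| + |δ * ⟪p, z⟫| := by
      have := abs_add_le (W z - w - δ * ⟪p, z⟫) (δ * ⟪p, z⟫)
      rwa [sub_add_cancel] at this
    rw [abs_mul, abs_of_pos hδ] at h2
    have h3 : δ * |⟪p, z⟫| ≤ δ * (C₂ * ‖z‖) := by gcongr; exact hinner z
    have h4 : C₁ * δ ^ 2 * ‖z‖ ^ 2 ≤ C₁ * δ * ‖z‖ ^ 2 := by
      gcongr; nlinarith
    linarith
  have hmean : |∫ z, W z ∂(gaussN n) - w| ≤ δ * I := by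
    have e : ∫ z, W z ∂(gaussN n) - w = ∫ z, (W z - w) ∂(gaussN n) := by
      rw [integral_sub iW (integrable_const _)]; simp
    rw [e, hI, ← integral_const_mul]
    exact norm_integral_le_of_norm_le (f := fun z => W z - w) (iG.const_mul δ) (ae_of_all _ hdev)
  have hsq : ∫ z, (W z - w) ^ 2 ∂(gaussN n) ≤ δ ^ 2 * (‖p‖ ^ 2 / n) +
      δ ^ 3 * ∫ z, (2 * C₂ * C₁ * ‖z‖ ^ 3 + C₁ ^ 2 * ‖z‖ ^ 4) ∂(gaussN n) := by
    rw [← integral_inner_sq_gaussN, ← integral_const_mul, ← integral_const_mul,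
      ← integral_add (ip.const_mul _) (iH.const_mul _)]
    refine integral_mono_of_nonneg (ae_of_all _ fun z => sq_nonneg _) ((ip.const_mul _).add (iH.const_mul _))
      (ae_of_all _ fun z => ?_)
    set e := W z - w - δ * ⟪p, z⟫ with he
    have h1 : |e| ≤ C₁ * δ ^ 2 * ‖z‖ ^ 2 := happ z
    have h2 : W z - w = e + δ * ⟪p, z⟫ := by rw [he]; ring
    have h3 : e ^ 2 ≤ (C₁ * δ ^ 2 * ‖z‖ ^ 2) ^ 2 := by rw [← sq_abs]; gcongr
    have h4 : e * ⟪p, z⟫ ≤ (C₁ * δ ^ 2 * ‖z‖ ^ 2) * (C₂ * ‖z‖) := by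
      refine (le_abs_self _).trans ?_
      rw [abs_mul]
      gcongr
      exact hinner z
    have h5 : (C₁ * δ ^ 2 * ‖z‖ ^ 2) ^ 2 ≤ δ ^ 3 * (C₁ ^ 2 * ‖z‖ ^ 4) := by
      have : (C₁ * δ ^ 2 * ‖z‖ ^ 2) ^ 2 = δ * (δ ^ 3 * (C₁ ^ 2 * ‖z‖ ^ 4)) := by ring
      rw [this]
      exact mul_le_of_le_one_left (by positivity) hδ1
    have h6 : δ * (e * ⟪p, z⟫) ≤ δ * ((C₁ * δ ^ 2 * ‖z‖ ^ 2) * (C₂ * ‖z‖)) := by gcongr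
    simp only [h2]
    nlinarith
  have hcube : ∫ z, |W z - ∫ z', W z' ∂(gaussN n)| ^ 3 ∂(gaussN n) ≤
      δ ^ 3 * ∫ z, (C₂ * ‖z‖ + C₁ * ‖z‖ ^ 2 + I) ^ 3 ∂(gaussN n) := by
    rw [← integral_const_mul]
    refine integral_mono_of_nonneg (ae_of_all _ fun z => by positivity) (iG3.const_mul _)
      (ae_of_all _ fun z => ?_)
    simp only
    rw [← mul_pow]
    gcongr
    have h1 : |W z - ∫ z', W z' ∂(gaussN n)| ≤ |W z - w| + |∫ z', W z' ∂(gaussN n) - w| := by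
      have := abs_sub (W z - w) (∫ z', W z' ∂(gaussN n) - w)
      rwa [sub_sub_sub_cancel_right] at this
    linarith [hdev z]
  refine (integral_exp_le_of_bounded hW hB w).trans ?_
  rw [add_assoc (∫ z, W z ∂(gaussN n)), exp_add]
  gcongr
  refine le_trans ?_ (add_one_le_exp _)
  have : exp (2 * B) * ∫ z, |W z - ∫ z', W z' ∂(gaussN n)| ^ 3 ∂(gaussN n) ≤
    exp (2 * B) * (δ ^ 3 * ∫ z, (C₂ * ‖z‖ + C₁ * ‖z‖ ^ 2 + I) ^ 3 ∂(gaussN n)) := by gcongr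
  have e : δ ^ 2 * ‖p‖ ^ 2 / (2 * n) = δ ^ 2 * (‖p‖ ^ 2 / n) / 2 := by
    rw [mul_comm 2, ← div_div, mul_div_assoc]
  rw [e]
  linarith

/-- The concave quadratic `m ↦ lam * m + t * (m - m ^ 2)`. -/
noncomputable def quadPot (lam t m : ℝ) : ℝ := lam * m + t * (m - m ^ 2)

lemma abs_quadPot_le {lam t m : ℝ} (ht : 0 ≤ t) (ht' : t ≤ |lam| / 2) (hm : 0 ≤ m) (hm' : m ≤ 1) :
    |quadPot lam t m| ≤ 2 * |lam| := by
  unfold quadPot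
  refine (abs_add_le _ _).trans ?_
  rw [abs_mul, abs_mul, abs_of_nonneg hm, abs_of_nonneg ht, abs_of_nonneg (by nlinarith : 0 ≤ m - m ^ 2)]
  have h1 : |lam| * m ≤ |lam| * 1 := by gcongr
  have h2 : t * (m - m ^ 2) ≤ |lam| / 2 * 1 := by
    gcongr
    · nlinarith
    · nlinarith
  linarith [abs_nonneg lam]

lemma lipschitz_of_quadratic_approx {a b c k L : ℝ} (hL : 1 ≤ L) (ha : 0 ≤ a) (ha' : a ≤ 1) (hb : 0 ≤ b)
    (hb' : b ≤ 1) (hc : |c| ≤ L) (h : |b - a - c * k| ≤ L * k ^ 2) : |b - a| ≤ 2 * L * |k| := by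
  rcases le_total |k| 1 with hk | hk
  · have h1 : |b - a| ≤ |b - a - c * k| + |c * k| := by
      have := abs_add_le (b - a - c * k) (c * k)
      rwa [sub_add_cancel] at this
    rw [abs_mul] at h1
    have h2 : |c| * |k| ≤ L * |k| := by gcongr
    have h3 : L * k ^ 2 ≤ L * |k| := by
      rw [← sq_abs]; gcongr; nlinarith [abs_nonneg k]
    linarith
  · have h1 : |b - a| ≤ 1 := abs_le.2 ⟨by linarith, by linarith⟩
    nlinarith

section
variable {n : ℕ} {ν : Measure (Euc n)}

lemma measurable_quadPot_comp {θ : Euc n → ℝ} (hθ : Measurable θ) {lam : ℝ} {f : Euc n → ℝ} (hf : Measurable f) :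
    Measurable (fun x => quadPot lam (θ x) (f x)) := by
  unfold quadPot; fun_prop

/-- First-order expansion of `v ↦ ∫ quadPot (θ x) (F x (z + v)) dν(x)`. -/
lemma quadPot_linear_approx [IsFiniteMeasure ν] {K lam L : ℝ} (hK : 0 < K) (hL : 1 ≤ L)
    (hν2 : ∀ v : Euc n, Integrable (fun x => ⟪x, v⟫ ^ 2) ν ∧ ∫ x, ⟪x, v⟫ ^ 2 ∂ν ≤ K * ‖v‖ ^ 2)
    (hν1 : Integrable (fun x : Euc n => x) ν) {θ : Euc n → ℝ} (hθm : Measurable θ) (hθ0 : ∀ x, 0 ≤ θ x)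
    (hθ1 : ∀ x, θ x ≤ |lam| / 2) {F F1 : Euc n → Euc n → ℝ} (hFm : ∀ z, Measurable (fun x => F x z))
    (hF1m : ∀ z, Measurable (fun x => F1 x z)) (hF : ∀ x z, 0 ≤ F x z ∧ F x z ≤ 1)
    (hF1 : ∀ x z, |F1 x z| ≤ L)
    (hT : ∀ x z v, |F x (z + v) - F x z - F1 x z * ⟪x, v⟫| ≤ L * ⟪x, v⟫ ^ 2) (z : Euc n) :
    ∃ p : Euc n, ‖p‖ ^ 2 ≤ K * (9 / 4 * lam ^ 2 * ∫ x, F1 x z ^ 2 ∂ν) ∧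
      ∀ v, |∫ x, quadPot lam (θ x) (F x (z + v)) ∂ν - ∫ x, quadPot lam (θ x) (F x z) ∂ν - ⟪p, v⟫| ≤
        (3 / 2 * |lam| * L + 2 * |lam| * L ^ 2) * K * ‖v‖ ^ 2 := by
  set P' : Euc n → ℝ := fun x => lam + θ x * (1 - 2 * F x z) with hP'
  have hP'm : Measurable P' := by have := hFm z; fun_prop
  have hP'b : ∀ x, |P' x| ≤ 3 / 2 * |lam| := by
    intro x
    refine (abs_add_le _ _).trans ?_
    rw [abs_mul, abs_of_nonneg (hθ0 x)]
    have : |1 - 2 * F x z| ≤ 1 := abs_le.2 ⟨by linarith [(hF x z).2], by linarith [(hF x z).1]⟩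
    have : θ x * |1 - 2 * F x z| ≤ |lam| / 2 * 1 := mul_le_mul (hθ1 x) this (abs_nonneg _) (by positivity)
    linarith
  set u : Euc n → ℝ := fun x => P' x * F1 x z with hu
  have hum : Measurable u := hP'm.mul (hF1m z)
  have hub : ∀ x, |u x| ≤ 3 / 2 * |lam| * L := fun x => by
    rw [hu]; simp only; rw [abs_mul]
    exact mul_le_mul (hP'b x) (hF1 x z) (abs_nonneg _) (by positivity)
  have iu : Integrable (fun x => u x • x) ν := hν1.bdd_smul (3 / 2 * |lam| * L) hum.aestronglyMeasurable (ae_of_all _ hub)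
  set p := ∫ x, u x • x ∂ν with hp
  have hpv : ∀ v, ⟪p, v⟫ = ∫ x, u x * ⟪x, v⟫ ∂ν := by
    intro v
    rw [real_inner_comm, hp, ← integral_inner iu]
    congr 1; ext x; rw [inner_smul_right, real_inner_comm]
  have iuv : ∀ v, Integrable (fun x => u x * ⟪x, v⟫) ν := by
    intro v
    have : (fun x => u x * ⟪x, v⟫) = fun x => ⟪v, u x • x⟫ := by
      ext x; rw [inner_smul_right, real_inner_comm]
    rw [this]
    exact iu.const_inner v
  have iu2 : Integrable (fun x => u x ^ 2) ν := Integrable.of_bound (by fun_prop) ((3 / 2 * |lam| * L) ^ 2)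
    (ae_of_all _ fun x => by rw [norm_pow, norm_eq_abs]; gcongr; exact hub x)
  have iF12 : Integrable (fun x => F1 x z ^ 2) ν := Integrable.of_bound (by have := hF1m z; fun_prop) (L ^ 2)
    (ae_of_all _ fun x => by rw [norm_pow, norm_eq_abs]; gcongr; exact hF1 x z)
  have iP : ∀ w, Integrable (fun x => quadPot lam (θ x) (F x w)) ν := fun w =>
    Integrable.of_bound (measurable_quadPot_comp hθm (hFm w)).aestronglyMeasurable (2 * |lam|)
      (ae_of_all _ fun x => abs_quadPot_le (hθ0 x) (hθ1 x) (hF x w).1 (hF x w).2)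
  refine ⟨p, ?_, ?_⟩
  · have h1 : ‖p‖ ^ 2 = ∫ x, u x * ⟪x, p⟫ ∂ν := by rw [← hpv, real_inner_self_eq_norm_sq]
    have h2 : ∫ x, u x * ⟪x, p⟫ ∂ν ≤ ∫ x, (K / 2 * u x ^ 2 + 1 / (2 * K) * ⟪x, p⟫ ^ 2) ∂ν := by
      refine integral_mono (iuv p) ((iu2.const_mul _).add ((hν2 p).1.const_mul _)) fun x => ?_
      have : K / 2 * u x ^ 2 + 1 / (2 * K) * ⟪x, p⟫ ^ 2 - u x * ⟪x, p⟫ = (K * u x - ⟪x, p⟫) ^ 2 / (2 * K) := by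
        field_simp; ring
      have h0 : 0 ≤ (K * u x - ⟪x, p⟫) ^ 2 / (2 * K) := by positivity
      simp only; linarith
    rw [integral_add (iu2.const_mul _) ((hν2 p).1.const_mul _), integral_const_mul, integral_const_mul] at h2
    have h3 : 1 / (2 * K) * ∫ x, ⟪x, p⟫ ^ 2 ∂ν ≤ 1 / (2 * K) * (K * ‖p‖ ^ 2) := by gcongr; exact (hν2 p).2
    have h4 : 1 / (2 * K) * (K * ‖p‖ ^ 2) = ‖p‖ ^ 2 / 2 := by field_simp
    have h5 : ∫ x, u x ^ 2 ∂ν ≤ 9 / 4 * lam ^ 2 * ∫ x, F1 x z ^ 2 ∂ν := by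
      rw [← integral_const_mul]
      refine integral_mono iu2 (iF12.const_mul _) fun x => ?_
      rw [hu]; simp only; rw [mul_pow]
      gcongr
      rw [← sq_abs, ← sq_abs lam]
      have : |P' x| ^ 2 ≤ (3 / 2 * |lam|) ^ 2 := by gcongr; exact hP'b x
      linarith
    have h6 : ‖p‖ ^ 2 ≤ K * ∫ x, u x ^ 2 ∂ν := by linarith
    exact h6.trans (by gcongr)
  · intro v
    have iPP : Integrable (fun x => quadPot lam (θ x) (F x (z + v)) - quadPot lam (θ x) (F x z)) ν :=
      (iP _).sub (iP _)
    rw [hpv, ← integral_sub (iP _) (iP _), ← integral_sub iPP (iuv v)]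
    have hle : ∀ x, |quadPot lam (θ x) (F x (z + v)) - quadPot lam (θ x) (F x z) - u x * ⟪x, v⟫| ≤
        (3 / 2 * |lam| * L + 2 * |lam| * L ^ 2) * ⟪x, v⟫ ^ 2 := by
      intro x
      set Δ := F x (z + v) - F x z with hΔ
      have e : quadPot lam (θ x) (F x (z + v)) - quadPot lam (θ x) (F x z) - u x * ⟪x, v⟫ =
          P' x * (Δ - F1 x z * ⟪x, v⟫) - θ x * Δ ^ 2 := by
        have : F x (z + v) = F x z + Δ := by rw [hΔ]; ring
        rw [this, hu, hP']; simp only [quadPot]; ring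
      rw [e]
      refine (abs_sub _ _).trans ?_
      rw [abs_mul, abs_mul, abs_of_nonneg (hθ0 x), abs_of_nonneg (sq_nonneg Δ)]
      have h1 : |P' x| * |Δ - F1 x z * ⟪x, v⟫| ≤ 3 / 2 * |lam| * (L * ⟪x, v⟫ ^ 2) :=
        mul_le_mul (hP'b x) (hT x z v) (abs_nonneg _) (by positivity)
      have h2 := lipschitz_of_quadratic_approx hL (hF x z).1 (hF x z).2 (hF x (z + v)).1 (hF x (z + v)).2
        (hF1 x z) (hT x z v)
      have h3 : Δ ^ 2 ≤ 4 * L ^ 2 * ⟪x, v⟫ ^ 2 := by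
        have : |Δ| ^ 2 ≤ (2 * L * |⟪x, v⟫|) ^ 2 := by gcongr
        rw [mul_pow, mul_pow, sq_abs, sq_abs] at this
        linarith
      have h4 : θ x * Δ ^ 2 ≤ |lam| / 2 * (4 * L ^ 2 * ⟪x, v⟫ ^ 2) :=
        mul_le_mul (hθ1 x) h3 (sq_nonneg _) (by positivity)
      linarith
    have hint := norm_integral_le_of_norm_le
      (f := fun x => quadPot lam (θ x) (F x (z + v)) - quadPot lam (θ x) (F x z) - u x * ⟪x, v⟫)
      ((hν2 v).1.const_mul (3 / 2 * |lam| * L + 2 * |lam| * L ^ 2)) (ae_of_all _ hle)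
    refine hint.trans ?_
    rw [integral_const_mul]
    exact (mul_le_mul_of_nonneg_left (hν2 v).2 (by positivity)).trans_eq (by ring)

lemma quadPot_integral_le [IsFiniteMeasure ν] {K lam L : ℝ} (hL : 1 ≤ L)
    (hν1 : Integrable (fun x : Euc n => x) ν) {θ : Euc n → ℝ} (hθm : Measurable θ) (hθ0 : ∀ x, 0 ≤ θ x)
    (hθ1 : ∀ x, θ x ≤ |lam| / 2) (hθ : ∀ᵐ x ∂ν, θ x * ‖x‖ ^ 2 = 2 * K * lam ^ 2)
    {F F1 : Euc n → Euc n → ℝ} (hFm : Measurable (Function.uncurry F))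
    (hF1m : ∀ z, Measurable (fun x => F1 x z)) (hF : ∀ x z, 0 ≤ F x z ∧ F x z ≤ 1)
    (hF1 : ∀ x z, |F1 x z| ≤ L)
    (hT : ∀ x z v, |F x (z + v) - F x z - F1 x z * ⟪x, v⟫| ≤ L * ⟪x, v⟫ ^ 2) (z : Euc n) {δ : ℝ} (hδ : 0 < δ) :
    ∫ ζ, ∫ x, quadPot lam (θ x) (F x (z + δ • ζ)) ∂ν ∂(gaussN n) + δ ^ 2 * (2 * K * lam ^ 2 / n) * ∫ x, F1 x z ^ 2 ∂ν
      - 4 * K * lam ^ 2 * L ^ 2 * (∫ ζ, ‖ζ‖ ^ 3 ∂(gaussN n)) * (∫ x, ‖x‖ ∂ν) * δ ^ 3 ≤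
    ∫ x, quadPot lam (θ x) (∫ ζ, F x (z + δ • ζ) ∂(gaussN n)) ∂ν := by
  set M := ∫ ζ : Euc n, ‖ζ‖ ^ 3 ∂(gaussN n) with hM
  have hM0 : 0 ≤ M := integral_nonneg fun _ => by positivity
  have hFx : ∀ x, Measurable (fun ζ => F x (z + δ • ζ)) := fun x =>
    hFm.comp (by fun_prop : Measurable fun ζ : Euc n => (x, z + δ • ζ))
  have hjoint : Measurable (fun q : Euc n × Euc n => F q.1 (z + δ • q.2)) :=
    hFm.comp (by fun_prop : Measurable fun q : Euc n × Euc n => (q.1, z + δ • q.2))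
  have hPj : Measurable (fun q : Euc n × Euc n => quadPot lam (θ q.1) (F q.1 (z + δ • q.2))) := by
    unfold quadPot; fun_prop
  have iPj : Integrable (fun q : Euc n × Euc n => quadPot lam (θ q.1) (F q.1 (z + δ • q.2))) (ν.prod (gaussN n)) :=
    Integrable.of_bound hPj.aestronglyMeasurable (2 * |lam|)
      (ae_of_all _ fun q => abs_quadPot_le (hθ0 _) (hθ1 _) (hF _ _).1 (hF _ _).2)
  have hmean : Measurable (fun x => ∫ ζ, F x (z + δ • ζ) ∂(gaussN n)) :=
    (hjoint.stronglyMeasurable.integral_prod_right' (ν := gaussN n)).measurable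
  have iFx : ∀ x, Integrable (fun ζ => F x (z + δ • ζ)) (gaussN n) := fun x =>
    Integrable.of_bound (hFx x).aestronglyMeasurable 1 (ae_of_all _ fun ζ => by
      rw [norm_of_nonneg (hF _ _).1]; exact (hF _ _).2)
  have iFx2 : ∀ x, Integrable (fun ζ => F x (z + δ • ζ) ^ 2) (gaussN n) := fun x =>
    Integrable.of_bound ((hFx x).pow_const 2).aestronglyMeasurable 1 (ae_of_all _ fun ζ => by
      rw [norm_pow, norm_of_nonneg (hF _ _).1]; exact pow_le_one₀ (hF _ _).1 (hF _ _).2)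
  have hmean01 : ∀ x, 0 ≤ ∫ ζ, F x (z + δ • ζ) ∂(gaussN n) ∧ ∫ ζ, F x (z + δ • ζ) ∂(gaussN n) ≤ 1 := fun x => by
    refine ⟨integral_nonneg fun ζ => (hF _ _).1, ?_⟩
    have := integral_mono (iFx x) (integrable_const (1:ℝ)) fun ζ => (hF x (z + δ • ζ)).2
    simpa using this
  have iF12 : Integrable (fun x => F1 x z ^ 2) ν := Integrable.of_bound (by have := hF1m z; fun_prop) (L ^ 2)
    (ae_of_all _ fun x => by rw [norm_pow, norm_eq_abs]; gcongr; exact hF1 x z)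
  have iA : Integrable (fun x => ∫ ζ, quadPot lam (θ x) (F x (z + δ • ζ)) ∂(gaussN n)) ν := iPj.integral_prod_left
  have iB : Integrable (fun x => δ ^ 2 * (2 * K * lam ^ 2 / n) * F1 x z ^ 2) ν := iF12.const_mul _
  have iC : Integrable (fun x => 4 * K * lam ^ 2 * L ^ 2 * M * δ ^ 3 * ‖x‖) ν := hν1.norm.const_mul _
  have iAB : Integrable (fun x => ∫ ζ, quadPot lam (θ x) (F x (z + δ • ζ)) ∂(gaussN n) +
    δ ^ 2 * (2 * K * lam ^ 2 / n) * F1 x z ^ 2) ν := iA.add iB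
  have e1 : ∫ ζ, ∫ x, quadPot lam (θ x) (F x (z + δ • ζ)) ∂ν ∂(gaussN n) =
      ∫ x, ∫ ζ, quadPot lam (θ x) (F x (z + δ • ζ)) ∂(gaussN n) ∂ν :=
    (integral_integral_swap (f := fun x ζ => quadPot lam (θ x) (F x (z + δ • ζ))) iPj).symm
  have e2 : 4 * K * lam ^ 2 * L ^ 2 * M * (∫ x, ‖x‖ ∂ν) * δ ^ 3 =
      ∫ x, 4 * K * lam ^ 2 * L ^ 2 * M * δ ^ 3 * ‖x‖ ∂ν := by
    rw [integral_const_mul]; ring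
  rw [e1, e2, ← integral_const_mul, ← integral_add iA iB, ← integral_sub iAB iC]
  refine integral_mono_ae (iAB.sub iC) (Integrable.of_bound
    (measurable_quadPot_comp hθm hmean).aestronglyMeasurable (2 * |lam|)
      (ae_of_all _ fun x => abs_quadPot_le (hθ0 x) (hθ1 x) (hmean01 x).1 (hmean01 x).2)) ?_
  filter_upwards [hθ] with x hx
  set m := ∫ ζ, F x (z + δ • ζ) ∂(gaussN n) with hm
  have e3 : ∫ ζ, quadPot lam (θ x) (F x (z + δ • ζ)) ∂(gaussN n) =
      lam * m + θ x * (m - ∫ ζ, F x (z + δ • ζ) ^ 2 ∂(gaussN n)) := by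
    unfold quadPot
    have iD : Integrable (fun ζ => F x (z + δ • ζ) - F x (z + δ • ζ) ^ 2) (gaussN n) := (iFx x).sub (iFx2 x)
    rw [integral_add ((iFx x).const_mul _) (iD.const_mul _), integral_const_mul, integral_const_mul,
      integral_sub (iFx x) (iFx2 x)]
  have hYlin : ∀ ζ, |δ * F1 x z * ⟪x, ζ⟫| ≤ δ * L * (‖x‖ * ‖ζ‖) := by
    intro ζ
    rw [abs_mul, abs_mul, abs_of_pos hδ]
    gcongr
    · exact hF1 x z
    · exact abs_real_inner_le_norm _ _
  have hvar := le_variance_of_linear_approx (P := gaussN n) (X := fun ζ => F x (z + δ • ζ))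
    (Y := fun ζ => δ * F1 x z * ⟪x, ζ⟫) (Z := fun ζ => L ^ 2 * δ ^ 3 * ‖x‖ ^ 3 * ‖ζ‖ ^ 3)
    (MemLp.of_bound (hFx x).aestronglyMeasurable 1 (ae_of_all _ fun ζ => by
      rw [norm_of_nonneg (hF _ _).1]; exact (hF _ _).2))
    ((memLp_two_iff_integrable_sq (by fun_prop)).2 (by
      refine ((integrable_norm_pow_gaussN n 2).const_mul ((δ * L * ‖x‖) ^ 2)).mono' (by fun_prop) (ae_of_all _ fun ζ => ?_)
      rw [norm_pow, norm_eq_abs, ← mul_pow]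
      refine pow_le_pow_left₀ (abs_nonneg _) ((hYlin ζ).trans_eq (by ring)) 2))
    (by rw [integral_const_mul, integral_inner_gaussN, mul_zero])
    ((integrable_norm_pow_gaussN n 3).const_mul _) (F x z) (fun ζ => by
      have h1 := hT x z (δ • ζ)
      rw [inner_smul_right] at h1
      rw [abs_mul]
      have h2 : |F x (z + δ • ζ) - F x z - δ * F1 x z * ⟪x, ζ⟫| ≤ L * (δ * (‖x‖ * ‖ζ‖)) ^ 2 := by
        rw [show δ * F1 x z * ⟪x, ζ⟫ = F1 x z * (δ * ⟪x, ζ⟫) by ring]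
        refine h1.trans ?_
        rw [← sq_abs, abs_mul, abs_of_pos hδ]
        gcongr
        exact abs_real_inner_le_norm _ _
      refine (mul_le_mul h2 (hYlin ζ) (abs_nonneg _) (by positivity)).trans_eq ?_
      ring)
  rw [integral_const_mul (L ^ 2 * δ ^ 3 * ‖x‖ ^ 3), ← hM, ← hm] at hvar
  have e4 : ∫ ζ, (δ * F1 x z * ⟪x, ζ⟫) ^ 2 ∂(gaussN n) = (δ * F1 x z) ^ 2 * (‖x‖ ^ 2 / n) := by
    simp_rw [mul_pow _ ⟪x, _⟫]
    rw [integral_const_mul, integral_inner_sq_gaussN]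
  rw [e4] at hvar
  have hmul := mul_le_mul_of_nonneg_left hvar (hθ0 x)
  have e5 : θ x * ((δ * F1 x z) ^ 2 * (‖x‖ ^ 2 / n) - 2 * (L ^ 2 * δ ^ 3 * ‖x‖ ^ 3 * M)) =
      δ ^ 2 * (2 * K * lam ^ 2 / n) * F1 x z ^ 2 - 4 * K * lam ^ 2 * L ^ 2 * M * δ ^ 3 * ‖x‖ := by
    rw [show 4 * K * lam ^ 2 * L ^ 2 * M * δ ^ 3 * ‖x‖ = 2 * (2 * K * lam ^ 2) * L ^ 2 * M * δ ^ 3 * ‖x‖ by ring, ← hx]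
    ring
  rw [e5] at hmul
  rw [e3]
  unfold quadPot
  linarith

/-- One step of the discretized Gaussian Brascamp-Lieb heat flow. -/
lemma exists_brascampLieb_step (hn : n ≠ 0) [IsFiniteMeasure ν] {K lam L : ℝ} (hK : 0 < K) (hL : 1 ≤ L)
    (hν2 : ∀ v : Euc n, Integrable (fun x => ⟪x, v⟫ ^ 2) ν ∧ ∫ x, ⟪x, v⟫ ^ 2 ∂ν ≤ K * ‖v‖ ^ 2)
    (hν1 : Integrable (fun x : Euc n => x) ν) {θ : Euc n → ℝ} (hθm : Measurable θ) (hθ0 : ∀ x, 0 ≤ θ x)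
    (hθ1 : ∀ x, θ x ≤ |lam| / 2) (hθ : ∀ᵐ x ∂ν, θ x * ‖x‖ ^ 2 = 2 * K * lam ^ 2) :
    ∃ C, 0 ≤ C ∧ ∀ F F1 : Euc n → Euc n → ℝ, Measurable (Function.uncurry F) →
      (∀ z, Measurable (fun x => F1 x z)) → (∀ x z, 0 ≤ F x z ∧ F x z ≤ 1) →
      (∀ x z, |F1 x z| ≤ L) → (∀ x z v, |F x (z + v) - F x z - F1 x z * ⟪x, v⟫| ≤ L * ⟪x, v⟫ ^ 2) →
      ∀ (z : Euc n) (δ : ℝ), 0 < δ → δ ≤ 1 →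
      ∫ ζ, exp (∫ x, quadPot lam (θ x) (F x (z + δ • ζ)) ∂ν) ∂(gaussN n) ≤
        exp (∫ x, quadPot lam (θ x) (∫ ζ, F x (z + δ • ζ) ∂(gaussN n)) ∂ν + C * δ ^ 3) := by
  set C₁ := (3 / 2 * |lam| * L + 2 * |lam| * L ^ 2) * K with hC₁
  have hC₁0 : 0 ≤ C₁ := by positivity
  set C₂ := √(K * (9 / 4 * lam ^ 2 * (L ^ 2 * ν.real univ))) with hC₂
  obtain ⟨D, hD0, hD⟩ := integral_exp_le_of_linear_approx n (B := 2 * |lam| * ν.real univ) hC₁0 (sqrt_nonneg _ : 0 ≤ C₂)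
  set M := ∫ ζ : Euc n, ‖ζ‖ ^ 3 ∂(gaussN n) with hM
  have hM0 : 0 ≤ M := integral_nonneg fun _ => by positivity
  have hN0 : 0 ≤ ∫ x, ‖x‖ ∂ν := integral_nonneg fun _ => by positivity
  refine ⟨D + 4 * K * lam ^ 2 * L ^ 2 * M * (∫ x, ‖x‖ ∂ν), by positivity, ?_⟩
  intro F F1 hFm hF1m hF hF1 hT z δ hδ hδ1
  have hFm' : ∀ z, Measurable (fun x => F x z) := fun z => hFm.comp (by fun_prop : Measurable fun x : Euc n => (x, z))
  obtain ⟨p, hp, happ⟩ := quadPot_linear_approx hK hL hν2 hν1 hθm hθ0 hθ1 hFm' hF1m hF hF1 hT z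
  have iF12 : Integrable (fun x => F1 x z ^ 2) ν := Integrable.of_bound (by have := hF1m z; fun_prop) (L ^ 2)
    (ae_of_all _ fun x => by rw [norm_pow, norm_eq_abs]; gcongr; exact hF1 x z)
  have hF12 : ∫ x, F1 x z ^ 2 ∂ν ≤ L ^ 2 * ν.real univ := by
    refine (integral_mono iF12 (integrable_const (L ^ 2)) fun x => ?_).trans_eq ?_
    · simp only; rw [← sq_abs]; gcongr; exact hF1 x z
    · simp [mul_comm]
  have hpC : ‖p‖ ≤ C₂ := by
    rw [hC₂]
    apply Real.le_sqrt_of_sq_le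
    refine hp.trans ?_
    gcongr
  have hPj : Measurable (fun q : Euc n × Euc n => quadPot lam (θ q.2) (F q.2 (z + δ • q.1))) := by
    have : Measurable (fun q : Euc n × Euc n => F q.2 (z + δ • q.1)) :=
      hFm.comp (by fun_prop : Measurable fun q : Euc n × Euc n => (q.2, z + δ • q.1))
    unfold quadPot; fun_prop
  have h1 := hD (fun ζ => ∫ x, quadPot lam (θ x) (F x (z + δ • ζ)) ∂ν) p (∫ x, quadPot lam (θ x) (F x z) ∂ν) δ
    (hPj.stronglyMeasurable.integral_prod_right' (ν := ν)).measurable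
    (fun ζ => norm_integral_le_of_norm_le_const (μ := ν) (f := fun x => quadPot lam (θ x) (F x (z + δ • ζ)))
      (C := 2 * |lam|) (ae_of_all _ fun x =>
      abs_quadPot_le (hθ0 x) (hθ1 x) (hF x _).1 (hF x _).2)) hpC hδ hδ1 (fun ζ => by
      have := happ (δ • ζ)
      rw [inner_smul_right, norm_smul, mul_pow, norm_of_nonneg hδ.le] at this
      refine this.trans_eq ?_
      ring)
  refine h1.trans (exp_le_exp.2 ?_)
  have h2 := quadPot_integral_le hL hν1 hθm hθ0 hθ1 hθ hFm hF1m hF hF1 hT z hδ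
  have hnn : (0:ℝ) < n := by positivity
  have hI0 : 0 ≤ ∫ x, F1 x z ^ 2 ∂ν := integral_nonneg fun _ => sq_nonneg _
  have h3 : δ ^ 2 * ‖p‖ ^ 2 / (2 * n) ≤ δ ^ 2 * (2 * K * lam ^ 2 / n) * ∫ x, F1 x z ^ 2 ∂ν := by
    have h4 : δ ^ 2 * ‖p‖ ^ 2 ≤ δ ^ 2 * (K * (9 / 4 * lam ^ 2 * ∫ x, F1 x z ^ 2 ∂ν)) := by gcongr
    rw [div_le_iff₀ (by positivity)]
    have e : δ ^ 2 * (2 * K * lam ^ 2 / n) * (∫ x, F1 x z ^ 2 ∂ν) * (2 * n) =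
        δ ^ 2 * (4 * K * lam ^ 2 * ∫ x, F1 x z ^ 2 ∂ν) := by
      field_simp; ring
    rw [e]
    refine h4.trans ?_
    have : 0 ≤ K * lam ^ 2 * ∫ x, F1 x z ^ 2 ∂ν := by positivity
    gcongr ?_ * ?_
    linarith
  rw [← hM] at h2
  linarith

end

section
variable {n : ℕ}

/-- The Gaussian smoothing `∫ ρ ⟪x, z + c ζ⟫ dγ(ζ)`. -/
noncomputable def smoothedRidge (ρ : ℝ → ℝ) (c : ℝ) (x z : Euc n) : ℝ := ∫ ζ, ρ ⟪x, z + c • ζ⟫ ∂(gaussN n)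

lemma measurable_ridge {ρ : ℝ → ℝ} (hρ : Measurable ρ) {α : Type*} [MeasurableSpace α] {f g : α → Euc n}
    (hf : Measurable f) (hg : Measurable g) : Measurable (fun a => ρ ⟪f a, g a⟫) :=
  hρ.comp (hf.inner hg)

lemma integrable_ridge {ρ : ℝ → ℝ} (hρ : Measurable ρ) {L : ℝ} (hL : ∀ y, |ρ y| ≤ L) {α : Type*} [MeasurableSpace α]
    {P : Measure α} [IsFiniteMeasure P] {f g : α → Euc n} (hf : Measurable f) (hg : Measurable g) :
    Integrable (fun a => ρ ⟪f a, g a⟫) P :=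
  Integrable.of_bound (measurable_ridge hρ hf hg).aestronglyMeasurable L (ae_of_all _ fun _ => hL _)

lemma measurable_smoothedRidge {ρ : ℝ → ℝ} (hρ : Measurable ρ) (c : ℝ) :
    Measurable (Function.uncurry (smoothedRidge (n := n) ρ c)) := by
  have : Measurable (fun q : (Euc n × Euc n) × Euc n => ρ ⟪q.1.1, q.1.2 + c • q.2⟫) :=
    measurable_ridge hρ (by fun_prop) (by fun_prop)
  exact (this.stronglyMeasurable.integral_prod_right' (ν := gaussN n)).measurable

lemma abs_smoothedRidge_le {ρ : ℝ → ℝ} {L : ℝ} (hL : ∀ y, |ρ y| ≤ L) (c : ℝ) (x z : Euc n) :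
    |smoothedRidge ρ c x z| ≤ L := by
  have := norm_integral_le_of_norm_le_const (μ := gaussN n) (f := fun ζ => ρ ⟪x, z + c • ζ⟫) (C := L)
    (ae_of_all _ fun ζ => hL _)
  simpa [smoothedRidge] using this

lemma smoothedRidge_nonneg {ρ : ℝ → ℝ} (h : ∀ y, 0 ≤ ρ y) (c : ℝ) (x z : Euc n) : 0 ≤ smoothedRidge ρ c x z :=
  integral_nonneg fun _ => h _

lemma smoothedRidge_zero (ρ : ℝ → ℝ) (x z : Euc n) : smoothedRidge ρ 0 x z = ρ ⟪x, z⟫ := by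
  simp [smoothedRidge]

lemma smoothedRidge_taylor {ρ ρ1 : ℝ → ℝ} (hρ : Measurable ρ) (hρ1 : Measurable ρ1) {L : ℝ} (hb : ∀ y, |ρ y| ≤ L)
    (hb1 : ∀ y, |ρ1 y| ≤ L) (hT : ∀ y k, |ρ (y + k) - ρ y - ρ1 y * k| ≤ L * k ^ 2) (c : ℝ) (x z v : Euc n) :
    |smoothedRidge ρ c x (z + v) - smoothedRidge ρ c x z - smoothedRidge ρ1 c x z * ⟪x, v⟫| ≤ L * ⟪x, v⟫ ^ 2 := by
  unfold smoothedRidge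
  have i1 : Integrable (fun ζ => ρ ⟪x, z + v + c • ζ⟫) (gaussN n) := integrable_ridge hρ hb (by fun_prop) (by fun_prop)
  have i2 : Integrable (fun ζ => ρ ⟪x, z + c • ζ⟫) (gaussN n) := integrable_ridge hρ hb (by fun_prop) (by fun_prop)
  have i3 : Integrable (fun ζ => ρ1 ⟪x, z + c • ζ⟫ * ⟪x, v⟫) (gaussN n) :=
    (integrable_ridge hρ1 hb1 (by fun_prop) (by fun_prop)).mul_const _
  have i12 : Integrable (fun ζ => ρ ⟪x, z + v + c • ζ⟫ - ρ ⟪x, z + c • ζ⟫) (gaussN n) := i1.sub i2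
  rw [← integral_mul_const, ← integral_sub i1 i2, ← integral_sub i12 i3]
  have := norm_integral_le_of_norm_le_const (μ := gaussN n)
    (f := fun ζ => ρ ⟪x, z + v + c • ζ⟫ - ρ ⟪x, z + c • ζ⟫ - ρ1 ⟪x, z + c • ζ⟫ * ⟪x, v⟫) (C := L * ⟪x, v⟫ ^ 2)
    (ae_of_all _ fun ζ => by
      have := hT ⟪x, z + c • ζ⟫ ⟪x, v⟫
      rwa [← inner_add_right, add_right_comm z (c • ζ) v] at this)
  simpa using this

lemma integral_gaussN_add {a b c : ℝ} (h : a ^ 2 + b ^ 2 = c ^ 2) {f : Euc n → ℝ} (hf : Measurable f) {B : ℝ}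
    (hB : ∀ z, |f z| ≤ B) (z : Euc n) :
    ∫ ζ, ∫ ζ', f (z + a • ζ + b • ζ') ∂(gaussN n) ∂(gaussN n) = ∫ ζ, f (z + c • ζ) ∂(gaussN n) := by
  have hf' : Measurable (fun y => f (z + y)) := hf.comp (measurable_const_add z)
  have e1 : ∫ ζ, f (z + c • ζ) ∂(gaussN n) = ∫ y, f (z + y) ∂((gaussN n).map (fun ζ => c • ζ)) := by
    rw [integral_map (by fun_prop) hf'.aestronglyMeasurable]
  rw [e1, ← gaussN_semigroup n h, integral_map (by fun_prop) hf'.aestronglyMeasurable, integral_prod]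
  · simp_rw [add_assoc]
  · exact Integrable.of_bound (hf'.comp (by fun_prop)).aestronglyMeasurable B (ae_of_all _ fun _ => hB _)

lemma integral_smoothedRidge {ρ : ℝ → ℝ} (hρ : Measurable ρ) {L : ℝ} (hb : ∀ y, |ρ y| ≤ L) {a b c : ℝ}
    (h : a ^ 2 + b ^ 2 = c ^ 2) (x z : Euc n) :
    ∫ ζ, smoothedRidge ρ b x (z + a • ζ) ∂(gaussN n) = smoothedRidge ρ c x z :=
  integral_gaussN_add (f := fun y => ρ ⟪x, y⟫) h (measurable_ridge hρ measurable_const measurable_id) (fun _ => hb _) z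

variable {ν : Measure (Euc n)}

lemma measurable_integral_quadPot [SFinite ν] {θ : Euc n → ℝ} (hθm : Measurable θ) (lam : ℝ) {F : Euc n → Euc n → ℝ}
    (hF : Measurable (Function.uncurry F)) : Measurable (fun z => ∫ x, quadPot lam (θ x) (F x z) ∂ν) := by
  have h : Measurable (fun q : Euc n × Euc n => F q.2 q.1) := hF.comp measurable_swap
  have : Measurable (fun q : Euc n × Euc n => quadPot lam (θ q.2) (F q.2 q.1)) := by
    unfold quadPot; fun_prop
  exact (this.stronglyMeasurable.integral_prod_right' (ν := ν)).measurable

lemma abs_integral_quadPot_le [IsFiniteMeasure ν] {θ : Euc n → ℝ} {lam : ℝ} (hθ0 : ∀ x, 0 ≤ θ x)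
    (hθ1 : ∀ x, θ x ≤ |lam| / 2) {f : Euc n → ℝ} (hf : ∀ x, 0 ≤ f x ∧ f x ≤ 1) :
    |∫ x, quadPot lam (θ x) (f x) ∂ν| ≤ 2 * |lam| * ν.real univ :=
  norm_integral_le_of_norm_le_const (μ := ν) (f := fun x => quadPot lam (θ x) (f x))
    (C := 2 * |lam|) (ae_of_all _ fun x => abs_quadPot_le (hθ0 x) (hθ1 x) (hf x).1 (hf x).2)

/-- Gaussian Brascamp-Lieb type inequality for averages of ridge functions. -/
lemma integral_exp_quadPot_le (hn : n ≠ 0) [IsFiniteMeasure ν] {K lam L : ℝ} (hK : 0 < K) (hL : 1 ≤ L)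
    (hν2 : ∀ v : Euc n, Integrable (fun x => ⟪x, v⟫ ^ 2) ν ∧ ∫ x, ⟪x, v⟫ ^ 2 ∂ν ≤ K * ‖v‖ ^ 2)
    (hν1 : Integrable (fun x : Euc n => x) ν) {θ : Euc n → ℝ} (hθm : Measurable θ) (hθ0 : ∀ x, 0 ≤ θ x)
    (hθ1 : ∀ x, θ x ≤ |lam| / 2) (hθ : ∀ᵐ x ∂ν, θ x * ‖x‖ ^ 2 = 2 * K * lam ^ 2)
    {ρ ρ1 : ℝ → ℝ} (hρ : Measurable ρ) (hρ1 : Measurable ρ1) (h01 : ∀ y, 0 ≤ ρ y ∧ ρ y ≤ 1)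
    (hb1 : ∀ y, |ρ1 y| ≤ L) (hT : ∀ y k, |ρ (y + k) - ρ y - ρ1 y * k| ≤ L * k ^ 2) :
    ∫ ζ, exp (∫ x, quadPot lam (θ x) (ρ ⟪x, ζ⟫) ∂ν) ∂(gaussN n) ≤
      exp (∫ x, quadPot lam (θ x) (∫ ζ, ρ ⟪x, ζ⟫ ∂(gaussN n)) ∂ν) := by
  obtain ⟨C, hC0, hC⟩ := exists_brascampLieb_step hn hK hL hν2 hν1 hθm hθ0 hθ1 hθ
  have hb : ∀ y, |ρ y| ≤ 1 := fun y => by rw [abs_of_nonneg (h01 y).1]; exact (h01 y).2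
  have hbL : ∀ y, |ρ y| ≤ L := fun y => (hb y).trans hL
  have hF01 : ∀ c (x z : Euc n), 0 ≤ smoothedRidge ρ c x z ∧ smoothedRidge ρ c x z ≤ 1 := fun c x z =>
    ⟨smoothedRidge_nonneg (fun y => (h01 y).1) c x z, (le_abs_self _).trans (abs_smoothedRidge_le hb c x z)⟩
  obtain ⟨V, hV⟩ : ∃ V : ℝ → Euc n → ℝ, ∀ c z, V c z = ∫ x, quadPot lam (θ x) (smoothedRidge ρ c x z) ∂ν :=
    ⟨_, fun _ _ => rfl⟩
  have hVb : ∀ c z, |V c z| ≤ 2 * |lam| * ν.real univ := fun c z => by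
    rw [hV]; exact abs_integral_quadPot_le hθ0 hθ1 (hF01 c · z)
  have hVm : ∀ c, Measurable (V c) := fun c => by
    rw [funext (hV c)]; exact measurable_integral_quadPot hθm lam (measurable_smoothedRidge hρ c)
  have hV0 : ∀ ζ, V 0 ζ = ∫ x, quadPot lam (θ x) (ρ ⟪x, ζ⟫) ∂ν := fun ζ => by
    rw [hV]; simp only [smoothedRidge_zero]
  have hV1 : V 1 0 = ∫ x, quadPot lam (θ x) (∫ ζ, ρ ⟪x, ζ⟫ ∂(gaussN n)) ∂ν := by
    rw [hV]; simp [smoothedRidge]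
  have hVs : ∀ {a b c : ℝ}, a ^ 2 + b ^ 2 = c ^ 2 → ∀ z,
      ∫ x, quadPot lam (θ x) (∫ ζ, smoothedRidge ρ b x (z + a • ζ) ∂(gaussN n)) ∂ν = V c z := fun h z => by
    rw [hV]; simp only [integral_smoothedRidge hρ hb h]
  have hstep1 : ∀ c z δ, 0 < δ → δ ≤ 1 → ∫ ζ, exp (V c (z + δ • ζ)) ∂(gaussN n) ≤
      exp (∫ x, quadPot lam (θ x) (∫ ζ, smoothedRidge ρ c x (z + δ • ζ) ∂(gaussN n)) ∂ν + C * δ ^ 3) := fun c z δ hδ hδ1 => by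
    have m1 : ∀ z : Euc n, Measurable (fun x => smoothedRidge ρ1 c x z) := fun z =>
      (measurable_smoothedRidge hρ1 c).of_uncurry_right
    have h := hC (smoothedRidge ρ c) (smoothedRidge ρ1 c) (measurable_smoothedRidge hρ c) m1
        (hF01 c) (fun x z => abs_smoothedRidge_le hb1 c x z)
        (fun x z v => smoothedRidge_taylor hρ hρ1 hbL hb1 hT c x z v) z δ hδ hδ1
    simpa only [hV] using h
  simp_rw [← hV0]
  rw [← hV1]
  have hem : ∀ c, Measurable (fun z => exp (V c z)) := fun c => (hVm c).exp
  have heb : ∀ c z, |exp (V c z)| ≤ exp (2 * |lam| * ν.real univ) := fun c z => by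
    rw [abs_exp]; exact exp_le_exp.2 ((le_abs_self _).trans (hVb c z))
  have hstep : ∀ (δ : ℝ), 0 < δ → δ ≤ 1 → ∀ (j : ℕ) (z : Euc n),
      ∫ ζ, exp (V 0 (z + (√j * δ) • ζ)) ∂(gaussN n) ≤ exp (V (√j * δ) z + j * (C * δ ^ 3)) := by
    intro δ hδ hδ1 j
    induction j with
    | zero => intro z; simp
    | succ j ih =>
      intro z
      have hsq : δ ^ 2 + (√j * δ) ^ 2 = (√((j + 1 : ℕ) : ℝ) * δ) ^ 2 := by
        rw [mul_pow, mul_pow, sq_sqrt (by positivity), sq_sqrt (by positivity)]; push_cast; ring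
      rw [← integral_gaussN_add hsq (hem 0) (heb 0) z]
      have hmono : ∫ ζ, ∫ ζ', exp (V 0 (z + δ • ζ + (√j * δ) • ζ')) ∂(gaussN n) ∂(gaussN n) ≤
          ∫ ζ, exp (V (√j * δ) (z + δ • ζ)) * exp (j * (C * δ ^ 3)) ∂(gaussN n) := by
        refine integral_mono_of_nonneg (ae_of_all _ fun ζ => integral_nonneg fun _ => (exp_pos _).le) ?_
          (ae_of_all _ fun ζ => (ih (z + δ • ζ)).trans_eq (exp_add _ _))
        refine (Integrable.of_bound ((hem (√j * δ)).comp (by fun_prop)).aestronglyMeasurable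
          (exp (2 * |lam| * ν.real univ)) (ae_of_all _ fun _ => heb _ _)).mul_const _
      refine hmono.trans ?_
      rw [integral_mul_const]
      have h1 := hstep1 (√j * δ) z δ hδ hδ1
      rw [hVs hsq] at h1
      refine (mul_le_mul_of_nonneg_right h1 (exp_pos _).le).trans_eq ?_
      rw [← exp_add]
      congr 1
      push_cast
      ring
  have hlim : Tendsto (fun M : ℕ => exp (V 1 0 + C * (√(M : ℝ))⁻¹)) atTop (𝓝 (exp (V 1 0 + C * 0))) := by
    refine (continuous_exp.tendsto _).comp (tendsto_const_nhds.add (tendsto_const_nhds.mul ?_))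
    exact tendsto_inv_atTop_zero.comp ((tendsto_sqrt_atTop).comp tendsto_natCast_atTop_atTop)
  rw [mul_zero, add_zero] at hlim
  refine ge_of_tendsto hlim ?_
  filter_upwards [eventually_ge_atTop 1] with M hM
  have hM1 : (1:ℝ) ≤ M := by exact_mod_cast hM
  have hs : 1 ≤ √(M : ℝ) := Real.one_le_sqrt.2 hM1
  have hs0 : 0 < √(M : ℝ) := by linarith
  have h := hstep (√(M:ℝ))⁻¹ (by positivity) (inv_le_one_of_one_le₀ hs) M 0
  rw [mul_inv_cancel₀ hs0.ne'] at h
  simp only [one_smul, zero_add] at h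
  refine h.trans_eq ?_
  congr 2
  have : (M:ℝ) = √(M:ℝ) ^ 2 := (sq_sqrt (by positivity)).symm
  nth_rewrite 1 [this]
  field_simp

/-- Bernstein-type exponential moment bound for averages of ridge functions. -/
lemma integral_exp_ridge_le (hn : n ≠ 0) [IsFiniteMeasure ν] {K lam L : ℝ} (hK : 0 < K) (hL : 1 ≤ L)
    (hν2 : ∀ v : Euc n, Integrable (fun x => ⟪x, v⟫ ^ 2) ν ∧ ∫ x, ⟪x, v⟫ ^ 2 ∂ν ≤ K * ‖v‖ ^ 2)
    (hν1 : Integrable (fun x : Euc n => x) ν) (hlam : lam ≠ 0) (hfar : ∀ᵐ x ∂ν, 4 * K * |lam| ≤ ‖x‖ ^ 2)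
    {ρ ρ1 : ℝ → ℝ} (hρ : Measurable ρ) (hρ1 : Measurable ρ1) (h01 : ∀ y, 0 ≤ ρ y ∧ ρ y ≤ 1)
    (hb1 : ∀ y, |ρ1 y| ≤ L) (hT : ∀ y k, |ρ (y + k) - ρ y - ρ1 y * k| ≤ L * k ^ 2) :
    ∫ ζ, exp (lam * (∫ x, ρ ⟪x, ζ⟫ ∂ν - ∫ x, ∫ ζ', ρ ⟪x, ζ'⟫ ∂(gaussN n) ∂ν)) ∂(gaussN n) ≤
      exp (2 * K * lam ^ 2 * ∫ x, (‖x‖ ^ 2)⁻¹ * ∫ ζ, ρ ⟪x, ζ⟫ ∂(gaussN n) ∂ν) := by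
  have hl : 0 < |lam| := abs_pos.2 hlam
  set θ : Euc n → ℝ := fun x => min (2 * K * lam ^ 2 * (‖x‖ ^ 2)⁻¹) (|lam| / 2) with hθdef
  have hθm : Measurable θ := by
    have : Measurable fun x : Euc n => (‖x‖ ^ 2)⁻¹ := (by fun_prop : Measurable fun x : Euc n => ‖x‖ ^ 2).inv
    rw [hθdef]; fun_prop
  have hθ0 : ∀ x, 0 ≤ θ x := fun x => le_min (by positivity) (by positivity)
  have hθ1 : ∀ x, θ x ≤ |lam| / 2 := fun x => min_le_right _ _
  have hθe : ∀ᵐ x ∂ν, θ x = 2 * K * lam ^ 2 * (‖x‖ ^ 2)⁻¹ ∧ 0 < ‖x‖ ^ 2 := by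
    filter_upwards [hfar] with x hx
    have hx0 : 0 < ‖x‖ ^ 2 := lt_of_lt_of_le (by positivity) hx
    refine ⟨min_eq_left ?_, hx0⟩
    rw [← div_eq_mul_inv, div_le_iff₀ hx0, ← sq_abs lam]
    nlinarith
  have hθ : ∀ᵐ x ∂ν, θ x * ‖x‖ ^ 2 = 2 * K * lam ^ 2 := by
    filter_upwards [hθe] with x hx
    rw [hx.1, mul_assoc, inv_mul_cancel₀ hx.2.ne', mul_one]
  have h := integral_exp_quadPot_le hn hK hL hν2 hν1 hθm hθ0 hθ1 hθ hρ hρ1 h01 hb1 hT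
  have hb : ∀ y, |ρ y| ≤ 1 := fun y => by rw [abs_of_nonneg (h01 y).1]; exact (h01 y).2
  set m : Euc n → ℝ := fun x => ∫ ζ, ρ ⟪x, ζ⟫ ∂(gaussN n) with hm
  have hmm : Measurable m := by
    have := (measurable_smoothedRidge (n := n) hρ 1).comp (by fun_prop : Measurable fun x : Euc n => (x, (0 : Euc n)))
    have e : (Function.uncurry (smoothedRidge ρ 1) ∘ fun x : Euc n => (x, (0 : Euc n))) = m := by
      ext x; simp [smoothedRidge, hm]
    rwa [e] at this
  have hm01 : ∀ x, 0 ≤ m x ∧ m x ≤ 1 := fun x => by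
    have := abs_smoothedRidge_le hb 1 x 0
    have e : smoothedRidge ρ 1 x 0 = m x := by simp [smoothedRidge, hm]
    rw [e] at this
    exact ⟨integral_nonneg fun _ => (h01 _).1, (abs_le.1 this).2⟩
  have im : Integrable m ν := Integrable.of_bound hmm.aestronglyMeasurable 1 (ae_of_all _ fun x => by
    rw [norm_of_nonneg (hm01 x).1]; exact (hm01 x).2)
  have iq : ∀ f : Euc n → ℝ, Measurable f → (∀ x, 0 ≤ f x ∧ f x ≤ 1) → Integrable (fun x => quadPot lam (θ x) (f x)) ν :=
    fun f hf hf1 => Integrable.of_bound (measurable_quadPot_comp hθm hf).aestronglyMeasurable (2 * |lam|)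
      (ae_of_all _ fun x => abs_quadPot_le (hθ0 x) (hθ1 x) (hf1 x).1 (hf1 x).2)
  have iθm : Integrable (fun x => θ x * m x) ν := im.bdd_mul hθm.aestronglyMeasurable
    (ae_of_all _ fun x => by rw [norm_of_nonneg (hθ0 x)]; exact hθ1 x)
  have hρm : ∀ ζ, Measurable (fun x : Euc n => ρ ⟪x, ζ⟫) := fun ζ => measurable_ridge hρ measurable_id measurable_const
  have iρ : ∀ ζ, Integrable (fun x : Euc n => ρ ⟪x, ζ⟫) ν := fun ζ => integrable_ridge hρ hb measurable_id measurable_const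
  have hlow : ∀ ζ, lam * ∫ x, ρ ⟪x, ζ⟫ ∂ν ≤ ∫ x, quadPot lam (θ x) (ρ ⟪x, ζ⟫) ∂ν := by
    intro ζ
    rw [← integral_const_mul]
    refine integral_mono ((iρ ζ).const_mul _) (iq _ (hρm ζ) fun x => h01 _) fun x => ?_
    have h1 : 0 ≤ θ x * (ρ ⟪x, ζ⟫ - ρ ⟪x, ζ⟫ ^ 2) :=
      mul_nonneg (hθ0 x) (by nlinarith [h01 ⟪x, ζ⟫])
    simp only [quadPot]; linarith
  have hup : ∫ x, quadPot lam (θ x) (m x) ∂ν ≤ lam * ∫ x, m x ∂ν + 2 * K * lam ^ 2 * ∫ x, (‖x‖ ^ 2)⁻¹ * m x ∂ν := by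
    have e : 2 * K * lam ^ 2 * ∫ x, (‖x‖ ^ 2)⁻¹ * m x ∂ν = ∫ x, θ x * m x ∂ν := by
      rw [← integral_const_mul]
      refine integral_congr_ae ?_
      filter_upwards [hθe] with x hx
      rw [hx.1]; ring
    rw [e, ← integral_const_mul, ← integral_add (im.const_mul _) iθm]
    refine integral_mono (iq _ hmm hm01) ((im.const_mul _).add iθm) fun x => ?_
    have h1 : 0 ≤ θ x * m x ^ 2 := mul_nonneg (hθ0 x) (sq_nonneg _)
    simp only [quadPot]; linarith
  have hmono : ∫ ζ, exp (lam * ∫ x, ρ ⟪x, ζ⟫ ∂ν) ∂(gaussN n) ≤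
      ∫ ζ, exp (∫ x, quadPot lam (θ x) (ρ ⟪x, ζ⟫) ∂ν) ∂(gaussN n) := by
    refine integral_mono_of_nonneg (ae_of_all _ fun _ => (exp_pos _).le) ?_ (ae_of_all _ fun ζ => exp_le_exp.2 (hlow ζ))
    have hj : Measurable (fun q : Euc n × Euc n => quadPot lam (θ q.2) (ρ ⟪q.2, q.1⟫)) := by
      have : Measurable (fun q : Euc n × Euc n => ρ ⟪q.2, q.1⟫) := measurable_ridge hρ measurable_snd measurable_fst
      unfold quadPot; fun_prop
    refine Integrable.of_bound (hj.stronglyMeasurable.integral_prod_right' (ν := ν)).measurable.exp.aestronglyMeasurable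
      (exp (2 * |lam| * ν.real univ)) (ae_of_all _ fun ζ => ?_)
    rw [norm_eq_abs, abs_exp]
    exact exp_le_exp.2 ((le_abs_self _).trans (abs_integral_quadPot_le hθ0 hθ1 fun _ => h01 _))
  have e : ∀ ζ : Euc n, exp (lam * (∫ x, ρ ⟪x, ζ⟫ ∂ν - ∫ x, m x ∂ν)) =
      exp (lam * ∫ x, ρ ⟪x, ζ⟫ ∂ν) * exp (-(lam * ∫ x, m x ∂ν)) := fun ζ => by
    rw [← exp_add]; congr 1; ring
  simp_rw [e]
  rw [integral_mul_const]
  have h2 := hmono.trans (h.trans (exp_le_exp.2 hup))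
  refine (mul_le_mul_of_nonneg_right h2 (exp_pos _).le).trans_eq ?_
  rw [← exp_add]
  congr 1
  ring

end

section
variable {n : ℕ} {ν : Measure (Euc n)}

/-- Average over `ν` of the ridge function `z ↦ ρ ⟪x, z⟫`. -/
noncomputable def ridgeAvg (ν : Measure (Euc n)) (ρ : ℝ → ℝ) (z : Euc n) : ℝ := ∫ x, ρ ⟪x, z⟫ ∂ν

lemma measurable_ridgeAvg [SFinite ν] {ρ : ℝ → ℝ} (hρ : Measurable ρ) : Measurable (ridgeAvg ν ρ) := by
  have : Measurable (fun q : Euc n × Euc n => ρ ⟪q.2, q.1⟫) := measurable_ridge hρ measurable_snd measurable_fst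
  exact (this.stronglyMeasurable.integral_prod_right' (ν := ν)).measurable

lemma abs_ridgeAvg_le [IsFiniteMeasure ν] {ρ : ℝ → ℝ} {L : ℝ} (hL : ∀ y, |ρ y| ≤ L) (z : Euc n) :
    |ridgeAvg ν ρ z| ≤ L * ν.real univ :=
  norm_integral_le_of_norm_le_const (μ := ν) (f := fun x => ρ ⟪x, z⟫) (C := L) (ae_of_all _ fun _ => hL _)

lemma integral_ridgeAvg [IsFiniteMeasure ν] {ρ : ℝ → ℝ} (hρ : Measurable ρ) {L : ℝ} (hL : ∀ y, |ρ y| ≤ L) :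
    ∫ z, ridgeAvg ν ρ z ∂(gaussN n) = ∫ x, ∫ z, ρ ⟪x, z⟫ ∂(gaussN n) ∂ν := by
  refine integral_integral_swap (f := fun z x => ρ ⟪x, z⟫) ?_
  exact integrable_ridge hρ hL measurable_snd measurable_fst

lemma integrable_ridgeAvg [IsFiniteMeasure ν] {ρ : ℝ → ℝ} (hρ : Measurable ρ) {L : ℝ} (hL : ∀ y, |ρ y| ≤ L) :
    Integrable (ridgeAvg ν ρ) (gaussN n) :=
  Integrable.of_bound (measurable_ridgeAvg hρ).aestronglyMeasurable _ (ae_of_all _ fun z => abs_ridgeAvg_le hL z)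

/-- Bernstein-type deviation inequality for averages of ridge functions. -/
lemma ridgeAvg_deviation (hn : n ≠ 0) [IsFiniteMeasure ν] {K lam L V : ℝ} (hK : 0 < K) (hL : 1 ≤ L)
    (hν2 : ∀ v : Euc n, Integrable (fun x => ⟪x, v⟫ ^ 2) ν ∧ ∫ x, ⟪x, v⟫ ^ 2 ∂ν ≤ K * ‖v‖ ^ 2)
    (hν1 : Integrable (fun x : Euc n => x) ν) (hlam : 0 < lam) (hfar : ∀ᵐ x ∂ν, 4 * K * lam ≤ ‖x‖ ^ 2)
    {ρ ρ1 : ℝ → ℝ} (hρ : Measurable ρ) (hρ1 : Measurable ρ1) (h01 : ∀ y, 0 ≤ ρ y ∧ ρ y ≤ 1)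
    (hb1 : ∀ y, |ρ1 y| ≤ L) (hT : ∀ y k, |ρ (y + k) - ρ y - ρ1 y * k| ≤ L * k ^ 2)
    (hV : ∫ x, (‖x‖ ^ 2)⁻¹ * ∫ ζ, ρ ⟪x, ζ⟫ ∂(gaussN n) ∂ν ≤ V) (s : ℝ) :
    (gaussN n).real {z | s ≤ |ridgeAvg ν ρ z - ∫ z', ridgeAvg ν ρ z' ∂(gaussN n)|} ≤
      2 * exp (-(lam * s) + 2 * K * lam ^ 2 * V) := by
  have hb : ∀ y, |ρ y| ≤ 1 := fun y => by rw [abs_of_nonneg (h01 y).1]; exact (h01 y).2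
  rw [integral_ridgeAvg hρ hb]
  set E := ∫ x, ∫ z, ρ ⟪x, z⟫ ∂(gaussN n) ∂ν with hE
  set X : Euc n → ℝ := fun z => ridgeAvg ν ρ z - E with hX
  have hXm : Measurable X := (measurable_ridgeAvg hρ).sub_const _
  have hXb : ∀ z, |X z| ≤ 1 * ν.real univ + |E| := fun z =>
    (abs_sub _ _).trans (by gcongr; exact abs_ridgeAvg_le hb z)
  have hint : ∀ t : ℝ, Integrable (fun z => exp (t * X z)) (gaussN n) := fun t =>
    Integrable.of_bound (by fun_prop) (exp (|t| * (1 * ν.real univ + |E|))) (ae_of_all _ fun z => by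
      rw [norm_eq_abs, abs_exp]
      refine exp_le_exp.2 ((le_abs_self _).trans ?_)
      rw [abs_mul]; gcongr; exact hXb z)
  have hmgf : ∀ t : ℝ, |t| = lam → mgf X (gaussN n) t ≤ exp (2 * K * lam ^ 2 * V) := by
    intro t ht
    have h := integral_exp_ridge_le hn hK hL hν2 hν1 (lam := t) (by rw [← abs_pos, ht]; exact hlam)
      (by rw [ht]; exact hfar) hρ hρ1 h01 hb1 hT
    have e : t ^ 2 = lam ^ 2 := by rw [← sq_abs, ht]
    rw [e] at h
    exact h.trans (exp_le_exp.2 (by gcongr))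
  have h1 := measure_ge_le_exp_mul_mgf (μ := gaussN n) (X := X) s hlam.le (hint lam)
  have h2 := measure_le_le_exp_mul_mgf (μ := gaussN n) (X := X) (-s) (neg_nonpos.2 hlam.le) (hint (-lam))
  have h3 : {z | s ≤ |X z|} ⊆ {z | s ≤ X z} ∪ {z | X z ≤ -s} := by
    intro z hz
    rcases le_abs.1 (show s ≤ |X z| from hz) with h | h
    · exact Or.inl h
    · exact Or.inr (by simp only [Set.mem_ofPred_eq]; linarith)
  have h4 := (measureReal_mono (μ := gaussN n) h3).trans (measureReal_union_le _ _)
  have h5 : exp (-lam * s) * mgf X (gaussN n) lam ≤ exp (-(lam * s) + 2 * K * lam ^ 2 * V) := by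
    rw [exp_add, neg_mul]; gcongr; exact hmgf _ (abs_of_pos hlam)
  have h6 : exp (-(-lam) * -s) * mgf X (gaussN n) (-lam) ≤ exp (-(lam * s) + 2 * K * lam ^ 2 * V) := by
    rw [exp_add, show -(-lam) * -s = -(lam * s) by ring]; gcongr; exact hmgf _ (by rw [abs_neg, abs_of_pos hlam])
  linarith

/-- Deviation of a bounded function which is nearly Lipschitz at most points. -/
lemma deviation_of_lipschitz_on (hn : n ≠ 0) {f : Euc n → ℝ} (hf : Measurable f) (h01 : ∀ z, 0 ≤ f z ∧ f z ≤ 1)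
    {B : Set (Euc n)} (hB : MeasurableSet B) {s δ : ℝ} (hs : 0 < s) (hδ : 0 ≤ δ)
    (hlip : ∀ w ∉ B, ∀ z, dist w z < δ → |f w - f z| ≤ s) :
    (gaussN n).real {z | 2 * s < |f z - ∫ z', f z' ∂(gaussN n)|} ≤
      (gaussN n).real B + 2 / s * exp (-(n * δ ^ 2 / 5)) := by
  set E := ∫ z', f z' ∂(gaussN n) with hE
  have iF : Integrable f (gaussN n) := Integrable.of_bound hf.aestronglyMeasurable 1 (ae_of_all _ fun z => by
    rw [norm_of_nonneg (h01 z).1]; exact (h01 z).2)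
  have hE1 : E ≤ 1 := by
    have := integral_mono iF (integrable_const (1:ℝ)) fun z => (h01 z).2
    simpa using this
  have hE0 : 0 ≤ E := integral_nonneg fun z => (h01 z).1
  rcases le_or_gt 1 s with hs1 | hs1
  · have : {z | 2 * s < |f z - E|} = ∅ := by
      ext z
      simp only [Set.mem_ofPred_eq, Set.mem_empty_iff_false, iff_false, not_lt]
      exact (abs_le.2 ⟨by linarith [(h01 z).1], by linarith [(h01 z).2]⟩ : |f z - E| ≤ 2 * s)
    rw [this]
    simp only [measureReal_empty]
    positivity
  have key : ∀ A D : Set (Euc n), MeasurableSet A → MeasurableSet D → s ≤ (gaussN n).real A →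
      (∀ z ∈ A, ∀ w ∈ D, s < |f w - f z|) →
      (gaussN n).real (D \ B) ≤ s⁻¹ * exp (-(n * δ ^ 2 / 5)) := by
    intro A D hA hD hsA hAD
    refine gaussN_real_le_of_far hn hA (hD.diff hB) hδ (fun z hz w hw => ?_) hs hsA
    by_contra! h
    exact absurd (hlip w hw.2 z h) (not_le.2 (hAD z hz w hw.1))
  have mle : MeasurableSet {z | f z ≤ E + s} := measurableSet_le hf measurable_const
  have mge : MeasurableSet {z | E - s ≤ f z} := measurableSet_le measurable_const hf
  have k1 := key {z | f z ≤ E + s} {z | E + 2 * s < f z} mle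
    (measurableSet_lt measurable_const hf) (by
      rcases lt_or_ge 1 (E + s) with hEs | hEs
      · have : {z | f z ≤ E + s} = univ := by
          ext z
          simp only [Set.mem_ofPred_eq, Set.mem_univ, iff_true]
          linarith [(h01 z).2]
        rw [this, probReal_univ]
        exact hs1.le
      have h1 : (E + s) * (gaussN n).real {z | E + s ≤ f z} ≤ E :=
        mul_meas_ge_le_integral_of_nonneg (ae_of_all _ fun z => (h01 z).1) iF (E + s)
      have h2 : (gaussN n).real {z | f z ≤ E + s}ᶜ ≤ (gaussN n).real {z | E + s ≤ f z} :=
        measureReal_mono fun z hz => le_of_lt (not_le.1 (show ¬ f z ≤ E + s from hz))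
      rw [probReal_compl_eq_one_sub mle] at h2
      set p := (gaussN n).real {z | f z ≤ E + s}
      set q := (gaussN n).real {z | E + s ≤ f z}
      have hq : q ≤ 1 := measureReal_le_one
      have hp : p ≤ 1 := measureReal_le_one
      have hp0 : 0 ≤ p := measureReal_nonneg
      nlinarith)
    (fun z hz w hw => lt_of_lt_of_le (by linarith [show f z ≤ E + s from hz, show E + 2 * s < f w from hw]) (le_abs_self _))
  have k2 := key {z | E - s ≤ f z} {z | f z < E - 2 * s} mge
    (measurableSet_lt hf measurable_const) (by
      rcases lt_or_ge E s with hEs | hEs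
      · have : {z | E - s ≤ f z} = univ := by
          ext z
          simp only [Set.mem_ofPred_eq, Set.mem_univ, iff_true]
          linarith [(h01 z).1]
        rw [this, probReal_univ]
        exact hs1.le
      have h1 : E ≤ ∫ z, ((E - s) + {z | E - s ≤ f z}.indicator (fun _ => (1:ℝ)) z) ∂(gaussN n) := by
        refine integral_mono iF ((integrable_const _).add ((integrable_const _).indicator mge)) fun z => ?_
        by_cases hz : z ∈ {z | E - s ≤ f z}
        · simp only [Set.indicator_of_mem hz]
          linarith [(h01 z).2]
        · simp only [Set.indicator_of_notMem hz]
          linarith [not_le.1 (show ¬ E - s ≤ f z from hz)]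
      rw [integral_add (integrable_const _) ((integrable_const _).indicator mge), integral_indicator_const _ mge,
        integral_const, probReal_univ, one_smul, smul_eq_mul, mul_one] at h1
      linarith)
    (fun z hz w hw => lt_of_lt_of_le (by linarith [show E - s ≤ f z from hz, show f w < E - 2 * s from hw]) (neg_le_abs _))
  have hsub : {z | 2 * s < |f z - E|} ⊆ B ∪ ({z | E + 2 * s < f z} \ B ∪ {z | f z < E - 2 * s} \ B) := by
    intro z hz
    by_cases hzB : z ∈ B
    · exact Or.inl hzB
    · rcases lt_abs.1 (show 2 * s < |f z - E| from hz) with h | h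
      · exact Or.inr (Or.inl ⟨by simp only [Set.mem_ofPred_eq]; linarith, hzB⟩)
      · exact Or.inr (Or.inr ⟨by simp only [Set.mem_ofPred_eq]; linarith, hzB⟩)
  have h1 := (measureReal_mono (μ := gaussN n) hsub).trans (measureReal_union_le _ _)
  have h2 := measureReal_union_le (μ := gaussN n) ({z | E + 2 * s < f z} \ B) ({z | f z < E - 2 * s} \ B)
  rw [div_eq_mul_inv]
  linarith

end

/-- Clamping of a real number to the unit interval. -/
noncomputable def clampUnit (x : ℝ) : ℝ := max 0 (min x 1)

/-- The cubic smoothstep function. -/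
noncomputable def smoothStep (x : ℝ) : ℝ := 3 * clampUnit x ^ 2 - 2 * clampUnit x ^ 3

/-- The derivative of the cubic smoothstep function. -/
noncomputable def smoothStepDeriv (x : ℝ) : ℝ := 6 * clampUnit x * (1 - clampUnit x)

lemma continuous_clampUnit : Continuous clampUnit := by unfold clampUnit; fun_prop

lemma continuous_smoothStep : Continuous smoothStep := by
  have := continuous_clampUnit; unfold smoothStep; fun_prop

lemma continuous_smoothStepDeriv : Continuous smoothStepDeriv := by
  have := continuous_clampUnit; unfold smoothStepDeriv; fun_prop

lemma clampUnit_nonneg (x : ℝ) : 0 ≤ clampUnit x := le_max_left _ _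

lemma clampUnit_le_one (x : ℝ) : clampUnit x ≤ 1 := max_le zero_le_one (min_le_right _ _)

lemma clampUnit_mono {x y : ℝ} (h : x ≤ y) : clampUnit x ≤ clampUnit y := by unfold clampUnit; gcongr

lemma clampUnit_of_nonpos {x : ℝ} (h : x ≤ 0) : clampUnit x = 0 :=
  max_eq_left ((min_le_left _ _).trans h)

lemma clampUnit_of_one_le {x : ℝ} (h : 1 ≤ x) : clampUnit x = 1 := by
  unfold clampUnit; rw [min_eq_right h, max_eq_right zero_le_one]

lemma clampUnit_of_mem {x : ℝ} (h : 0 ≤ x) (h' : x ≤ 1) : clampUnit x = x := by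
  unfold clampUnit; rw [min_eq_left h', max_eq_right h]

lemma abs_clampUnit_sub_le (x y : ℝ) : |clampUnit x - clampUnit y| ≤ |x - y| := by
  unfold clampUnit
  refine (abs_max_sub_max_le_max _ _ _ _).trans ?_
  simp only [sub_self, abs_zero]
  refine max_le (abs_nonneg _) ((abs_min_sub_min_le_max _ _ _ _).trans ?_)
  simp

lemma smoothStep_nonneg (x : ℝ) : 0 ≤ smoothStep x := by
  unfold smoothStep
  have h0 := clampUnit_nonneg x
  have h1 := clampUnit_le_one x
  have : 0 ≤ clampUnit x ^ 2 * (3 - 2 * clampUnit x) := mul_nonneg (sq_nonneg _) (by linarith)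
  linarith

lemma smoothStep_of_nonpos {x : ℝ} (h : x ≤ 0) : smoothStep x = 0 := by
  unfold smoothStep; rw [clampUnit_of_nonpos h]; norm_num

lemma smoothStep_of_one_le {x : ℝ} (h : 1 ≤ x) : smoothStep x = 1 := by
  unfold smoothStep; rw [clampUnit_of_one_le h]; norm_num

lemma smoothStep_mono {x y : ℝ} (h : x ≤ y) : smoothStep x ≤ smoothStep y := by
  have h1 := clampUnit_mono h
  have h0 := clampUnit_nonneg x
  have h2 := clampUnit_le_one y
  unfold smoothStep
  set a := clampUnit x
  set b := clampUnit y
  have e : 3 * b ^ 2 - 2 * b ^ 3 - (3 * a ^ 2 - 2 * a ^ 3) =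
      (b - a) * (2 * (a * (1 - a)) + 2 * (b * (1 - b)) + a * (1 - b) + b * (1 - a)) := by ring
  have h3 : 0 ≤ a * (1 - a) := mul_nonneg h0 (by linarith)
  have h4 : 0 ≤ b * (1 - b) := mul_nonneg (by linarith) (by linarith)
  have h5 : 0 ≤ a * (1 - b) := mul_nonneg h0 (by linarith)
  have h6 : 0 ≤ b * (1 - a) := mul_nonneg (by linarith) (by linarith)
  have h7 : 0 ≤ (b - a) * (2 * (a * (1 - a)) + 2 * (b * (1 - b)) + a * (1 - b) + b * (1 - a)) :=
    mul_nonneg (by linarith) (by linarith)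
  linarith

lemma smoothStep_le_one (x : ℝ) : smoothStep x ≤ 1 := by
  have := smoothStep_mono (le_max_left x 1)
  rwa [smoothStep_of_one_le (le_max_right x 1)] at this

lemma abs_smoothStepDeriv_le (x : ℝ) : |smoothStepDeriv x| ≤ 6 := by
  unfold smoothStepDeriv
  have h0 := clampUnit_nonneg x
  have h1 := clampUnit_le_one x
  rw [abs_of_nonneg (mul_nonneg (by linarith) (by linarith))]
  nlinarith

lemma abs_smoothStep_sub_le (x y : ℝ) : |smoothStep x - smoothStep y| ≤ 2 * |x - y| := by
  have h := abs_clampUnit_sub_le x y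
  have h0 := clampUnit_nonneg x
  have h1 := clampUnit_le_one x
  have h2 := clampUnit_nonneg y
  have h3 := clampUnit_le_one y
  unfold smoothStep
  set a := clampUnit x
  set b := clampUnit y
  have e : 3 * a ^ 2 - 2 * a ^ 3 - (3 * b ^ 2 - 2 * b ^ 3) = (a - b) * (3 * (a + b) - 2 * (a ^ 2 + a * b + b ^ 2)) := by
    ring
  rw [e, abs_mul, mul_comm]
  refine mul_le_mul (abs_le.2 ⟨?_, ?_⟩) h (abs_nonneg _) (by norm_num)
  · nlinarith
  · nlinarith [sq_nonneg (a - 1 / 2), sq_nonneg (b - 1 / 2), sq_nonneg (a + b - 1)]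

lemma smoothStep_taylor (x k : ℝ) : |smoothStep (x + k) - smoothStep x - smoothStepDeriv x * k| ≤ 6 * k ^ 2 := by
  have h := abs_clampUnit_sub_le (x + k) x
  rw [add_sub_cancel_left] at h
  have h0 := clampUnit_nonneg x
  have h1 := clampUnit_le_one x
  have h2 := clampUnit_nonneg (x + k)
  have h3 := clampUnit_le_one (x + k)
  have hd : |smoothStepDeriv x * (clampUnit (x + k) - clampUnit x - k)| ≤ 3 / 2 * k ^ 2 := by
    rcases le_or_gt x 0 with hx | hx
    · rw [smoothStepDeriv, clampUnit_of_nonpos hx]; simp; positivity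
    rcases le_or_gt 1 x with hx1 | hx1
    · rw [smoothStepDeriv, clampUnit_of_one_le hx1]; simp; positivity
    rw [smoothStepDeriv, clampUnit_of_mem hx.le hx1.le]
    have hpos : 0 ≤ 6 * x * (1 - x) := mul_nonneg (by linarith) (by linarith)
    rw [abs_mul, abs_of_nonneg hpos]
    rcases le_or_gt (x + k) 0 with hk | hk
    · rw [clampUnit_of_nonpos hk, abs_of_nonneg (by linarith)]
      have h5 : 6 * x * (1 - x) * (0 - x - k) ≤ 6 * x * (0 - x - k) := by
        refine mul_le_mul_of_nonneg_right (by nlinarith) (by linarith)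
      nlinarith [sq_nonneg (2 * x + k)]
    rcases le_or_gt 1 (x + k) with hk1 | hk1
    · rw [clampUnit_of_one_le hk1, abs_of_nonpos (by linarith)]
      have h5 : 6 * x * (1 - x) * -(1 - x - k) ≤ 6 * (1 - x) * -(1 - x - k) := by
        refine mul_le_mul_of_nonneg_right (by nlinarith) (by linarith)
      nlinarith [sq_nonneg (2 * (1 - x) - k)]
    · rw [clampUnit_of_mem hk.le hk1.le]
      simp only [add_sub_cancel_left, sub_self, abs_zero, mul_zero]
      positivity
  set a := clampUnit x with ha
  set b := clampUnit (x + k) with hb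
  have e : smoothStep (x + k) - smoothStep x - smoothStepDeriv x * k =
      (b - a) ^ 2 * (3 - 4 * a - 2 * b) + smoothStepDeriv x * (b - a - k) := by
    unfold smoothStep smoothStepDeriv
    rw [← ha, ← hb]; ring
  rw [e]
  refine (abs_add_le _ _).trans ?_
  have h4 : |(b - a) ^ 2 * (3 - 4 * a - 2 * b)| ≤ k ^ 2 * 3 := by
    rw [abs_mul, abs_of_nonneg (sq_nonneg _), ← sq_abs (b - a), ← sq_abs k]
    gcongr
    exact abs_le.2 ⟨by linarith, by linarith⟩
  nlinarith [sq_nonneg k]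

/-- The smooth ramp rising from `0` at `t` to `1` at `t + h`. -/
noncomputable def ramp (t h y : ℝ) : ℝ := smoothStep ((y - t) / h)

/-- The derivative of `ramp`. -/
noncomputable def rampDeriv (t h y : ℝ) : ℝ := smoothStepDeriv ((y - t) / h) / h

section
variable {t h : ℝ}

lemma continuous_ramp : Continuous (ramp t h) := continuous_smoothStep.comp (by fun_prop)

lemma continuous_rampDeriv : Continuous (rampDeriv t h) := by
  have := continuous_smoothStepDeriv
  unfold rampDeriv; fun_prop

lemma ramp_nonneg (y : ℝ) : 0 ≤ ramp t h y := smoothStep_nonneg _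

lemma ramp_le_one (y : ℝ) : ramp t h y ≤ 1 := smoothStep_le_one _

lemma ramp_of_le (hh : 0 < h) {y : ℝ} (hy : y ≤ t) : ramp t h y = 0 :=
  smoothStep_of_nonpos (div_nonpos_of_nonpos_of_nonneg (by linarith) hh.le)

lemma ramp_of_ge (hh : 0 < h) {y : ℝ} (hy : t + h ≤ y) : ramp t h y = 1 :=
  smoothStep_of_one_le ((one_le_div hh).2 (by linarith))

lemma ramp_anti_width {h' : ℝ} (hh : 0 < h) (hh' : h ≤ h') (y : ℝ) : ramp t h' y ≤ ramp t h y := by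
  rcases le_or_gt y t with hy | hy
  · rw [ramp_of_le (hh.trans_le hh') hy, ramp_of_le hh hy]
  · exact smoothStep_mono (div_le_div_of_nonneg_left (by linarith) hh hh')

lemma abs_ramp_sub_le (hh : 0 < h) (x y : ℝ) : |ramp t h x - ramp t h y| ≤ 2 / h * |x - y| := by
  refine (abs_smoothStep_sub_le _ _).trans_eq ?_
  rw [← sub_div, sub_sub_sub_cancel_right, abs_div, abs_of_pos hh]; ring

lemma abs_rampDeriv_le (hh : 0 < h) (y : ℝ) : |rampDeriv t h y| ≤ 6 / h := by
  unfold rampDeriv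
  rw [abs_div, abs_of_pos hh]; gcongr; exact abs_smoothStepDeriv_le _

lemma ramp_taylor (y k : ℝ) : |ramp t h (y + k) - ramp t h y - rampDeriv t h y * k| ≤ 6 / h ^ 2 * k ^ 2 := by
  have := smoothStep_taylor ((y - t) / h) (k / h)
  unfold ramp rampDeriv
  rw [show (y + k - t) / h = (y - t) / h + k / h by ring,
    show smoothStepDeriv ((y - t) / h) / h * k = smoothStepDeriv ((y - t) / h) * (k / h) by ring]
  refine this.trans_eq ?_
  rw [div_pow]; ring

end

/-- The part of a sharp ramp not captured by a wider one. -/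
noncomputable def rampGap (t η h y : ℝ) : ℝ := ramp t η y - ramp t h y

section
variable {t η h : ℝ}

lemma rampGap_nonneg (hη : 0 < η) (hh : η ≤ h) (y : ℝ) : 0 ≤ rampGap t η h y :=
  sub_nonneg.2 (ramp_anti_width hη hh y)

lemma rampGap_le_one (y : ℝ) : rampGap t η h y ≤ 1 := by
  unfold rampGap; linarith [ramp_le_one (t := t) (h := η) y, ramp_nonneg (t := t) (h := h) y]

lemma rampGap_le_indicator (hη : 0 < η) (hh : η ≤ h) (y : ℝ) :
    rampGap t η h y ≤ (Icc t (t + h)).indicator (fun _ => (1:ℝ)) y := by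
  by_cases hy : y ∈ Icc t (t + h)
  · rw [Set.indicator_of_mem hy]; exact rampGap_le_one y
  · rw [Set.indicator_of_notMem hy]
    unfold rampGap
    rcases le_or_gt t y with h1 | h1
    · have h2 : t + h ≤ y := by by_contra! h3; exact hy ⟨h1, h3.le⟩
      rw [ramp_of_ge hη (by linarith), ramp_of_ge (hη.trans_le hh) h2, sub_self]
    · rw [ramp_of_le hη h1.le, ramp_of_le (hη.trans_le hh) h1.le, sub_self]

lemma exists_rampGap_taylor (hη : 0 < η) (hh : 0 < h) (t : ℝ) :
    ∃ (L : ℝ) (ρ1 : ℝ → ℝ), 1 ≤ L ∧ Measurable ρ1 ∧ (∀ y, |ρ1 y| ≤ L) ∧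
      ∀ y k, |rampGap t η h (y + k) - rampGap t η h y - ρ1 y * k| ≤ L * k ^ 2 := by
  have hpos : ∀ {u : ℝ}, 0 < u → 0 ≤ 6 / u ∧ 0 ≤ 6 / u ^ 2 := fun hu => ⟨by positivity, by positivity⟩
  refine ⟨1 + (6 / η + 6 / h) + (6 / η ^ 2 + 6 / h ^ 2), fun y => rampDeriv t η y - rampDeriv t h y, ?_,
    (continuous_rampDeriv.sub continuous_rampDeriv).measurable, fun y => ?_, fun y k => ?_⟩
  · linarith [hpos hη, hpos hh]
  · refine (abs_sub _ _).trans ?_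
    linarith [hpos hη, hpos hh, abs_rampDeriv_le (t := t) hη y, abs_rampDeriv_le (t := t) hh y]
  · have e : rampGap t η h (y + k) - rampGap t η h y - (rampDeriv t η y - rampDeriv t h y) * k =
        (ramp t η (y + k) - ramp t η y - rampDeriv t η y * k) - (ramp t h (y + k) - ramp t h y - rampDeriv t h y * k) := by
      unfold rampGap; ring
    rw [e]
    refine (abs_sub _ _).trans ?_
    have h3 : (6 / η ^ 2 + 6 / h ^ 2) * k ^ 2 ≤ (1 + (6 / η + 6 / h) + (6 / η ^ 2 + 6 / h ^ 2)) * k ^ 2 := by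
      exact mul_le_mul_of_nonneg_right (by linarith [hpos hη, hpos hh]) (sq_nonneg k)
    linarith [ramp_taylor (t := t) (h := η) y k, ramp_taylor (t := t) (h := h) y k]

end

/-- The combination `1/2 - 2 Q(t) + Q(2 t)`, whose third-order vanishing at the origin detects small norms. -/
noncomputable def tailDefect (t : ℝ) : ℝ := 1 / 2 - 2 * gaussTail t + gaussTail (2 * t)

lemma hasDerivAt_tailDefect (t : ℝ) :
    HasDerivAt tailDefect (2 * (gaussDensity t - gaussDensity (2 * t))) t := by
  have h1 := (hasDerivAt_gaussTail t).const_mul 2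
  have h2 : HasDerivAt (fun t => gaussTail (2 * t)) (-gaussDensity (2 * t) * 2) t :=
    (hasDerivAt_gaussTail (2 * t)).comp t (by simpa using (hasDerivAt_id t).const_mul 2)
  have h3 := ((hasDerivAt_const t (1 / 2 : ℝ)).sub h1).add h2
  exact h3.congr_deriv (by ring)

lemma tailDefect_zero : tailDefect 0 = 0 := by norm_num [tailDefect, gaussTail_zero]

lemma gaussDensity_double (t : ℝ) : gaussDensity (2 * t) = gaussDensity t * rexp (-(3 * t ^ 2 / 2)) := by
  unfold gaussDensity
  rw [div_mul_eq_mul_div, ← Real.exp_add]; congr 2; ring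

lemma tailDefect_monotone : Monotone tailDefect := by
  refine monotone_of_hasDerivAt_nonneg (fun t => hasDerivAt_tailDefect t) fun t => ?_
  simp only [Pi.zero_apply]
  rw [gaussDensity_double]
  have h1 : rexp (-(3 * t ^ 2 / 2)) ≤ 1 := Real.exp_le_one_iff.2 (by nlinarith [sq_nonneg t])
  nlinarith [gaussDensity_pos t]

lemma tailDefect_nonneg {t : ℝ} (ht : 0 ≤ t) : 0 ≤ tailDefect t := by
  rw [← tailDefect_zero]; exact tailDefect_monotone ht

lemma tailDefect_le {t : ℝ} (ht : 0 ≤ t) : tailDefect t ≤ 2 / 5 * t ^ 3 := by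
  have hm : Monotone (fun t => 2 / 5 * t ^ 3 - tailDefect t) := by
    refine monotone_of_hasDerivAt_nonneg (f' := fun t => 6 / 5 * t ^ 2 - 2 * (gaussDensity t - gaussDensity (2 * t)))
      (fun t => ?_) fun t => ?_
    · exact ((((hasDerivAt_pow 3 t).const_mul (2 / 5)).sub (hasDerivAt_tailDefect t))).congr_deriv (by norm_num; ring)
    · simp only [Pi.zero_apply]
      rw [gaussDensity_double]
      have h1 := Real.add_one_le_exp (-(3 * t ^ 2 / 2))
      have h2 := gaussDensity_le_one t
      have h3 := gaussDensity_pos t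
      have h4 : gaussDensity t * (1 - rexp (-(3 * t ^ 2 / 2))) ≤ gaussDensity t * (3 * t ^ 2 / 2) :=
        mul_le_mul_of_nonneg_left (by linarith) h3.le
      have h5 : gaussDensity t * (3 * t ^ 2 / 2) ≤ 2 / 5 * (3 * t ^ 2 / 2) :=
        mul_le_mul_of_nonneg_right h2 (by positivity)
      nlinarith
  have := hm ht
  simp only [tailDefect_zero] at this
  linarith

lemma tailDefect_ten : 49 / 100 ≤ tailDefect 10 := by
  have h1 := gaussTail_le_exp (t := 10) (by norm_num)
  have h2 : rexp (-10 ^ 2 / 2 : ℝ) ≤ 1 / 1000 := by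
    rw [show (-10 ^ 2 / 2 : ℝ) = -50 by norm_num, Real.exp_neg, ← one_div]
    have := Real.quadratic_le_exp_of_nonneg (x := 50) (by norm_num)
    exact one_div_le_one_div_of_le (by norm_num) (by linarith)
  have h3 := h1.trans h2
  have h4 := gaussTail_nonneg (2 * 10)
  unfold tailDefect
  generalize gaussTail (2 * 10) = a at *
  linarith

lemma scaledDefect_nonneg {R t : ℝ} (hR : 0 ≤ R) (ht : 0 < t) :
    0 ≤ 1 / 2 - 2 * scaledTail R t + scaledTail R (2 * t) := by
  rcases hR.eq_or_lt with h0 | h0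
  · rw [← h0, scaledTail_zero ht, scaledTail_zero (by linarith)]; norm_num
  · have := tailDefect_nonneg (t := t / R) (by positivity)
    rw [scaledTail_eq h0, scaledTail_eq h0, mul_div_assoc]
    exact this

lemma scaledDefect_ge {R t : ℝ} (hR : 0 ≤ R) (ht : 0 < t) (h : 10 * R ≤ t) :
    49 / 100 ≤ 1 / 2 - 2 * scaledTail R t + scaledTail R (2 * t) := by
  rcases hR.eq_or_lt with h0 | h0
  · rw [← h0, scaledTail_zero ht, scaledTail_zero (by linarith)]; norm_num
  · have := tailDefect_monotone (a := 10) (b := t / R) (by rw [le_div_iff₀ h0]; linarith)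
    rw [scaledTail_eq h0, scaledTail_eq h0, mul_div_assoc]
    exact tailDefect_ten.trans this

section
variable {n : ℕ} {μ : Measure (Euc n)}

lemma measure_rad_lt_le [IsProbabilityMeasure μ] {ε : ℝ} (hε : 0 ≤ ε)
    (hD : ∀ t, 0 ≤ t → t ≤ 1 → (1 - 6 / 5 * ε) * gaussTail t ≤ meanTail μ t ∧
      meanTail μ t ≤ (1 + 6 / 5 * ε) * gaussTail t) {ϱ : ℝ} (h0 : 0 < ϱ) (h1 : ϱ ≤ 1 / 20) :
    μ.real {x | rad x < ϱ} ≤ 820 * ϱ ^ 3 + 37 / 10 * ε := by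
  set t := 10 * ϱ with ht
  have ht0 : 0 < t := by positivity
  have i1 : Integrable (fun x : Euc n => 2 * scaledTail (rad x) t) μ := (integrable_scaledTail t).const_mul 2
  have i2 := integrable_scaledTail (μ := μ) (2 * t)
  have i3 : Integrable (fun x : Euc n => (1 / 2 : ℝ) - 2 * scaledTail (rad x) t) μ := (integrable_const _).sub i1
  have i4 : Integrable (fun x : Euc n => 1 / 2 - 2 * scaledTail (rad x) t + scaledTail (rad x) (2 * t)) μ := i3.add i2
  have hI : ∫ x : Euc n, (1 / 2 - 2 * scaledTail (rad x) t + scaledTail (rad x) (2 * t)) ∂μ =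
      1 / 2 - 2 * meanTail μ t + meanTail μ (2 * t) := by
    rw [integral_add i3 i2, integral_sub (integrable_const _) i1, integral_const_mul,
      meanTail_eq_integral_scaledTail, meanTail_eq_integral_scaledTail]
    simp
  have hM := mul_meas_ge_le_integral_of_nonneg
    (ae_of_all μ fun x => scaledDefect_nonneg (rad_nonneg x) ht0) i4 (49 / 100)
  have hsub : μ.real {x | rad x < ϱ} ≤
      μ.real {x | 49 / 100 ≤ 1 / 2 - 2 * scaledTail (rad x) t + scaledTail (rad x) (2 * t)} :=
    measureReal_mono fun x hx => scaledDefect_ge (rad_nonneg x) ht0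
      (by rw [ht]; linarith [show rad x < ϱ from hx])
  rw [hI] at hM
  have ha := (hD t ht0.le (by linarith)).1
  have hb := (hD (2 * t) (by linarith) (by linarith)).2
  have hk := tailDefect_le ht0.le
  unfold tailDefect at hk
  have hq1 := gaussTail_le_half ht0.le
  have hq2 := gaussTail_le_half (t := 2 * t) (by linarith)
  have e1 : ε * gaussTail t ≤ ε * (1 / 2) := mul_le_mul_of_nonneg_left hq1 hε
  have e2 : ε * gaussTail (2 * t) ≤ ε * (1 / 2) := mul_le_mul_of_nonneg_left hq2 hε
  have e3 : t ^ 3 = 1000 * ϱ ^ 3 := by rw [ht]; ring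
  have e4 : 0 < ϱ ^ 3 := by positivity
  rw [e3] at hk
  nlinarith

/-- Integrability of `rad⁻²` away from the origin. -/
lemma integrableOn_rad_inv [IsProbabilityMeasure μ] {r ϱ : ℝ} (hr : 0 < r) :
    Integrable ({x : Euc n | r ≤ rad x ∧ rad x < ϱ}.indicator fun x => (rad x ^ 2)⁻¹) μ := by
  have hm : MeasurableSet {x : Euc n | r ≤ rad x ∧ rad x < ϱ} :=
    (measurableSet_le measurable_const measurable_rad).inter (measurableSet_lt measurable_rad measurable_const)
  refine Integrable.of_bound (((measurable_rad.pow_const 2).inv).indicator hm).aestronglyMeasurable ((r ^ 2)⁻¹)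
    (ae_of_all _ fun x => ?_)
  by_cases hx : x ∈ {x : Euc n | r ≤ rad x ∧ rad x < ϱ}
  · rw [Set.indicator_of_mem hx, norm_of_nonneg (by positivity)]
    have h1 : r ≤ rad x := hx.1
    gcongr
  · rw [Set.indicator_of_notMem hx, norm_zero]; positivity

lemma integral_rad_inv_le [IsProbabilityMeasure μ] {ε : ℝ} (hε : 0 ≤ ε)
    (hD : ∀ t, 0 ≤ t → t ≤ 1 → (1 - 6 / 5 * ε) * gaussTail t ≤ meanTail μ t ∧
      meanTail μ t ≤ (1 + 6 / 5 * ε) * gaussTail t) {r : ℝ} (hr : 0 < r) (K : ℕ) :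
    ∀ ϱ, r / 2 ≤ ϱ → ϱ ≤ 2 ^ K * r → ϱ ≤ 1 / 20 →
    ∫ x, {x : Euc n | r ≤ rad x ∧ rad x < ϱ}.indicator (fun x => (rad x ^ 2)⁻¹) x ∂μ ≤
      820 * (8 * ϱ + 8 * ε / r ^ 2 - 2 * ε / ϱ ^ 2) := by
  have base : ∀ ϱ, r / 2 ≤ ϱ → ϱ ≤ r →
    ∫ x, {x : Euc n | r ≤ rad x ∧ rad x < ϱ}.indicator (fun x => (rad x ^ 2)⁻¹) x ∂μ ≤
      820 * (8 * ϱ + 8 * ε / r ^ 2 - 2 * ε / ϱ ^ 2) := by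
    intro ϱ h1 h2
    have : {x : Euc n | r ≤ rad x ∧ rad x < ϱ} = ∅ := by
      ext x; simp only [mem_ofPred_eq, mem_empty_iff_false, iff_false, not_and, not_lt]; intro h; linarith
    rw [this]
    simp only [indicator_empty, integral_zero]
    have h3 : 2 * ε / ϱ ^ 2 ≤ 8 * ε / r ^ 2 := by
      have h4 : 2 * ε / ϱ ^ 2 ≤ 2 * ε / (r / 2) ^ 2 := by gcongr
      refine h4.trans_eq ?_
      field_simp; ring
    have : 0 < r / 2 := by positivity
    linarith
  induction K with
  | zero => intro ϱ h1 h2 _; exact base ϱ h1 (by simpa using h2)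
  | succ K ih =>
    intro ϱ h1 h2 h3
    rcases le_or_gt ϱ r with h4 | h4
    · exact base ϱ h1 h4
    have hϱ : 0 < ϱ := hr.trans h4
    have h5 := ih (ϱ / 2) (by linarith) (by rw [pow_succ] at h2; linarith) (by linarith)
    have h6 := measure_rad_lt_le hε hD hϱ h3
    have hm : MeasurableSet {x : Euc n | rad x < ϱ} := measurableSet_lt measurable_rad measurable_const
    have i7 : Integrable ({x : Euc n | rad x < ϱ}.indicator fun _ => 4 / ϱ ^ 2) μ :=
      (integrable_const _).indicator hm
    have h7 : ∫ x, {x : Euc n | r ≤ rad x ∧ rad x < ϱ}.indicator (fun x => (rad x ^ 2)⁻¹) x ∂μ ≤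
        ∫ x, ({x : Euc n | r ≤ rad x ∧ rad x < ϱ / 2}.indicator (fun x => (rad x ^ 2)⁻¹) x +
          {x : Euc n | rad x < ϱ}.indicator (fun _ => 4 / ϱ ^ 2) x) ∂μ := by
      refine integral_mono (integrableOn_rad_inv hr) ((integrableOn_rad_inv hr).add i7) fun x => ?_
      have p1 : 0 ≤ {x : Euc n | r ≤ rad x ∧ rad x < ϱ / 2}.indicator (fun x => (rad x ^ 2)⁻¹) x :=
        indicator_nonneg (fun _ _ => by positivity) _
      have p2 : 0 ≤ {x : Euc n | rad x < ϱ}.indicator (fun _ => 4 / ϱ ^ 2) x :=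
        indicator_nonneg (fun _ _ => by positivity) _
      by_cases hx : x ∈ {x : Euc n | r ≤ rad x ∧ rad x < ϱ}
      · have hx2 : x ∈ {x : Euc n | rad x < ϱ} := hx.2
        rw [Set.indicator_of_mem hx] at *
        by_cases hx3 : x ∈ {x : Euc n | r ≤ rad x ∧ rad x < ϱ / 2}
        · simp only [Set.indicator_of_mem hx3]; linarith
        · simp only [Set.indicator_of_mem hx2]
          have h8 : ϱ / 2 ≤ rad x := by
            by_contra! h; exact hx3 ⟨hx.1, h⟩
          have h9 : (rad x ^ 2)⁻¹ ≤ ((ϱ / 2) ^ 2)⁻¹ := by gcongr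
          have h10 : ((ϱ / 2) ^ 2)⁻¹ = 4 / ϱ ^ 2 := by field_simp; norm_num
          linarith
      · rw [Set.indicator_of_notMem hx]; exact add_nonneg p1 p2
    rw [integral_add (integrableOn_rad_inv hr) i7, integral_indicator_const _ hm, smul_eq_mul] at h7
    have h8 : μ.real {x | rad x < ϱ} * (4 / ϱ ^ 2) ≤ (820 * (ϱ ^ 3 + ε)) * (4 / ϱ ^ 2) :=
      mul_le_mul_of_nonneg_right (by linarith) (by positivity)
    have e1 : (820 * (ϱ ^ 3 + ε)) * (4 / ϱ ^ 2) = 820 * (4 * ϱ + 4 * (ε / ϱ ^ 2)) := by field_simp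
    have e2 : 2 * ε / (ϱ / 2) ^ 2 = 8 * (ε / ϱ ^ 2) := by field_simp; ring
    have e3 : 2 * ε / ϱ ^ 2 = 2 * (ε / ϱ ^ 2) := by ring
    have e4 : 0 ≤ ε / ϱ ^ 2 := by positivity
    rw [e3]; rw [e2] at h5; rw [e1] at h8
    linarith

lemma gaussianReal_rampGap_le {R t η h : ℝ} (hR : 0 < R) (hη : 0 < η) (hh : η ≤ h) :
    ∫ s, rampGap t η h (R * s) ∂(gaussianReal 0 1) ≤ 2 / 5 * (h / R) := by
  have hi : Integrable (fun s => rampGap t η h (R * s)) (gaussianReal 0 1) :=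
    Integrable.of_bound (((continuous_ramp.sub continuous_ramp).comp (continuous_const.mul continuous_id)).aestronglyMeasurable) 1
      (ae_of_all _ fun s => by rw [norm_of_nonneg (rampGap_nonneg hη hh _)]; exact rampGap_le_one _)
  have hm : MeasurableSet (Icc (t / R) ((t + h) / R)) := measurableSet_Icc
  have h1 : ∫ s, rampGap t η h (R * s) ∂(gaussianReal 0 1) ≤
      ∫ s, (Icc (t / R) ((t + h) / R)).indicator (fun _ => (1:ℝ)) s ∂(gaussianReal 0 1) := by
    refine integral_mono hi ((integrable_const _).indicator hm) fun s => ?_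
    refine (rampGap_le_indicator hη hh _).trans_eq ?_
    by_cases hs : R * s ∈ Icc t (t + h)
    · rw [Set.indicator_of_mem hs, Set.indicator_of_mem]
      exact ⟨by rw [div_le_iff₀ hR]; linarith [hs.1], by rw [le_div_iff₀ hR]; linarith [hs.2]⟩
    · rw [Set.indicator_of_notMem hs, Set.indicator_of_notMem]
      intro h2; apply hs
      have a := h2.1; have b := h2.2
      rw [div_le_iff₀ hR] at a; rw [le_div_iff₀ hR] at b
      exact ⟨by linarith, by linarith⟩
  rw [integral_indicator_const _ hm, smul_eq_mul, mul_one] at h1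
  refine h1.trans ?_
  have h2 : (gaussianReal 0 1).real (Icc (t / R) ((t + h) / R)) = ∫ s in Icc (t / R) ((t + h) / R), gaussDensity s := by
    rw [measureReal_def, gaussianReal_apply_eq_integral 0 one_ne_zero, ENNReal.toReal_ofReal]
    · exact setIntegral_congr_fun hm fun s _ => (congrFun gaussDensity_eq_pdf s).symm
    · exact integral_nonneg fun s => gaussianPDFReal_nonneg _ _ _
  rw [h2]
  have h3 := norm_setIntegral_le_of_norm_le_const (μ := volume) (s := Icc (t / R) ((t + h) / R))
    (f := gaussDensity) (C := 2 / 5) (by simp) (fun s _ => by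
      rw [norm_of_nonneg (gaussDensity_pos s).le]; exact gaussDensity_le_one s)
  rw [measureReal_def, Real.volume_Icc, ENNReal.toReal_ofReal (by rw [← sub_div]; apply div_nonneg <;> linarith)] at h3
  refine (le_abs_self _).trans (h3.trans_eq ?_)
  ring

lemma measurableSet_le_rad (r : ℝ) : MeasurableSet {x : Euc n | r ≤ rad x} :=
  measurableSet_le measurable_const measurable_rad

/-- The total variance proxy contributed by the sharp part of the ramp. -/
lemma integral_rampGap_variance_le [IsProbabilityMeasure μ] (hn : n ≠ 0) {ε : ℝ} (hε : 0 ≤ ε)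
    (hD : ∀ t, 0 ≤ t → t ≤ 1 → (1 - 6 / 5 * ε) * gaussTail t ≤ meanTail μ t ∧
      meanTail μ t ≤ (1 + 6 / 5 * ε) * gaussTail t) {r f t η h : ℝ} (hr : 0 < r) (hrf : r ≤ f)
    (hf : f ≤ 1 / 20) (hη : 0 < η) (hh : η ≤ h) (hhf : h ≤ f ^ 4) :
    ∫ x, (‖x‖ ^ 2)⁻¹ * ∫ ζ, rampGap t η h ⟪x, ζ⟫ ∂(gaussN n) ∂(μ.restrict {x | r ≤ rad x}) ≤
      (7000 * f + 6560 * (ε / r ^ 2)) / n := by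
  have hf0 : 0 < f := hr.trans_le hrf
  have hn0 : (0:ℝ) < n := by positivity
  obtain ⟨K, hK⟩ := pow_unbounded_of_one_lt (f / r) (by norm_num : (1:ℝ) < 2)
  have hG := integral_rad_inv_le hε hD hr K f (by linarith) (by rw [div_lt_iff₀ hr] at hK; exact hK.le) hf
  have hms := measurableSet_le_rad (n := n) r
  have hmeas : Measurable (rampGap t η h) := (continuous_ramp.sub continuous_ramp).measurable
  have hb : Integrable (fun x : Euc n => (({x : Euc n | r ≤ rad x ∧ rad x < f}.indicator (fun x => (rad x ^ 2)⁻¹) x) + 2 / 5 * f) / n) μ :=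
    ((integrableOn_rad_inv hr).add (integrable_const _)).div_const _
  have hpt : ∀ x : Euc n, {x : Euc n | r ≤ rad x}.indicator (fun x => (‖x‖ ^ 2)⁻¹ * ∫ ζ, rampGap t η h ⟪x, ζ⟫ ∂(gaussN n)) x ≤
      (({x : Euc n | r ≤ rad x ∧ rad x < f}.indicator (fun x => (rad x ^ 2)⁻¹) x) + 2 / 5 * f) / n := by
    intro x
    have p1 : 0 ≤ {x : Euc n | r ≤ rad x ∧ rad x < f}.indicator (fun x => (rad x ^ 2)⁻¹) x :=
      indicator_nonneg (fun _ _ => by positivity) _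
    by_cases hx : x ∈ {x : Euc n | r ≤ rad x}
    · rw [Set.indicator_of_mem hx]
      have hR : 0 < rad x := hr.trans_le hx
      have hnx : ‖x‖ ^ 2 = n * rad x ^ 2 := by
        unfold rad; rw [div_pow, Real.sq_sqrt hn0.le]; field_simp
      rw [integral_gaussN_inner n x hmeas, hnx, mul_inv]
      rw [show ‖x‖ / √(n:ℝ) = rad x from rfl]
      rw [show (n:ℝ)⁻¹ * (rad x ^ 2)⁻¹ * ∫ s, rampGap t η h (rad x * s) ∂(gaussianReal 0 1) =
        ((rad x ^ 2)⁻¹ * ∫ s, rampGap t η h (rad x * s) ∂(gaussianReal 0 1)) / n by ring]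
      gcongr
      by_cases hxf : rad x < f
      · have hx2 : x ∈ {x : Euc n | r ≤ rad x ∧ rad x < f} := ⟨hx, hxf⟩
        rw [Set.indicator_of_mem hx2]
        have h1 : ∫ s, rampGap t η h (rad x * s) ∂(gaussianReal 0 1) ≤ 1 := by
          have := norm_integral_le_of_norm_le_const (μ := gaussianReal 0 1) (f := fun s => rampGap t η h (rad x * s))
            (C := 1) (ae_of_all _ fun s => by rw [norm_of_nonneg (rampGap_nonneg hη hh _)]; exact rampGap_le_one _)
          exact (le_abs_self _).trans (by simpa using this)
        have h2 : (rad x ^ 2)⁻¹ * ∫ s, rampGap t η h (rad x * s) ∂(gaussianReal 0 1) ≤ (rad x ^ 2)⁻¹ * 1 :=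
          mul_le_mul_of_nonneg_left h1 (by positivity)
        linarith
      · push Not at hxf
        have h1 := gaussianReal_rampGap_le (t := t) hR hη hh
        have h2 : (rad x ^ 2)⁻¹ * ∫ s, rampGap t η h (rad x * s) ∂(gaussianReal 0 1) ≤
            (f ^ 2)⁻¹ * (2 / 5 * (f ^ 4 / f)) := by
          have h3 : 2 / 5 * (h / rad x) ≤ 2 / 5 * (f ^ 4 / f) := by gcongr
          have h4 : (rad x ^ 2)⁻¹ ≤ (f ^ 2)⁻¹ := by gcongr
          exact mul_le_mul h4 (h1.trans h3) (integral_nonneg fun s => rampGap_nonneg hη hh _) (by positivity)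
        have h5 : (f ^ 2)⁻¹ * (2 / 5 * (f ^ 4 / f)) = 2 / 5 * f := by field_simp
        linarith
    · rw [Set.indicator_of_notMem hx]; positivity
  rw [← integral_indicator hms]
  have hpos : ∀ x : Euc n, 0 ≤ {x : Euc n | r ≤ rad x}.indicator (fun x => (‖x‖ ^ 2)⁻¹ * ∫ ζ, rampGap t η h ⟪x, ζ⟫ ∂(gaussN n)) x :=
    fun x => indicator_nonneg (fun y _ => mul_nonneg (by positivity) (integral_nonneg fun _ => rampGap_nonneg hη hh _)) x
  refine (integral_mono_of_nonneg (ae_of_all _ hpos) hb (ae_of_all _ hpt)).trans ?_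
  rw [integral_div, integral_add (integrableOn_rad_inv hr) (integrable_const _)]
  simp only [integral_const, probReal_univ, one_smul]
  refine div_le_div_of_nonneg_right ?_ hn0.le
  have : 0 ≤ 2 * ε / f ^ 2 := by positivity
  have e : 8 * ε / r ^ 2 = 8 * (ε / r ^ 2) := by ring
  rw [e] at hG
  linarith

end

section
variable {n : ℕ} {μ : Measure (Euc n)}

lemma measurableSet_rad_lt (r : ℝ) : MeasurableSet {x : Euc n | rad x < r} :=
  measurableSet_lt measurable_rad measurable_const

lemma HasPsiOneMarginals.restrict [IsFiniteMeasure μ] {C₀ c₀ : ℝ} (hψ : HasPsiOneMarginals μ C₀ c₀)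
    (s : Set (Euc n)) : HasPsiOneMarginals (μ.restrict s) C₀ c₀ := by
  intro θ hθ t ht
  refine le_trans ?_ (hψ θ hθ t ht)
  exact ENNReal.toReal_mono (measure_ne_top _ _) (Measure.restrict_apply_le _ _)

lemma upTail_restrict (t : ℝ) (z : Euc n) (s : Set (Euc n)) :
    upTail (μ.restrict s) t z = μ.real ({x | t ≤ ⟪x, z⟫} ∩ s) := by
  rw [upTail, measureReal_restrict_apply (measurableSet_le_inner t z)]

lemma upTail_restrict_rad_le_half [IsFiniteMeasure μ] (hμ : Measure.IsEven μ) {t : ℝ} (ht : 0 < t) (r : ℝ) (z : Euc n) :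
    2 * upTail (μ.restrict {x | rad x < r}) t z ≤ μ.real {x | rad x < r} := by
  rw [upTail_restrict]
  have hm := (measurableSet_le_inner t z).inter (measurableSet_rad_lt (n := n) r)
  have h1 := hμ.real_preimage_neg hm
  have hd : Disjoint ((fun x => -x) ⁻¹' ({x | t ≤ ⟪x, z⟫} ∩ {x : Euc n | rad x < r})) ({x | t ≤ ⟪x, z⟫} ∩ {x : Euc n | rad x < r}) := by
    rw [Set.disjoint_left]
    intro x hx hx'
    have a : t ≤ ⟪-x, z⟫ := hx.1
    have b : t ≤ ⟪x, z⟫ := hx'.1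
    rw [inner_neg_left] at a
    linarith
  have h2 := measureReal_union (μ := μ) hd hm
  have h3 : μ.real ((fun x => -x) ⁻¹' ({x | t ≤ ⟪x, z⟫} ∩ {x : Euc n | rad x < r}) ∪ ({x | t ≤ ⟪x, z⟫} ∩ {x : Euc n | rad x < r})) ≤
      μ.real {x | rad x < r} := by
    refine measureReal_mono ?_
    rintro x (hx | hx)
    · have : rad (-x) < r := hx.2
      simpa [rad] using this
    · exact hx.2
  linarith

lemma meanTail_restrict_rad_le [IsProbabilityMeasure μ] {r t : ℝ} (ht : 0 < t) :
    meanTail (μ.restrict {x | rad x < r}) t ≤ gaussTail (t / r) := by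
  rw [meanTail_eq_integral_scaledTail]
  have h := norm_integral_le_of_norm_le_const (μ := μ.restrict {x : Euc n | rad x < r}) (f := fun x => scaledTail (rad x) t)
    (C := gaussTail (t / r)) (by
      filter_upwards [ae_restrict_mem (measurableSet_rad_lt r)] with x hx
      have hx' : rad x < r := hx
      rw [norm_of_nonneg (show 0 ≤ scaledTail (rad x) t from measureReal_nonneg)]
      rcases (rad_nonneg x).eq_or_lt with h0 | h0
      · rw [← h0, scaledTail_zero ht]; exact gaussTail_nonneg _
      · rw [scaledTail_eq h0]
        exact gaussTail_strictAnti.antitone (by gcongr))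
  refine (le_abs_self _).trans (h.trans ?_)
  have : (μ.restrict {x : Euc n | rad x < r}).real univ ≤ 1 := by
    rw [measureReal_restrict_apply MeasurableSet.univ]; exact measureReal_le_one
  exact mul_le_of_le_one_right (gaussTail_nonneg _) this

lemma gaussTail_le_pow {e : ℝ} (he : 0 < e) (h1 : e ≤ 1 / 10 ^ 12) : gaussTail (1 / (2 * e)) ≤ e ^ 15 := by
  refine (gaussTail_le_exp (by positivity)).trans ?_
  have h2 : (0:ℝ) ≤ 1 / (8 * e ^ 2) := by positivity
  have h3 := Real.pow_div_factorial_le_exp (1 / (8 * e ^ 2)) h2 8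
  have h4 : (1 / e) ^ 15 ≤ (1 / (8 * e ^ 2)) ^ 8 / (Nat.factorial 8 : ℝ) := by
    have : Nat.factorial 8 = 40320 := by decide
    rw [this]
    have e1 : (1 / (8 * e ^ 2)) ^ 8 / ((40320 : ℕ) : ℝ) = (1 / e) ^ 15 * (1 / (8 ^ 8 * 40320 * e)) := by
      push_cast; field_simp
    rw [e1]
    refine le_mul_of_one_le_right (by positivity) ?_
    rw [le_div_iff₀ (by positivity)]
    nlinarith
  have h5 : -(1 / (2 * e)) ^ 2 / 2 = -(1 / (8 * e ^ 2)) := by field_simp; norm_num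
  rw [h5, Real.exp_neg]
  have h6 := h4.trans h3
  have h7 : e ^ 15 = ((1 / e) ^ 15)⁻¹ := by rw [one_div, inv_pow, inv_inv]
  rw [h7]
  gcongr

/-- The part of the measure near the origin contributes negligibly to all tails. -/
lemma upTail_restrict_rad_dev [IsProbabilityMeasure μ] (hn : n ≠ 0) {C₀ c₀ : ℝ} (hC₀ : 0 < C₀) (hc₀ : 0 < c₀)
    (hμ : Measure.IsEven μ) (hψ : HasPsiOneMarginals μ C₀ c₀) {e : ℝ} (he : 0 < e) (he1 : e ≤ 1 / 10 ^ 12)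
    (hD : ∀ t, 0 ≤ t → t ≤ 1 → (1 - 6 / 5 * e ^ 5) * gaussTail t ≤ meanTail μ t ∧
      meanTail μ t ≤ (1 + 6 / 5 * e ^ 5) * gaussTail t)
    (hC : C₀ * rexp (-(c₀ / (2 * e ^ 4))) ≤ e ^ 15) {τ : ℝ} (hτ : 0 < τ) (hq : 3 * e ^ 10 ≤ gaussTail τ) :
    meanTail (μ.restrict {x | rad x < e ^ 2}) τ ≤ 9 / 2 * e ^ 5 * gaussTail τ ∧
    (gaussN n).real {z | 9 / 2 * e ^ 5 * gaussTail τ < upTail (μ.restrict {x | rad x < e ^ 2}) τ z} ≤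
      2 * rexp (-(n * (e ^ 5) ^ 2 / 5)) := by
  have he5 : 0 < e ^ 5 := by positivity
  have hex : 0 ≤ 2 * rexp (-(n * (e ^ 5) ^ 2 / 5)) := by positivity
  rcases le_or_gt τ e with h | h
  · have hp := measure_rad_lt_le (μ := μ) he5.le hD (ϱ := e ^ 2) (by positivity) (by nlinarith)
    have hQ : 9 / 20 ≤ gaussTail τ := by
      have := gaussTail_sub_le hτ.le
      rw [gaussTail_zero] at this
      have h1 : e ≤ 1 / 100 := he1.trans (by norm_num)
      linarith
    have hp2 : μ.real {x | rad x < e ^ 2} ≤ 4 * e ^ 5 := by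
      refine hp.trans ?_
      have : (e ^ 2) ^ 3 = e * e ^ 5 := by ring
      rw [this]
      have : e * e ^ 5 ≤ 1 / 10 ^ 12 * e ^ 5 := by gcongr
      linarith
    have hpt : ∀ z, upTail (μ.restrict {x | rad x < e ^ 2}) τ z ≤ 9 / 2 * e ^ 5 * gaussTail τ := fun z => by
      have h2 := upTail_restrict_rad_le_half hμ hτ (e ^ 2) z
      have h3 : e ^ 5 * (9 / 20) ≤ e ^ 5 * gaussTail τ := mul_le_mul_of_nonneg_left hQ he5.le
      linarith
    constructor
    · refine (integral_mono (integrable_upTail _) (integrable_const _) hpt).trans_eq ?_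
      simp
    · have : {z | 9 / 2 * e ^ 5 * gaussTail τ < upTail (μ.restrict {x | rad x < e ^ 2}) τ z} = ∅ := by
        ext z; simp only [mem_ofPred_eq, mem_empty_iff_false, iff_false, not_lt]; exact hpt z
      rw [this, measureReal_empty]; exact hex
  · have hM : meanTail (μ.restrict {x | rad x < e ^ 2}) (τ / 2) ≤ e ^ 15 := by
      refine (meanTail_restrict_rad_le (by positivity)).trans ?_
      refine le_trans (gaussTail_strictAnti.antitone ?_) (gaussTail_le_pow he he1)
      rw [div_div, div_le_div_iff₀ (by positivity) (by positivity)]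
      nlinarith
    have hq2 : 3 * e ^ 15 ≤ e ^ 5 * gaussTail τ := by
      calc 3 * e ^ 15 = e ^ 5 * (3 * e ^ 10) := by ring
        _ ≤ _ := by gcongr
    have he15 : 0 < e ^ 15 := by positivity
    constructor
    · have := (meanTail_antitone (μ := μ.restrict {x | rad x < e ^ 2}) (show τ / 2 ≤ τ by linarith)).trans hM
      linarith
    · have hk := upTail_markov (μ := μ.restrict {x : Euc n | rad x < e ^ 2}) (τ / 2) (a := 2 * e ^ 15) (by positivity)
      have hα : 1 / 2 ≤ (gaussN n).real {z | upTail (μ.restrict {x | rad x < e ^ 2}) (τ / 2) z ≤ 2 * e ^ 15} := by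
        refine le_trans ?_ hk
        have : meanTail (μ.restrict {x | rad x < e ^ 2}) (τ / 2) / (2 * e ^ 15) ≤ 1 / 2 := by
          rw [div_le_iff₀ (by positivity)]; linarith
        linarith
      have := gaussN_real_le_of_far (δ := e ^ 5) hn
        (measurableSet_le (measurable_upTail (μ := μ.restrict {x : Euc n | rad x < e ^ 2}) (τ / 2)) measurable_const)
        (measurableSet_lt measurable_const (measurable_upTail τ) :
          MeasurableSet {z | 9 / 2 * e ^ 5 * gaussTail τ < upTail (μ.restrict {x | rad x < e ^ 2}) τ z})
        he5.le ?_ (by norm_num) hα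
      · refine this.trans_eq ?_
        norm_num
      · intro z hz w hw
        refine dist_ge_of_upTail_lt (μ := μ.restrict {x : Euc n | rad x < e ^ 2}) (t := τ) (h := τ / 2) hC₀ hc₀ (hψ.restrict _) (by positivity) ?_
        have hz' : upTail (μ.restrict {x | rad x < e ^ 2}) (τ / 2) z ≤ 2 * e ^ 15 := hz
        have hw' : 9 / 2 * e ^ 5 * gaussTail τ < upTail (μ.restrict {x | rad x < e ^ 2}) τ w := hw
        rw [show τ - τ / 2 = τ / 2 by ring]
        have h4 : C₀ * rexp (-(c₀ * (τ / 2) / e ^ 5)) ≤ C₀ * rexp (-(c₀ / (2 * e ^ 4))) := by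
          refine mul_le_mul_of_nonneg_left (Real.exp_le_exp.2 (neg_le_neg ?_)) hC₀.le
          rw [div_le_div_iff₀ (by positivity) (by positivity)]
          have : c₀ * e * e ^ 4 ≤ c₀ * τ * e ^ 4 := by gcongr
          nlinarith
        have : 0 < e ^ 5 * gaussTail τ := mul_pos he5 (gaussTail_pos τ)
        linarith

end

section
variable {n : ℕ} {μ : Measure (Euc n)}

/-- The mass of the slab of width `3 h` around the transition region of a ramp. -/
noncomputable def slabMass (μ : Measure (Euc n)) (t h : ℝ) (w : Euc n) : ℝ :=
  μ.real {x | t - h ≤ ⟪x, w⟫ ∧ ⟪x, w⟫ ≤ t + 2 * h}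

lemma measurableSet_slab (t h : ℝ) (w : Euc n) : MeasurableSet {x : Euc n | t - h ≤ ⟪x, w⟫ ∧ ⟪x, w⟫ ≤ t + 2 * h} :=
  (show Measurable fun x : Euc n => ⟪x, w⟫ by fun_prop) (measurableSet_Icc (a := t - h) (b := t + 2 * h))

lemma abs_ramp_sub_le_slab {t h : ℝ} (hh : 0 < h) {a y y' : ℝ} (ha0 : 0 ≤ a) (ha : a ≤ h) :
    |ramp t h y - ramp t h y'| ≤
      2 * a / h * (Icc (t - h) (t + 2 * h)).indicator (fun _ => (1:ℝ)) y +
      2 / h * ({u | a < |u|}.indicator (fun u => |u|) (y - y')) := by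
  have p1 : 0 ≤ {u : ℝ | a < |u|}.indicator (fun u => |u|) (y - y') := indicator_nonneg (fun _ _ => abs_nonneg _) _
  have h0 := abs_ramp_sub_le (t := t) hh y y'
  by_cases hu : a < |y - y'|
  · rw [Set.indicator_of_mem (show y - y' ∈ {u : ℝ | a < |u|} from hu)]
    have : 0 ≤ 2 * a / h * (Icc (t - h) (t + 2 * h)).indicator (fun _ => (1:ℝ)) y :=
      mul_nonneg (by positivity) (indicator_nonneg (fun _ _ => zero_le_one) _)
    linarith
  · push Not at hu
    by_cases hy : y ∈ Icc (t - h) (t + 2 * h)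
    · rw [Set.indicator_of_mem hy]
      have h2 : 2 / h * |y - y'| ≤ 2 / h * a := by gcongr
      have e : 2 * a / h * 1 = 2 / h * a := by ring
      have : 0 ≤ 2 / h * {u : ℝ | a < |u|}.indicator (fun u => |u|) (y - y') := mul_nonneg (by positivity) p1
      linarith
    · rw [Set.indicator_of_notMem hy]
      have hz : ramp t h y = ramp t h y' := by
        have h3 := abs_le.1 (hu.trans ha)
        rcases le_or_gt (t - h) y with h1 | h1
        · have h2 : t + 2 * h < y := by by_contra! h3; exact hy ⟨h1, h3⟩
          rw [ramp_of_ge hh (by linarith), ramp_of_ge hh (by linarith [h3.2])]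
        · rw [ramp_of_le hh (by linarith), ramp_of_le hh (by linarith [h3.1])]
      rw [hz, sub_self, abs_zero]
      have : 0 ≤ 2 / h * {u : ℝ | a < |u|}.indicator (fun u => |u|) (y - y') := mul_nonneg (by positivity) p1
      linarith

lemma setIntegral_abs_inner_tail_le {C₀ c₀ : ℝ} [IsProbabilityMeasure μ] (hC₀ : 0 < C₀) (hc₀ : 0 < c₀)
    (hψ : HasPsiOneMarginals μ C₀ c₀) {v : Euc n} {δ : ℝ} (A : ℝ) (hv : ‖v‖ ≤ δ) :
    Integrable (fun x => {u : ℝ | A * δ < |u|}.indicator (fun u => |u|) ⟪x, v⟫) μ ∧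
    ∫ x, {u : ℝ | A * δ < |u|}.indicator (fun u => |u|) ⟪x, v⟫ ∂μ ≤
      δ * (4 * (1 + 2 * C₀) / c₀ * rexp (-(c₀ * A / 4))) := by
  have hδ : 0 ≤ δ := (norm_nonneg v).trans hv
  rcases eq_or_ne v 0 with rfl | h0
  · have : ∀ x : Euc n, {u : ℝ | A * δ < |u|}.indicator (fun u => |u|) ⟪x, (0 : Euc n)⟫ = 0 := fun x => by
      rw [inner_zero_right]; by_cases h : (0:ℝ) ∈ {u : ℝ | A * δ < |u|} <;> simp [h]
    simp only [this]
    exact ⟨integrable_zero _ _ _, by simp; positivity⟩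
  have hv0 : 0 < ‖v‖ := norm_pos_iff.2 h0
  set θ := ‖v‖⁻¹ • v with hθ
  have hθ1 : ‖θ‖ = 1 := by rw [hθ, norm_smul, norm_inv, norm_norm, inv_mul_cancel₀ hv0.ne']
  obtain ⟨i1, i2⟩ := setIntegral_abs_inner_le hC₀ hc₀ hψ hθ1 A
  have hinner : ∀ x : Euc n, ⟪x, v⟫ = ‖v‖ * ⟪x, θ⟫ := fun x => by
    rw [hθ, inner_smul_right, mul_inv_cancel_left₀ hv0.ne']
  have hm : MeasurableSet {x : Euc n | A < |⟪x, θ⟫|} := measurableSet_lt measurable_const (by fun_prop)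
  have iB : Integrable ({x : Euc n | A < |⟪x, θ⟫|}.indicator fun x => |⟪x, θ⟫|) μ := i1.indicator hm
  have hmeas : Measurable (fun x : Euc n => {u : ℝ | A * δ < |u|}.indicator (fun u => |u|) ⟪x, v⟫) := by
    have : Measurable ({u : ℝ | A * δ < |u|}.indicator fun u => |u|) :=
      measurable_abs.indicator (measurableSet_lt measurable_const measurable_abs)
    exact this.comp (by fun_prop)
  have hpt : ∀ x : Euc n, {u : ℝ | A * δ < |u|}.indicator (fun u => |u|) ⟪x, v⟫ ≤
      δ * {x : Euc n | A < |⟪x, θ⟫|}.indicator (fun x => |⟪x, θ⟫|) x := fun x => by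
    have p1 : 0 ≤ {x : Euc n | A < |⟪x, θ⟫|}.indicator (fun x => |⟪x, θ⟫|) x := indicator_nonneg (fun _ _ => abs_nonneg _) _
    by_cases hu : ⟪x, v⟫ ∈ {u : ℝ | A * δ < |u|}
    · have hu' : A * δ < |⟪x, v⟫| := hu
      rw [Set.indicator_of_mem hu]
      have h1 : |⟪x, v⟫| = ‖v‖ * |⟪x, θ⟫| := by rw [hinner, abs_mul, abs_of_pos hv0]
      have h2 : x ∈ {x : Euc n | A < |⟪x, θ⟫|} := by
        show A < _
        by_contra! h3
        have : ‖v‖ * |⟪x, θ⟫| ≤ δ * A := by gcongr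
        linarith
      rw [Set.indicator_of_mem h2, h1]
      gcongr
    · rw [Set.indicator_of_notMem hu]; positivity
  have p0 : ∀ x : Euc n, 0 ≤ {u : ℝ | A * δ < |u|}.indicator (fun u => |u|) ⟪x, v⟫ :=
    fun x => indicator_nonneg (fun _ _ => abs_nonneg _) _
  have i3 : Integrable (fun x => {u : ℝ | A * δ < |u|}.indicator (fun u => |u|) ⟪x, v⟫) μ :=
    (iB.const_mul δ).mono' hmeas.aestronglyMeasurable (ae_of_all _ fun x => by
      rw [norm_of_nonneg (p0 x)]; exact hpt x)
  refine ⟨i3, (integral_mono i3 (iB.const_mul δ) hpt).trans ?_⟩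
  rw [integral_const_mul, integral_indicator hm]
  exact mul_le_mul_of_nonneg_left i2 hδ

/-- Local Lipschitz estimate for the average of a ramp, in terms of the slab mass. -/
lemma ridgeAvg_ramp_sub_le {C₀ c₀ : ℝ} [IsProbabilityMeasure μ] (hC₀ : 0 < C₀) (hc₀ : 0 < c₀)
    (hψ : HasPsiOneMarginals μ C₀ c₀) {t h δ A : ℝ} (hh : 0 < h) (hA : 0 ≤ A) (hAh : A * δ ≤ h) (s : Set (Euc n))
    {w z : Euc n} (hwz : dist w z < δ) :
    |ridgeAvg (μ.restrict s) (ramp t h) w - ridgeAvg (μ.restrict s) (ramp t h) z| ≤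
      2 * (A * δ) / h * slabMass μ t h w + 2 / h * (δ * (4 * (1 + 2 * C₀) / c₀ * rexp (-(c₀ * A / 4)))) := by
  have hδ : 0 < δ := dist_nonneg.trans_lt hwz
  have hir : ∀ (ν : Measure (Euc n)) [IsFiniteMeasure ν] (v : Euc n), Integrable (fun x => ramp t h ⟪x, v⟫) ν := fun ν _ v =>
    Integrable.of_bound (Measurable.aestronglyMeasurable (continuous_ramp.measurable.comp (by fun_prop))) 1
      (ae_of_all _ fun x => by rw [norm_of_nonneg (ramp_nonneg _)]; exact ramp_le_one _)
  obtain ⟨i1, i2⟩ := setIntegral_abs_inner_tail_le (v := w - z) (δ := δ) hC₀ hc₀ hψ A (by rw [← dist_eq_norm]; exact hwz.le)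
  have hms := measurableSet_slab (n := n) t h w
  have i3 : Integrable ({x : Euc n | t - h ≤ ⟪x, w⟫ ∧ ⟪x, w⟫ ≤ t + 2 * h}.indicator fun _ => (1:ℝ)) μ :=
    (integrable_const _).indicator hms
  have hsl : ∫ x, {x : Euc n | t - h ≤ ⟪x, w⟫ ∧ ⟪x, w⟫ ≤ t + 2 * h}.indicator (fun _ => (1:ℝ)) x ∂μ = slabMass μ t h w := by
    rw [integral_indicator_const _ hms, smul_eq_mul, mul_one]; rfl
  have habs : Integrable (fun x => |ramp t h ⟪x, w⟫ - ramp t h ⟪x, z⟫|) μ := ((hir μ w).sub (hir μ z)).abs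
  calc |ridgeAvg (μ.restrict s) (ramp t h) w - ridgeAvg (μ.restrict s) (ramp t h) z|
      = |∫ x in s, (ramp t h ⟪x, w⟫ - ramp t h ⟪x, z⟫) ∂μ| := by
        rw [integral_sub (hir _ w) (hir _ z)]; rfl
    _ ≤ ∫ x in s, |ramp t h ⟪x, w⟫ - ramp t h ⟪x, z⟫| ∂μ := abs_integral_le_integral_abs
    _ ≤ ∫ x, |ramp t h ⟪x, w⟫ - ramp t h ⟪x, z⟫| ∂μ :=
        setIntegral_le_integral habs (ae_of_all _ fun x => abs_nonneg _)
    _ ≤ ∫ x, (2 * (A * δ) / h * {x : Euc n | t - h ≤ ⟪x, w⟫ ∧ ⟪x, w⟫ ≤ t + 2 * h}.indicator (fun _ => (1:ℝ)) x +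
          2 / h * {u : ℝ | A * δ < |u|}.indicator (fun u => |u|) ⟪x, w - z⟫) ∂μ := by
        refine integral_mono habs ((i3.const_mul _).add (i1.const_mul _)) fun x => ?_
        have := abs_ramp_sub_le_slab (t := t) (y := ⟪x, w⟫) (y' := ⟪x, z⟫) hh (by positivity) hAh
        rw [inner_sub_right]
        exact this
    _ = 2 * (A * δ) / h * slabMass μ t h w + 2 / h * ∫ x, {u : ℝ | A * δ < |u|}.indicator (fun u => |u|) ⟪x, w - z⟫ ∂μ := by
        rw [integral_add (i3.const_mul _) (i1.const_mul _), integral_const_mul, integral_const_mul, hsl]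
    _ ≤ _ := by gcongr

/-- Markov's inequality combined with Gaussian concentration. -/
lemma gaussN_real_gt_le_of_shift (hn : n ≠ 0) {S G : Euc n → ℝ} (hS : Measurable S) (hS0 : ∀ z, 0 ≤ S z)
    (hSi : Integrable S (gaussN n)) (hG : Measurable G) {m k δ : ℝ} (hm : 0 < m)
    (hSm : ∫ z, S z ∂(gaussN n) ≤ m) (hδ : 0 ≤ δ) (hGS : ∀ w z, dist w z < δ → G w ≤ S z + k) :
    (gaussN n).real {w | 2 * m + k < G w} ≤ 2 * rexp (-(n * δ ^ 2 / 5)) := by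
  have h1 := mul_meas_ge_le_integral_of_nonneg (μ := gaussN n) (ae_of_all _ hS0) hSi (2 * m)
  have h2 : {z | S z ≤ 2 * m}ᶜ ⊆ {z | 2 * m ≤ S z} := by
    intro z hz; simp only [mem_compl_iff, mem_ofPred_eq, not_le] at hz ⊢; exact hz.le
  have h3 := measureReal_mono (μ := gaussN n) h2
  have hms : MeasurableSet {z | S z ≤ 2 * m} := measurableSet_le hS measurable_const
  rw [probReal_compl_eq_one_sub hms] at h3
  have h4 : (gaussN n).real {z | 2 * m ≤ S z} ≤ 1 / 2 := by
    by_contra! h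
    have : 2 * m * (1 / 2) < 2 * m * (gaussN n).real {z | 2 * m ≤ S z} := by gcongr
    linarith
  have := gaussN_real_le_of_far hn hms (measurableSet_lt measurable_const hG : MeasurableSet {w | 2 * m + k < G w}) hδ
    (fun z hz w hw => by
      by_contra! hc
      have := hGS w z hc
      have a : S z ≤ 2 * m := hz
      have b : 2 * m + k < G w := hw
      linarith) (by norm_num : (0:ℝ) < 1 / 2) (by linarith)
  exact this.trans_eq (by norm_num)

end

section
variable {n : ℕ} {μ : Measure (Euc n)}

lemma upTail_le_half [IsProbabilityMeasure μ] (hμ : Measure.IsEven μ) {t : ℝ} (ht : 0 < t) (z : Euc n) :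
    upTail μ t z ≤ 1 / 2 := by
  linarith [upTail_zero_add_le hμ ht z, upTail_antitone (μ := μ) z ht.le]

lemma slabMass_le_sub [IsProbabilityMeasure μ] {t h : ℝ} (hh : 0 < h) (w : Euc n) :
    slabMass μ t h w ≤ upTail μ (t - h) w - upTail μ (t + 3 * h) w := by
  have hd : Disjoint {x : Euc n | t - h ≤ ⟪x, w⟫ ∧ ⟪x, w⟫ ≤ t + 2 * h} {x | t + 3 * h ≤ ⟪x, w⟫} := by
    rw [Set.disjoint_left]
    intro x hx hx'
    linarith [hx.2, show t + 3 * h ≤ ⟪x, w⟫ from hx']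
  have h1 := measureReal_union (μ := μ) hd (measurableSet_le_inner _ _)
  have h2 : μ.real ({x : Euc n | t - h ≤ ⟪x, w⟫ ∧ ⟪x, w⟫ ≤ t + 2 * h} ∪ {x | t + 3 * h ≤ ⟪x, w⟫}) ≤ upTail μ (t - h) w := by
    refine measureReal_mono ?_
    rintro x (hx | hx)
    · exact hx.1
    · show t - h ≤ _; linarith [show t + 3 * h ≤ ⟪x, w⟫ from hx]
  unfold slabMass
  have : upTail μ (t + 3 * h) w = μ.real {x | t + 3 * h ≤ ⟪x, w⟫} := rfl
  linarith

lemma slabMass_le_one_sub [IsProbabilityMeasure μ] (hμ : Measure.IsEven μ) {t h : ℝ} (ht : 0 < t) (hh : 0 < h) (w : Euc n) :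
    slabMass μ t h w ≤ 1 - 2 * upTail μ (t + 3 * h) w := by
  have h1 := slabMass_le_sub (μ := μ) (t := t) hh w
  have h2 : upTail μ (t - h) w ≤ 1 - upTail μ (t + 3 * h) w := by
    rw [← hμ.real_inner_le_neg (t + 3 * h) w]
    have hd : Disjoint {x : Euc n | t - h ≤ ⟪x, w⟫} {x | ⟪x, w⟫ ≤ -(t + 3 * h)} := by
      rw [Set.disjoint_left]
      intro x hx hx'
      linarith [show t - h ≤ ⟪x, w⟫ from hx, show ⟪x, w⟫ ≤ -(t + 3 * h) from hx']
    have h3 := measureReal_union (μ := μ) hd (measurableSet_le (by fun_prop) measurable_const)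
    have h4 : μ.real ({x : Euc n | t - h ≤ ⟪x, w⟫} ∪ {x | ⟪x, w⟫ ≤ -(t + 3 * h)}) ≤ 1 := measureReal_le_one
    have : upTail μ (t - h) w = μ.real {x | t - h ≤ ⟪x, w⟫} := rfl
    linarith
  linarith

/-- Outside a small set of directions, the slab mass is controlled by its width. -/
lemma exists_slabMass_le {C₀ c₀ T ε h : ℝ} [IsProbabilityMeasure μ] (hn : n ≠ 0) (hC₀ : 0 < C₀) (hc₀ : 0 < c₀)
    (hμ : Measure.IsEven μ) (hψ : HasPsiOneMarginals μ C₀ c₀) (hT : 1 ≤ T) (hε : 0 < ε) (hε1 : ε ≤ 1 / 100)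
    (hD : ∀ t, 0 ≤ t → t ≤ T + ε / (2000 * T) → (1 - 6 / 5 * ε) * gaussTail t ≤ meanTail μ t ∧
      meanTail μ t ≤ (1 + 6 / 5 * ε) * gaussTail t)
    (hεh : ε ≤ h) (hhT : 100 * h * T ≤ 1) {τ : ℝ} (hτ : 0 < τ) (hτT : τ ≤ T + ε / (2000 * T)) :
    ∃ B : Set (Euc n), MeasurableSet B ∧ (gaussN n).real B ≤ 2 * rexp (-(n * ε ^ 2 / 5)) ∧
      ∀ w ∉ B, slabMass μ τ h w ≤ 280 * (h * T * gaussTail τ) + 2 * (C₀ * rexp (-(c₀ * h / ε))) := by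
  have hh : 0 < h := hε.trans_le hεh
  have hhT' : h ≤ h * T := le_mul_of_one_le_right hh.le hT
  have hQ := gaussTail_pos τ
  have hm : 0 < 140 * (h * T * gaussTail τ) := by positivity
  have hτ2 : τ ≤ 2 * T := by
    have : ε / (2000 * T) ≤ 1 := by rw [div_le_one (by positivity)]; linarith
    linarith
  have hshift : ∀ (w z : Euc n), dist w z < ε → ∀ t, upTail μ t w ≤ upTail μ (t - h) z + C₀ * rexp (-(c₀ * h / ε)) :=
    fun w z hwz t => upTail_shift_le hC₀ hc₀ hψ (by rw [← dist_eq_norm]; exact hwz.le) hh.le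
  have key : ∀ S G : Euc n → ℝ, Measurable S → (∀ z, 0 ≤ S z) → Integrable S (gaussN n) → Measurable G →
      ∫ z, S z ∂(gaussN n) ≤ 140 * (h * T * gaussTail τ) →
      (∀ w z, dist w z < ε → G w ≤ S z + 2 * (C₀ * rexp (-(c₀ * h / ε)))) → (∀ w, slabMass μ τ h w ≤ G w) →
      ∃ B : Set (Euc n), MeasurableSet B ∧ (gaussN n).real B ≤ 2 * rexp (-(n * ε ^ 2 / 5)) ∧
      ∀ w ∉ B, slabMass μ τ h w ≤ 280 * (h * T * gaussTail τ) + 2 * (C₀ * rexp (-(c₀ * h / ε))) := by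
    intro S G hS hS0 hSi hG hSm hGS hsl
    refine ⟨_, measurableSet_lt measurable_const hG, gaussN_real_gt_le_of_shift hn hS hS0 hSi hG hm hSm hε.le hGS, ?_⟩
    intro w hw
    have : G w ≤ 2 * (140 * (h * T * gaussTail τ)) + 2 * (C₀ * rexp (-(c₀ * h / ε))) := not_lt.1 hw
    linarith [hsl w]
  rcases le_or_gt τ (9 * h) with hc | hc
  · refine key (fun z => 1 - 2 * upTail μ (τ + 4 * h) z) (fun w => 1 - 2 * upTail μ (τ + 3 * h) w)
      (((measurable_upTail _).const_mul _).const_sub _) (fun z => ?_)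
      ((integrable_const _).sub ((integrable_upTail _).const_mul _)) (((measurable_upTail _).const_mul _).const_sub _) ?_
      (fun w z hwz => ?_) (fun w => slabMass_le_one_sub hμ hτ hh w)
    · linarith [upTail_le_half (μ := μ) hμ (show 0 < τ + 4 * h by positivity) z]
    · rw [integral_sub (integrable_const _) ((integrable_upTail _).const_mul _), integral_const_mul]
      simp only [integral_const, probReal_univ, one_smul]
      have h1 := (hD (τ + 4 * h) (by positivity) (by linarith [show 0 ≤ ε / (2000 * T) by positivity])).1
      have h2 := gaussTail_sub_le (show 0 ≤ τ + 4 * h by positivity)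
      have h3 := gaussTail_sub_le hτ.le
      rw [gaussTail_zero] at h2 h3
      have h4 := gaussTail_le_half (show 0 ≤ τ + 4 * h by positivity)
      have h5 : ε * gaussTail (τ + 4 * h) ≤ ε * (1 / 2) := mul_le_mul_of_nonneg_left h4 hε.le
      have h6 : h * T * (9 / 20) ≤ h * T * gaussTail τ := mul_le_mul_of_nonneg_left (by linarith) (by positivity)
      have h7 : meanTail μ (τ + 4 * h) = ∫ z, upTail μ (τ + 4 * h) z ∂(gaussN n) := rfl
      rw [← h7]
      linarith
    · have := hshift z w (by rwa [dist_comm]) (τ + 4 * h)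
      rw [show τ + 4 * h - h = τ + 3 * h by ring] at this
      linarith
  · refine key (fun z => upTail μ (τ - 2 * h) z - upTail μ (τ + 4 * h) z) (fun w => upTail μ (τ - h) w - upTail μ (τ + 3 * h) w)
      ((measurable_upTail _).sub (measurable_upTail _)) (fun z => sub_nonneg.2 (upTail_antitone z (by linarith)))
      ((integrable_upTail _).sub (integrable_upTail _)) ((measurable_upTail _).sub (measurable_upTail _)) ?_
      (fun w z hwz => ?_) (fun w => slabMass_le_sub hh w)
    · rw [integral_sub (integrable_upTail _) (integrable_upTail _)]
      change meanTail μ (τ - 2 * h) - meanTail μ (τ + 4 * h) ≤ _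
      have hcv := meanTail_convex (μ := μ) (a := τ - 8 * h) (b := τ - 2 * h) (c := τ + 4 * h) (by linarith) (by linarith) (by linarith)
      have h1 := (hD (τ - 8 * h) (by linarith) (by linarith)).2
      have h2 := (hD (τ - 2 * h) (by linarith) (by linarith)).1
      have h3 := gaussTail_sub_le_mul (h := 8 * h) (t := τ) (u := 24 * (h * T)) (by positivity) (by linarith) (by
        have : h * (τ + 1) ≤ h * (3 * T) := by gcongr; linarith
        linarith) (by linarith)
      have h4 : gaussTail τ ≤ gaussTail (τ - 2 * h) := gaussTail_strictAnti.antitone (by linarith)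
      have h4' : gaussTail (τ - 2 * h) ≤ gaussTail (τ - 8 * h) := gaussTail_strictAnti.antitone (by linarith)
      have h5 : gaussTail (τ - 8 * h) ≤ 2 * gaussTail τ := h3.trans (mul_le_mul_of_nonneg_right (by linarith) hQ.le)
      have h6 : ε * gaussTail (τ - 8 * h) ≤ h * T * (2 * gaussTail τ) :=
        mul_le_mul (hεh.trans hhT') h5 (gaussTail_nonneg _) (by positivity)
      have h6' : ε * gaussTail (τ - 2 * h) ≤ ε * gaussTail (τ - 8 * h) := mul_le_mul_of_nonneg_left h4' hε.le
      have hDD : meanTail μ (τ - 8 * h) - meanTail μ (τ - 2 * h) ≤ 53 * (h * T * gaussTail τ) := by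
        nlinarith
      have hpos : 0 < h * (τ - 5 * h) := mul_pos hh (by linarith)
      have e : h * (τ - 5 * h) * (meanTail μ (τ - 2 * h) - meanTail μ (τ + 4 * h)) ≤
          h * (τ + h) * (meanTail μ (τ - 8 * h) - meanTail μ (τ - 2 * h)) := by nlinarith
      have e2 : h * (τ + h) * (meanTail μ (τ - 8 * h) - meanTail μ (τ - 2 * h)) ≤
          h * (τ + h) * (53 * (h * T * gaussTail τ)) := by gcongr
      have e3 : h * (τ + h) * (53 * (h * T * gaussTail τ)) ≤ h * (τ - 5 * h) * (140 * (h * T * gaussTail τ)) := by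
        have : h * ((τ + h) * 53) ≤ h * ((τ - 5 * h) * 140) := mul_le_mul_of_nonneg_left (by linarith) hh.le
        have := mul_le_mul_of_nonneg_right this (show 0 ≤ h * T * gaussTail τ by positivity)
        linarith
      exact le_of_mul_le_mul_left (e.trans (e2.trans e3)) hpos
    · have a1 := hshift w z hwz (τ - h)
      have a2 := hshift z w (by rwa [dist_comm]) (τ + 4 * h)
      rw [show τ + 4 * h - h = τ + 3 * h by ring] at a2
      rw [show τ - h - h = τ - 2 * h by ring] at a1
      linarith

/-- Concentration for averages of wide ramps. -/
lemma ridgeAvg_ramp_dev {C₀ c₀ T ε h : ℝ} [IsProbabilityMeasure μ] (hn : n ≠ 0) (hC₀ : 0 < C₀) (hc₀ : 0 < c₀)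
    (hμ : Measure.IsEven μ) (hψ : HasPsiOneMarginals μ C₀ c₀) (hT : 1 ≤ T) (hε : 0 < ε) (hε1 : ε ≤ 1 / 100)
    (hD : ∀ t, 0 ≤ t → t ≤ T + ε / (2000 * T) → (1 - 6 / 5 * ε) * gaussTail t ≤ meanTail μ t ∧
      meanTail μ t ≤ (1 + 6 / 5 * ε) * gaussTail t)
    (hεh : ε ≤ h) (hhT : 100 * h * T ≤ 1) {τ : ℝ} (hτ : 0 < τ) (hτT : τ ≤ T + ε / (2000 * T))
    {B : ℝ} (hB : 1 ≤ B) (hB1 : 2 * (C₀ * rexp (-(c₀ * h / ε))) ≤ h * T * gaussTail τ)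
    (hB2 : 16 * (4 * (1 + 2 * C₀) / c₀ * rexp (-(c₀ * (B * T ^ 2) / 4))) ≤ h * gaussTail τ) (s : Set (Euc n)) :
    (gaussN n).real {z | ε * gaussTail τ / 2 < |ridgeAvg (μ.restrict s) (ramp τ h) z -
      ∫ z', ridgeAvg (μ.restrict s) (ramp τ h) z' ∂(gaussN n)|} ≤
      2 * rexp (-(n * ε ^ 2 / 5)) + 8 / (ε * gaussTail τ) * rexp (-(n * (ε / (4496 * B * T ^ 3)) ^ 2 / 5)) := by
  have hh : 0 < h := hε.trans_le hεh
  have hQ := gaussTail_pos τ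
  have hT0 : 0 < T := by linarith
  obtain ⟨S, hS, hSm, hSl⟩ := exists_slabMass_le hn hC₀ hc₀ hμ hψ hT hε hε1 hD hεh hhT hτ hτT
  set δ := ε / (4496 * B * T ^ 3) with hδ
  have hδ0 : 0 < δ := by positivity
  have hδε : δ ≤ ε := by
    refine div_le_self hε.le ?_
    have : 1 ≤ B * T ^ 3 := one_le_mul_of_one_le_of_one_le hB (one_le_pow₀ hT)
    linarith
  have hAδ : B * T ^ 2 * δ * T = ε / 4496 := by rw [hδ]; field_simp
  have hAh : B * T ^ 2 * δ ≤ h := by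
    have : B * T ^ 2 * δ ≤ B * T ^ 2 * δ * T := le_mul_of_one_le_right (by positivity) hT
    linarith
  have h01 : ∀ z, 0 ≤ ridgeAvg (μ.restrict s) (ramp τ h) z ∧ ridgeAvg (μ.restrict s) (ramp τ h) z ≤ 1 := fun z => by
    refine ⟨integral_nonneg fun x => ramp_nonneg _, ?_⟩
    have h1 := abs_ridgeAvg_le (ν := μ.restrict s) (ρ := ramp τ h) (L := 1)
      (fun y => by rw [abs_of_nonneg (ramp_nonneg _)]; exact ramp_le_one _) z
    have h2 : (μ.restrict s).real univ ≤ 1 := by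
      rw [measureReal_restrict_apply MeasurableSet.univ]; exact measureReal_le_one
    linarith [le_abs_self (ridgeAvg (μ.restrict s) (ramp τ h) z)]
  have hmain := deviation_of_lipschitz_on hn (measurable_ridgeAvg (ν := μ.restrict s) (continuous_ramp (t := τ) (h := h)).measurable)
    h01 hS (s := ε * gaussTail τ / 4) (δ := δ) (by positivity) hδ0.le (fun w hw z hwz => by
      refine (ridgeAvg_ramp_sub_le (A := B * T ^ 2) hC₀ hc₀ hψ hh (by positivity) hAh s hwz).trans ?_
      have h1 := hSl w hw
      have h2 : slabMass μ τ h w ≤ 281 * (h * T * gaussTail τ) := by linarith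
      have h3 : 2 * (B * T ^ 2 * δ) / h * slabMass μ τ h w ≤ 2 * (B * T ^ 2 * δ) / h * (281 * (h * T * gaussTail τ)) := by
        gcongr
      have h4 : 2 * (B * T ^ 2 * δ) / h * (281 * (h * T * gaussTail τ)) = ε * gaussTail τ / 8 := by
        have : 2 * (B * T ^ 2 * δ) / h * (281 * (h * T * gaussTail τ)) = 562 * (B * T ^ 2 * δ * T) * gaussTail τ := by
          field_simp; ring
        rw [this, hAδ]; ring
      have h5 : 2 / h * (δ * (4 * (1 + 2 * C₀) / c₀ * rexp (-(c₀ * (B * T ^ 2) / 4)))) ≤ 2 / h * (ε * (h * gaussTail τ / 16)) := by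
        have : 4 * (1 + 2 * C₀) / c₀ * rexp (-(c₀ * (B * T ^ 2) / 4)) ≤ h * gaussTail τ / 16 := by linarith
        have h6 := mul_le_mul hδε this (by positivity) hε.le
        exact mul_le_mul_of_nonneg_left h6 (by positivity)
      have h6 : 2 / h * (ε * (h * gaussTail τ / 16)) = ε * gaussTail τ / 8 := by field_simp; ring
      linarith)
  have e1 : 2 * (ε * gaussTail τ / 4) = ε * gaussTail τ / 2 := by ring
  have e2 : 2 / (ε * gaussTail τ / 4) = 8 / (ε * gaussTail τ) := by field_simp; ring
  rw [e1, e2] at hmain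
  refine hmain.trans ?_
  gcongr

end

section
variable {n : ℕ} {μ : Measure (Euc n)}

lemma ridgeAvg_rampGap_dev [IsProbabilityMeasure μ] (hn : n ≠ 0) {C₀ c₀ : ℝ} (hC₀ : 0 < C₀) (hc₀ : 0 < c₀)
    (hψ : HasPsiOneMarginals μ C₀ c₀) {e f h η τ : ℝ} (he : 0 < e)
    (hD : ∀ t, 0 ≤ t → t ≤ 1 → (1 - 6 / 5 * e ^ 5) * gaussTail t ≤ meanTail μ t ∧
      meanTail μ t ≤ (1 + 6 / 5 * e ^ 5) * gaussTail t)
    (hef : e ^ 2 ≤ f) (hf : f ≤ 1 / 20) (hη : 0 < η) (hηh : η ≤ h) (hhf : h ≤ f ^ 4)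
    (hV : 7000 * f + 6560 * e ≤ gaussTail τ ^ 2) (heq : e ≤ gaussTail τ) :
    (gaussN n).real {z | e ^ 5 * gaussTail τ / 2 ≤ |ridgeAvg (μ.restrict {x | e ^ 2 ≤ rad x}) (rampGap τ η h) z -
      ∫ z', ridgeAvg (μ.restrict {x | e ^ 2 ≤ rad x}) (rampGap τ η h) z' ∂(gaussN n)|} ≤
      2 * rexp (-(n * (e ^ 5) ^ 2 / (32 * (8 * (1 + 2 * C₀) / c₀ ^ 2)))) := by
  set K := 8 * (1 + 2 * C₀) / c₀ ^ 2 with hK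
  have hK0 : 0 < K := by positivity
  have hQ := gaussTail_pos τ
  have hn0 : (0:ℝ) < n := by positivity
  obtain ⟨L, ρ1, hL, hρ1, hb1, hT⟩ := exists_rampGap_taylor hη (hη.trans_le hηh) τ
  have hvar := integral_rampGap_variance_le hn (by positivity) hD (r := e ^ 2) (by positivity) hef hf hη hηh hhf (t := τ)
  have hV' : (7000 * f + 6560 * (e ^ 5 / (e ^ 2) ^ 2)) / n ≤ gaussTail τ ^ 2 / n := by
    have : e ^ 5 / (e ^ 2) ^ 2 = e := by field_simp
    rw [this]
    exact div_le_div_of_nonneg_right hV hn0.le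
  have hfar : ∀ᵐ x ∂(μ.restrict {x : Euc n | e ^ 2 ≤ rad x}), 4 * K * (n * e ^ 5 / (8 * K * gaussTail τ)) ≤ ‖x‖ ^ 2 := by
    filter_upwards [ae_restrict_mem (measurableSet_le_rad _)] with x hx
    have hx' : e ^ 2 ≤ ‖x‖ / √n := hx
    have h1 : (e ^ 2) ^ 2 ≤ ‖x‖ ^ 2 / n := by
      calc (e ^ 2) ^ 2 ≤ (‖x‖ / √n) ^ 2 := pow_le_pow_left₀ (by positivity) hx' 2
        _ = _ := by rw [div_pow, sq_sqrt hn0.le]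
    rw [le_div_iff₀ hn0] at h1
    refine le_trans ?_ h1
    have : 4 * K * (n * e ^ 5 / (8 * K * gaussTail τ)) = (e ^ 4 * n) * (e / gaussTail τ) / 2 := by field_simp; norm_num
    rw [this]
    have h2 : e / gaussTail τ ≤ 1 := (div_le_one hQ).2 heq
    have h3 : 0 ≤ e ^ 4 * n := by positivity
    nlinarith
  have hint : Integrable (fun x : Euc n => x) (μ.restrict {x | e ^ 2 ≤ rad x}) :=
    ((memLp_id_of_psiOne hC₀ hc₀ hψ).integrable (by norm_num)).restrict
  have key := ridgeAvg_deviation hn (ν := μ.restrict {x : Euc n | e ^ 2 ≤ rad x}) hK0 hL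
    (fun v => ⟨(integral_inner_sq_le hC₀ hc₀ hψ v).1.restrict,
      (setIntegral_le_integral (integral_inner_sq_le hC₀ hc₀ hψ v).1 (ae_of_all _ fun x => sq_nonneg _)).trans
        (integral_inner_sq_le hC₀ hc₀ hψ v).2⟩) hint
    (lam := n * e ^ 5 / (8 * K * gaussTail τ)) (by positivity) hfar (ρ := rampGap τ η h) (ρ1 := ρ1)
    (continuous_ramp.sub continuous_ramp).measurable hρ1 (fun y => ⟨rampGap_nonneg hη hηh y, rampGap_le_one y⟩)
    hb1 hT (hvar.trans hV') (e ^ 5 * gaussTail τ / 2)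
  refine key.trans_eq ?_
  congr 2
  field_simp
  ring

lemma ridgeAvg_ramp_add [IsFiniteMeasure μ] {τ η h : ℝ} (z : Euc n) :
    ridgeAvg μ (ramp τ η) z = ridgeAvg μ (ramp τ h) z + ridgeAvg μ (rampGap τ η h) z := by
  unfold ridgeAvg
  have hi : ∀ g : ℝ, Integrable (fun x : Euc n => ramp τ g ⟪x, z⟫) μ := fun g =>
    Integrable.of_bound (continuous_ramp.measurable.comp (by fun_prop)).aestronglyMeasurable 1
      (ae_of_all _ fun x => by rw [norm_eq_abs, abs_of_nonneg (ramp_nonneg _)]; exact ramp_le_one _)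
  have hi2 : Integrable (fun x : Euc n => rampGap τ η h ⟪x, z⟫) μ := (hi η).sub (hi h)
  rw [← integral_add (hi h) hi2]
  refine integral_congr_ae (ae_of_all _ fun x => ?_)
  simp [rampGap]

lemma abs_ramp_le (τ η y : ℝ) : |ramp τ η y| ≤ 1 := by
  rw [abs_of_nonneg (ramp_nonneg _)]; exact ramp_le_one _

lemma ridgeAvg_ramp_le_upTail [IsFiniteMeasure μ] {τ η : ℝ} (hη : 0 < η) (z : Euc n) :
    ridgeAvg μ (ramp τ η) z ≤ upTail μ τ z := by
  have hm := measurableSet_le_inner (n := n) τ z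
  calc ridgeAvg μ (ramp τ η) z ≤ ∫ x, {x : Euc n | τ ≤ ⟪x, z⟫}.indicator 1 x ∂μ := by
        refine integral_mono ?_ ?_ fun x => ?_
        · exact Integrable.of_bound (continuous_ramp.measurable.comp (by fun_prop)).aestronglyMeasurable 1
            (ae_of_all _ fun x => abs_ramp_le _ _ _)
        · exact (integrable_const (1:ℝ)).indicator hm
        · by_cases hx : τ ≤ ⟪x, z⟫
          · rw [Set.indicator_of_mem (show x ∈ {x : Euc n | τ ≤ ⟪x, z⟫} from hx)]; exact ramp_le_one _
          · rw [Set.indicator_of_notMem (show x ∉ {x : Euc n | τ ≤ ⟪x, z⟫} from hx)]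
            exact (ramp_of_le hη (not_le.1 hx).le).le
    _ = upTail μ τ z := integral_indicator_one hm

lemma upTail_le_ridgeAvg_ramp [IsFiniteMeasure μ] {τ η : ℝ} (hη : 0 < η) (z : Euc n) :
    upTail μ (τ + η) z ≤ ridgeAvg μ (ramp τ η) z := by
  have hm := measurableSet_le_inner (n := n) (τ + η) z
  calc upTail μ (τ + η) z = ∫ x, {x : Euc n | τ + η ≤ ⟪x, z⟫}.indicator 1 x ∂μ := (integral_indicator_one hm).symm
    _ ≤ ridgeAvg μ (ramp τ η) z := by
        refine integral_mono ((integrable_const (1:ℝ)).indicator hm) ?_ fun x => ?_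
        · exact Integrable.of_bound (continuous_ramp.measurable.comp (by fun_prop)).aestronglyMeasurable 1
            (ae_of_all _ fun x => abs_ramp_le _ _ _)
        · by_cases hx : τ + η ≤ ⟪x, z⟫
          · rw [Set.indicator_of_mem (show x ∈ {x : Euc n | τ + η ≤ ⟪x, z⟫} from hx)]
            exact (ramp_of_ge hη hx).ge
          · rw [Set.indicator_of_notMem (show x ∉ {x : Euc n | τ + η ≤ ⟪x, z⟫} from hx)]
            exact ramp_nonneg _

lemma upTail_split [IsFiniteMeasure μ] (r τ : ℝ) (z : Euc n) :
    upTail μ τ z = upTail (μ.restrict {x | rad x < r}) τ z + upTail (μ.restrict {x | r ≤ rad x}) τ z := by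
  rw [upTail_restrict, upTail_restrict]
  have hc : {x : Euc n | r ≤ rad x} = {x | rad x < r}ᶜ := by ext; simp
  rw [hc, ← Set.sdiff_eq_compl_inter.trans (Set.inter_comm _ _)]
  exact (measureReal_inter_add_sdiff (measurableSet_rad_lt r)).symm

lemma meanTail_split [IsFiniteMeasure μ] (r τ : ℝ) :
    meanTail μ τ = meanTail (μ.restrict {x | rad x < r}) τ + meanTail (μ.restrict {x | r ≤ rad x}) τ := by
  unfold meanTail
  rw [← integral_add (integrable_upTail _) (integrable_upTail _)]
  exact integral_congr_ae (ae_of_all _ fun z => upTail_split r τ z)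

end

section
variable {n : ℕ} {μ : Measure (Euc n)}

set_option maxHeartbeats 1000000 in
/-- Concentration of the tails `μ {x | τ ≤ ⟪x, z⟫}` in the direction `z` for very small relative errors `e ^ 5`. -/
lemma upTail_concentration_small [IsProbabilityMeasure μ] (hn : n ≠ 0) {C₀ c₀ : ℝ} (hC₀ : 0 < C₀) (hc₀ : 0 < c₀)
    (hμ : Measure.IsEven μ) (hψ : HasPsiOneMarginals μ C₀ c₀) {T e f q B : ℝ} (hT : 1 ≤ T) (he : 0 < e)
    (he1 : e ≤ 1 / 10 ^ 12) (heT : e * T ≤ 1 / 10 ^ 5)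
    (hD : ∀ t, 0 ≤ t → t ≤ T + e ^ 5 / (2000 * T) → (1 - 6 / 5 * e ^ 5) * gaussTail t ≤ meanTail μ t ∧
      meanTail μ t ≤ (1 + 6 / 5 * e ^ 5) * gaussTail t)
    (hq0 : 0 < q) (hq : ∀ t, t ≤ T + e ^ 5 / (2000 * T) → q ≤ gaussTail t)
    (hC : C₀ * rexp (-(c₀ / (2 * e ^ 4))) ≤ e ^ 15) (hq1 : 3 * e ^ 10 ≤ q) (heq : e ≤ q)
    (hef : e ^ 2 ≤ f) (hf : f ≤ 1 / 20) (heh : e ^ 5 ≤ f ^ 4) (hV : 7000 * f + 6560 * e ≤ q ^ 2)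
    (hhT : 100 * f ^ 4 * T ≤ 1) (hB : 1 ≤ B)
    (hB1 : 2 * (C₀ * rexp (-(c₀ * f ^ 4 / e ^ 5))) ≤ f ^ 4 * q)
    (hB2 : 16 * (4 * (1 + 2 * C₀) / c₀ * rexp (-(c₀ * (B * T ^ 2) / 4))) ≤ f ^ 4 * q)
    {τ : ℝ} (hτ0 : e ^ 5 / (10000 * T) ≤ τ) (hτ : τ ≤ T + e ^ 5 / (5000 * T)) :
    (gaussN n).real {z | (1 + 8 * e ^ 5) * gaussTail τ < upTail μ τ z} ≤
      4 * rexp (-(n * (e ^ 5) ^ 2 / 5)) + 2 * rexp (-(n * (e ^ 5) ^ 2 / (32 * (8 * (1 + 2 * C₀) / c₀ ^ 2)))) +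
        8 / (e ^ 5 * q) * rexp (-(n * (e ^ 5 / (4496 * B * T ^ 3)) ^ 2 / 5)) ∧
    (gaussN n).real {z | upTail μ τ z < (1 - 8 * e ^ 5) * gaussTail τ} ≤
      4 * rexp (-(n * (e ^ 5) ^ 2 / 5)) + 2 * rexp (-(n * (e ^ 5) ^ 2 / (32 * (8 * (1 + 2 * C₀) / c₀ ^ 2)))) +
        8 / (e ^ 5 * q) * rexp (-(n * (e ^ 5 / (4496 * B * T ^ 3)) ^ 2 / 5)) := by
  have hT0 : 0 < T := by linarith
  have hε : 0 < e ^ 5 := by positivity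
  have hε1 : e ^ 5 ≤ 1 / 100 := by
    calc e ^ 5 ≤ e ^ 1 := pow_le_pow_of_le_one he.le (by linarith) (by norm_num)
      _ ≤ _ := by rw [pow_one]; linarith
  have hη : (0:ℝ) < e ^ 10 := by positivity
  have hηε : e ^ 10 ≤ e ^ 5 / (10 ^ 8 * T) := by
    rw [le_div_iff₀ (by positivity)]
    have h1 : e ^ 4 ≤ 1 / 10 ^ 4 := by
      calc e ^ 4 ≤ e ^ 1 := pow_le_pow_of_le_one he.le (by linarith) (by norm_num)
        _ ≤ _ := by rw [pow_one]; linarith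
    have h2 : e ^ 5 * T ≤ 1 / 10 ^ 8 := by
      have : e ^ 5 * T = e ^ 4 * (e * T) := by ring
      rw [this]
      calc e ^ 4 * (e * T) ≤ 1 / 10 ^ 4 * (1 / 10 ^ 5) := by gcongr
        _ ≤ _ := by norm_num
    have : e ^ 10 * (10 ^ 8 * T) = e ^ 5 * (10 ^ 8 * (e ^ 5 * T)) := by ring
    rw [this]
    nlinarith
  have hηh : e ^ 10 ≤ f ^ 4 := by
    refine (pow_le_pow_of_le_one he.le (by linarith) (by norm_num : 5 ≤ 10)).trans heh
  have eT1 : e ^ 5 / (10 ^ 8 * T) = e ^ 5 / T / 10 ^ 8 := by field_simp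
  have eT2 : e ^ 5 / (10000 * T) = e ^ 5 / T / 10000 := by field_simp
  have eT3 : e ^ 5 / (5000 * T) = e ^ 5 / T / 5000 := by field_simp
  have eT4 : e ^ 5 / (2000 * T) = e ^ 5 / T / 2000 := by field_simp
  have hx0 : 0 < e ^ 5 / T := by positivity
  have hxT : e ^ 5 / T ≤ 1 / 100 := (div_le_self hε.le hT).trans hε1
  rw [eT4] at hD hq
  rw [eT1] at hηε
  rw [eT2] at hτ0
  rw [eT3] at hτ
  have hDone : ∀ t, 0 ≤ t → t ≤ 1 → (1 - 6 / 5 * e ^ 5) * gaussTail t ≤ meanTail μ t ∧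
      meanTail μ t ≤ (1 + 6 / 5 * e ^ 5) * gaussTail t := fun t h0 h1 => hD t h0 (by linarith)
  have hτpos : 0 < τ := by linarith
  set M := μ.restrict {x : Euc n | e ^ 2 ≤ rad x} with hM
  set N := μ.restrict {x : Euc n | rad x < e ^ 2} with hN
  -- deviation of the smoothed tail of the far part
  have dev : ∀ s, 0 < s → s ≤ T + e ^ 5 / T / 2000 →
      (gaussN n).real {z | e ^ 5 * gaussTail s < |ridgeAvg M (ramp s (e ^ 10)) z - ∫ z', ridgeAvg M (ramp s (e ^ 10)) z' ∂(gaussN n)|} ≤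
        2 * rexp (-(n * (e ^ 5) ^ 2 / (32 * (8 * (1 + 2 * C₀) / c₀ ^ 2)))) + (2 * rexp (-(n * (e ^ 5) ^ 2 / 5)) +
        8 / (e ^ 5 * q) * rexp (-(n * (e ^ 5 / (4496 * B * T ^ 3)) ^ 2 / 5))) := by
    intro s hs0 hsT
    have hqs := hq s hsT
    have hQs := gaussTail_pos s
    have hT1 : T * gaussTail s ≥ gaussTail s := by nlinarith
    have hf4 : 0 ≤ f ^ 4 := by positivity
    have h1 := ridgeAvg_rampGap_dev hn hC₀ hc₀ hψ he hDone hef hf hη hηh le_rfl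
      (hV.trans (pow_le_pow_left₀ hq0.le hqs 2)) (heq.trans hqs) (τ := s)
    have h2 := ridgeAvg_ramp_dev (h := f ^ 4) hn hC₀ hc₀ hμ hψ hT hε hε1 (by rw [eT4]; exact hD) heh hhT hs0
      (by rw [eT4]; exact hsT) hB (hB1.trans (by
        rw [mul_assoc]; exact mul_le_mul_of_nonneg_left (by linarith) hf4))
      (hB2.trans (mul_le_mul_of_nonneg_left hqs hf4)) {x : Euc n | e ^ 2 ≤ rad x}
    rw [← hM] at h1 h2
    have hEadd : ∫ z', ridgeAvg M (ramp s (e ^ 10)) z' ∂(gaussN n) =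
        ∫ z', ridgeAvg M (ramp s (f ^ 4)) z' ∂(gaussN n) + ∫ z', ridgeAvg M (rampGap s (e ^ 10) (f ^ 4)) z' ∂(gaussN n) := by
      have hi : Integrable (fun z => ridgeAvg M (rampGap s (e ^ 10) (f ^ 4)) z) (gaussN n) :=
        integrable_ridgeAvg (L := 1) (ρ := rampGap s (e ^ 10) (f ^ 4)) (continuous_ramp.sub continuous_ramp).measurable
          fun y => by rw [abs_of_nonneg (rampGap_nonneg hη hηh y)]; exact rampGap_le_one y
      rw [← integral_add (integrable_ridgeAvg continuous_ramp.measurable (abs_ramp_le _ _)) hi]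
      exact integral_congr_ae (ae_of_all _ fun z => ridgeAvg_ramp_add z)
    have hsub : {z | e ^ 5 * gaussTail s < |ridgeAvg M (ramp s (e ^ 10)) z - ∫ z', ridgeAvg M (ramp s (e ^ 10)) z' ∂(gaussN n)|} ⊆
        {z | e ^ 5 * gaussTail s / 2 ≤ |ridgeAvg M (rampGap s (e ^ 10) (f ^ 4)) z - ∫ z', ridgeAvg M (rampGap s (e ^ 10) (f ^ 4)) z' ∂(gaussN n)|} ∪
        {z | e ^ 5 * gaussTail s / 2 < |ridgeAvg M (ramp s (f ^ 4)) z - ∫ z', ridgeAvg M (ramp s (f ^ 4)) z' ∂(gaussN n)|} := by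
      intro z hz
      by_contra hcon
      simp only [Set.mem_union, not_or, Set.mem_ofPred_eq, not_le, not_lt] at hcon
      have a1 := hcon.1
      have a2 := hcon.2
      have a3 : e ^ 5 * gaussTail s < |ridgeAvg M (ramp s (e ^ 10)) z - ∫ z', ridgeAvg M (ramp s (e ^ 10)) z' ∂(gaussN n)| := hz
      rw [hEadd, ridgeAvg_ramp_add (h := f ^ 4) z, add_sub_add_comm] at a3
      have a4 := a3.trans_le (abs_add_le _ _)
      linarith
    refine (measureReal_mono hsub).trans ((measureReal_union_le _ _).trans (add_le_add h1 (h2.trans ?_)))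
    refine add_le_add le_rfl (mul_le_mul_of_nonneg_right ?_ (exp_pos _).le)
    exact div_le_div_of_nonneg_left (by norm_num) (by positivity) (mul_le_mul_of_nonneg_left hqs hε.le)
  have hqτ : q ≤ gaussTail τ := hq τ (by linarith)
  have hQ := gaussTail_pos τ
  obtain ⟨hnear1, hnear2⟩ := upTail_restrict_rad_dev hn hC₀ hc₀ hμ hψ he he1 hDone hC hτpos (hq1.trans hqτ)
  rw [← hN] at hnear1 hnear2
  have hηT : e ^ 10 * (T + 2) ≤ e ^ 5 / 100 := by
    have h3 : e ^ 5 / T * T = e ^ 5 := by field_simp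
    nlinarith
  set ε := e ^ 5 with hεdef
  set Q := gaussTail τ with hQdef
  set near := 2 * rexp (-(n * ε ^ 2 / 5))
  constructor
  · have hs0 : 0 < τ - e ^ 10 := by linarith
    have hd := dev (τ - e ^ 10) hs0 (by linarith)
    have hDs := (hD (τ - e ^ 10) hs0.le (by linarith)).2
    have hQs : gaussTail (τ - e ^ 10) ≤ (1 + 2 * (ε / 100)) * Q :=
      gaussTail_sub_le_mul hη.le (by linarith) ((mul_le_mul_of_nonneg_left (by linarith) hη.le).trans hηT) (by linarith)
    have hE : ∫ z', ridgeAvg M (ramp (τ - e ^ 10) (e ^ 10)) z' ∂(gaussN n) ≤ meanTail μ (τ - e ^ 10) := by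
      rw [meanTail_split (e ^ 2)]
      have : 0 ≤ meanTail (μ.restrict {x | rad x < e ^ 2}) (τ - e ^ 10) := integral_nonneg fun z => upTail_nonneg _ _
      have h2 : ∫ z', ridgeAvg M (ramp (τ - e ^ 10) (e ^ 10)) z' ∂(gaussN n) ≤ meanTail M (τ - e ^ 10) :=
        integral_mono (integrable_ridgeAvg continuous_ramp.measurable (abs_ramp_le _ _)) (integrable_upTail _)
          fun z => ridgeAvg_ramp_le_upTail hη z
      linarith
    have hsub : {z | (1 + 8 * ε) * Q < upTail μ τ z} ⊆ {z | 9 / 2 * ε * Q < upTail N τ z} ∪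
        {z | ε * gaussTail (τ - e ^ 10) < |ridgeAvg M (ramp (τ - e ^ 10) (e ^ 10)) z - ∫ z', ridgeAvg M (ramp (τ - e ^ 10) (e ^ 10)) z' ∂(gaussN n)|} := by
      intro z hz
      by_contra hcon
      simp only [Set.mem_union, not_or, Set.mem_ofPred_eq, not_lt] at hcon
      have a1 := hcon.1
      have a2 := hcon.2
      have a3 : (1 + 8 * ε) * Q < upTail μ τ z := hz
      rw [upTail_split (e ^ 2)] at a3
      have a4 := upTail_le_ridgeAvg_ramp (μ := M) (τ := τ - e ^ 10) hη z
      rw [sub_add_cancel] at a4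
      have a5 := (abs_le.1 a2).2
      have a6 : (1 + 11 / 5 * ε) * gaussTail (τ - e ^ 10) ≤ (1 + 11 / 5 * ε) * ((1 + 2 * (ε / 100)) * Q) :=
        mul_le_mul_of_nonneg_left hQs (by positivity)
      have a7 : ε * ε * Q ≤ ε * (1 / 100) * Q := by gcongr
      have a8 : 0 < ε * Q := by positivity
      linarith
    refine (measureReal_mono hsub).trans ((measureReal_union_le _ _).trans ((add_le_add hnear2 hd).trans_eq ?_))
    ring
  · have hd := dev τ hτpos (by linarith)
    have hDs := (hD (τ + e ^ 10) (by positivity) (by linarith)).1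
    have hQs : Q ≤ (1 + 2 * (ε / 100)) * gaussTail (τ + e ^ 10) := by
      have := gaussTail_sub_le_mul (t := τ + e ^ 10) (u := ε / 100) hη.le (by linarith)
        ((mul_le_mul_of_nonneg_left (by linarith) hη.le).trans hηT) (by linarith)
      rwa [add_sub_cancel_right] at this
    have hE : meanTail μ (τ + e ^ 10) - 9 / 2 * ε * Q ≤ ∫ z', ridgeAvg M (ramp τ (e ^ 10)) z' ∂(gaussN n) := by
      rw [meanTail_split (e ^ 2)]
      have h1 : meanTail N (τ + e ^ 10) ≤ meanTail N τ := meanTail_antitone (by linarith)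
      have h2 : meanTail M (τ + e ^ 10) ≤ ∫ z', ridgeAvg M (ramp τ (e ^ 10)) z' ∂(gaussN n) :=
        integral_mono (integrable_upTail _) (integrable_ridgeAvg continuous_ramp.measurable (abs_ramp_le _ _))
          fun z => upTail_le_ridgeAvg_ramp hη z
      linarith
    have hsub : {z | upTail μ τ z < (1 - 8 * ε) * Q} ⊆
        {z | ε * gaussTail τ < |ridgeAvg M (ramp τ (e ^ 10)) z - ∫ z', ridgeAvg M (ramp τ (e ^ 10)) z' ∂(gaussN n)|} := by
      intro z hz
      by_contra hcon
      simp only [Set.mem_ofPred_eq, not_lt] at hcon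
      have a2 := hcon
      have a3 : upTail μ τ z < (1 - 8 * ε) * Q := hz
      rw [upTail_split (e ^ 2)] at a3
      have a4 := ridgeAvg_ramp_le_upTail (μ := M) (τ := τ) hη z
      have a5 := (abs_le.1 a2).1
      have a6 := upTail_nonneg (μ := N) τ z
      have a7 : (1 - 6 / 5 * ε) * ((1 - 2 * (ε / 100)) * Q) ≤ (1 - 6 / 5 * ε) * gaussTail (τ + e ^ 10) := by
        refine mul_le_mul_of_nonneg_left ?_ (by linarith)
        have : (1 - 2 * (ε / 100)) * Q ≤ (1 - 2 * (ε / 100)) * ((1 + 2 * (ε / 100)) * gaussTail (τ + e ^ 10)) :=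
          mul_le_mul_of_nonneg_left hQs (by linarith)
        have h9 : 0 ≤ ε * ε * gaussTail (τ + e ^ 10) := mul_nonneg (by positivity) (gaussTail_nonneg _)
        linarith
      have a8 : 0 < ε * Q := by positivity
      have a9 : 0 < ε * ε * Q := by positivity
      linarith
    refine (measureReal_mono hsub).trans (hd.trans ?_)
    have : 0 ≤ near := by positivity
    linarith

end

section

lemma exp_neg_le_inv {x : ℝ} (hx : 0 < x) : rexp (-x) ≤ 1 / x := by
  rw [exp_neg, ← one_div]
  exact one_div_le_one_div_of_le hx (by linarith [add_one_le_exp x])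

lemma exp_neg_le_inv_pow {x : ℝ} (hx : 0 < x) : rexp (-x) ≤ 24 / x ^ 4 := by
  rw [exp_neg, ← one_div, div_le_div_iff₀ (exp_pos _) (by positivity)]
  have := pow_div_factorial_le_exp x hx.le 4
  rw [div_le_iff₀ (by positivity)] at this
  norm_num [Nat.factorial] at this
  linarith

lemma gaussTail_ge_exp {T t : ℝ} (hT : 1 ≤ T) (ht : t ≤ 2 * T) : rexp (-T ^ 2) ^ 7 ≤ gaussTail t := by
  refine le_trans ?_ ((gaussTail_lower (by linarith)).trans (gaussTail_strictAnti.antitone ht))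
  rw [← exp_nat_mul]
  have h1 : rexp ((7:ℕ) * -T ^ 2) ≤ rexp (-(6 * T ^ 2)) * rexp (-1) := by
    rw [← exp_add]; apply exp_le_exp.2; push_cast; nlinarith
  have h2 : rexp (-1) ≤ 1 / 2 := by
    have := exp_neg_one_lt_d9; linarith
  have h3 : rexp (-(6 * T ^ 2)) ≤ rexp (-((2 * T) ^ 2 + 2 * T)) := by
    apply exp_le_exp.2; nlinarith
  calc rexp ((7:ℕ) * -T ^ 2) ≤ rexp (-(6 * T ^ 2)) * rexp (-1) := h1
    _ ≤ rexp (-((2 * T) ^ 2 + 2 * T)) * (1 / 2) := by gcongr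
    _ = _ := by ring

set_option maxHeartbeats 1000000 in
lemma exists_upTail_concentration_small {C₀ c₀ : ℝ} (hC₀ : 0 < C₀) (hc₀ : 0 < c₀) :
    ∃ D c' : ℝ, 1 ≤ D ∧ 0 < c' ∧ ∀ (n : ℕ) (μ : Measure (Euc n)), n ≠ 0 → IsProbabilityMeasure μ →
      Measure.IsEven μ → HasPsiOneMarginals μ C₀ c₀ → ∀ T ε : ℝ, 1 ≤ T → 0 < ε → ε ≤ rexp (-(D * T ^ 2)) →
      (∀ t, 0 ≤ t → t ≤ T + ε / (2000 * T) → (1 - 6 / 5 * ε) * gaussTail t ≤ meanTail μ t ∧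
        meanTail μ t ≤ (1 + 6 / 5 * ε) * gaussTail t) →
      ∀ τ, ε / (10000 * T) ≤ τ → τ ≤ T + ε / (5000 * T) →
      (gaussN n).real {z | (1 + 8 * ε) * gaussTail τ < upTail μ τ z} ≤ 14 / ε ^ 2 * rexp (-(c' * (n * ε ^ 2 / T ^ 6))) ∧
      (gaussN n).real {z | upTail μ τ z < (1 - 8 * ε) * gaussTail τ} ≤ 14 / ε ^ 2 * rexp (-(c' * (n * ε ^ 2 / T ^ 6))) := by
  set M := 64 * (1 + 2 * C₀) / c₀ with hM
  have hM0 : 0 < M := by positivity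
  set B := 1 + 4 / c₀ * (103 + M) with hBdef
  have hB : 1 ≤ B := le_add_of_nonneg_right (by positivity)
  have hB0 : 0 < B := by linarith
  set K := 32 * (8 * (1 + 2 * C₀) / c₀ ^ 2) with hK
  have hK0 : 0 < K := by positivity
  set D := 60 + 384 * C₀ / c₀ ^ 4 + 2 * C₀ / c₀ with hD
  have hD1 : 384 * C₀ / c₀ ^ 4 ≤ D := by
    have : 0 < 2 * C₀ / c₀ := by positivity
    linarith
  have hD2 : 2 * C₀ / c₀ ≤ D := by
    have : 0 < 384 * C₀ / c₀ ^ 4 := by positivity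
    linarith
  have hD60 : 60 ≤ D := by
    have : 0 < 384 * C₀ / c₀ ^ 4 := by positivity
    have : 0 < 2 * C₀ / c₀ := by positivity
    linarith
  have hD0 : 0 < D := by linarith
  set S := 5 + K + 5 * (4496 * B) ^ 2 with hS
  have hS0 : 0 < S := by positivity
  refine ⟨5 * D, 1 / S, by linarith, by positivity, ?_⟩
  intro n μ hn _ hμ hψ T ε hT hε hεD hHD τ hτ0 hτ
  have hT0 : 0 < T := by linarith
  have hT2 : 1 ≤ T ^ 2 := one_le_pow₀ hT
  set e := ε ^ (1 / 5 : ℝ) with he_def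
  have he : 0 < e := rpow_pos_of_pos hε _
  have he5 : e ^ 5 = ε := by
    rw [he_def, ← rpow_natCast, ← rpow_mul hε.le]; norm_num
  have heD : e ≤ rexp (-(D * T ^ 2)) := by
    refine le_of_pow_le_pow_left₀ (n := 5) (by norm_num) (exp_pos _).le ?_
    rw [he5, ← exp_nat_mul]
    refine hεD.trans_eq ?_
    congr 1; push_cast; ring
  set y := rexp (-T ^ 2) with hy
  have hy0 : 0 < y := exp_pos _
  have hy1 : y ≤ 37 / 100 := by
    have h1 : y ≤ rexp (-1) := exp_le_exp.2 (by linarith)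
    have := exp_neg_one_lt_d9; linarith
  have hypow : ∀ k : ℕ, rexp (-(k * T ^ 2)) = y ^ k := fun k => by
    rw [hy, ← exp_nat_mul]; congr 1; ring
  have hyanti : ∀ {a b : ℕ}, b ≤ a → y ^ a ≤ y ^ b := fun h => pow_le_pow_of_le_one hy0.le (by linarith) h
  have hey : e ≤ y ^ 60 := by
    rw [← hypow]
    refine heD.trans (exp_le_exp.2 (neg_le_neg ?_))
    exact mul_le_mul_of_nonneg_right (by exact_mod_cast hD60) (by positivity)
  have heinv : e ≤ 1 / D := heD.trans ((exp_le_exp.2 (neg_le_neg (le_mul_of_one_le_right hD0.le hT2))).trans (exp_neg_le_inv hD0))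
  have heD1 : 384 * C₀ / c₀ ^ 4 * e ≤ 1 := by
    calc 384 * C₀ / c₀ ^ 4 * e ≤ D * (1 / D) := by gcongr
      _ = 1 := by field_simp
  have heD2 : 2 * C₀ / c₀ * e ≤ 1 := by
    calc 2 * C₀ / c₀ * e ≤ D * (1 / D) := by gcongr
      _ = 1 := by field_simp
  have hTy : T * y ≤ 1 := by
    have h1 : T ≤ rexp (T ^ 2) := by nlinarith [add_one_le_exp (T ^ 2)]
    calc T * y ≤ rexp (T ^ 2) * y := by gcongr
      _ = 1 := by rw [hy, ← exp_add]; simp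
  have hy10 : y ^ 10 ≤ 1 / 20000 := (pow_le_pow_left₀ hy0.le hy1 10).trans (by norm_num)
  have hy40 : y ^ 40 ≤ 1 / 10 ^ 16 := by
    calc y ^ 40 = (y ^ 10) ^ 4 := by ring
      _ ≤ (1 / 20000) ^ 4 := by gcongr
      _ ≤ _ := by norm_num
  have he40 : e ≤ 1 / 10 ^ 16 := hey.trans ((hyanti (by norm_num)).trans hy40)
  have he1 : e ≤ 1 := he40.trans (by norm_num)
  have heT : e * T ≤ 1 / 10 ^ 16 := by
    calc e * T ≤ y ^ 60 * T := by gcongr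
      _ = y ^ 59 * (T * y) := by ring
      _ ≤ y ^ 40 * 1 := by gcongr ?_ * ?_; exact hyanti (by norm_num)
      _ ≤ _ := by linarith
  have heq : e ≤ y ^ 7 := hey.trans (hyanti (by norm_num))
  have hT2' : T ≤ T ^ 2 := by nlinarith
  have hε1 : ε ≤ 1 := by rw [← he5]; exact pow_le_one₀ he.le he1
  have key := upTail_concentration_small (τ := τ) (f := y ^ 24) (q := y ^ 7) (B := B) hn hC₀ hc₀ hμ hψ hT he
    (he40.trans (by norm_num)) (heT.trans (by norm_num)) (by rw [he5]; exact hHD) (by positivity)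
    (by
      intro t ht
      refine gaussTail_ge_exp hT (ht.trans ?_)
      have : e ^ 5 / (2000 * T) ≤ 1 := by
        rw [he5, div_le_one (by positivity)]; linarith
      linarith)
    (by
      have h4 := exp_neg_le_inv_pow (x := c₀ / (2 * e ^ 4)) (by positivity)
      calc C₀ * rexp (-(c₀ / (2 * e ^ 4))) ≤ C₀ * (24 / (c₀ / (2 * e ^ 4)) ^ 4) := by gcongr
        _ = 384 * C₀ / c₀ ^ 4 * e * e ^ 15 := by field_simp; norm_num
        _ ≤ 1 * e ^ 15 := by gcongr
        _ = e ^ 15 := one_mul _)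
    (by
      have : e ^ 10 ≤ e ^ 2 := pow_le_pow_of_le_one he.le he1 (by norm_num)
      nlinarith)
    heq
    (by
      have : e ^ 2 ≤ e := by nlinarith
      exact this.trans (hey.trans (hyanti (by norm_num))))
    ((hyanti (by norm_num : 10 ≤ 24)).trans (hy10.trans (by norm_num)))
    (by
      calc e ^ 5 ≤ e ^ 2 := pow_le_pow_of_le_one he.le he1 (by norm_num)
        _ ≤ (y ^ 60) ^ 2 := by gcongr
        _ = y ^ 120 := by ring
        _ ≤ y ^ 96 := hyanti (by norm_num)
        _ = (y ^ 24) ^ 4 := by ring)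
    (by
      have h1 : e ≤ y ^ 24 := hey.trans (hyanti (by norm_num))
      have h2 : y ^ 24 = y ^ 10 * y ^ 14 := by ring
      have h3 : (y ^ 7) ^ 2 = y ^ 14 := by ring
      have h4 : 0 ≤ y ^ 14 := by positivity
      rw [h3]
      nlinarith)
    (by
      have h5 : (y ^ 24) ^ 4 * T = y ^ 95 * (T * y) := by ring
      have h6 : y ^ 95 ≤ 1 / 20000 := (hyanti (by norm_num)).trans hy10
      have : y ^ 95 * (T * y) ≤ 1 / 20000 * 1 := by gcongr
      linarith)
    hB
    (by
      have hx : 0 < c₀ * (y ^ 24) ^ 4 / e ^ 5 := by positivity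
      have h4 : e ^ 4 ≤ y ^ 199 := by
        calc e ^ 4 ≤ (y ^ 60) ^ 4 := by gcongr
          _ = y ^ 240 := by ring
          _ ≤ y ^ 199 := hyanti (by norm_num)
      calc 2 * (C₀ * rexp (-(c₀ * (y ^ 24) ^ 4 / e ^ 5))) ≤ 2 * (C₀ * (1 / (c₀ * (y ^ 24) ^ 4 / e ^ 5))) := by
            have := exp_neg_le_inv hx
            gcongr
        _ = (2 * C₀ / c₀ * e) * (e ^ 4 / y ^ 96) := by field_simp
        _ ≤ 1 * (y ^ 199 / y ^ 96) := by gcongr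
        _ = (y ^ 24) ^ 4 * y ^ 7 := by field_simp)
    (by
      have h1 : rexp (-(c₀ * (B * T ^ 2) / 4)) ≤ y ^ 103 * rexp (-M) := by
        rw [← hypow, ← exp_add]
        refine exp_le_exp.2 ?_
        have h2 : c₀ * (B * T ^ 2) / 4 = c₀ / 4 * T ^ 2 + (103 + M) * T ^ 2 := by
          rw [hBdef]; field_simp
        have h3 : 0 ≤ c₀ / 4 * T ^ 2 := by positivity
        rw [h2]; push_cast
        nlinarith
      calc 16 * (4 * (1 + 2 * C₀) / c₀ * rexp (-(c₀ * (B * T ^ 2) / 4)))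
          ≤ 16 * (4 * (1 + 2 * C₀) / c₀ * (y ^ 103 * rexp (-M))) := by gcongr
        _ = (M * rexp (-M)) * y ^ 103 := by rw [hM]; ring
        _ ≤ 1 * y ^ 103 := by
          have h2 : M * rexp (-M) ≤ M * (1 / M) := mul_le_mul_of_nonneg_left (exp_neg_le_inv hM0) hM0.le
          have h3 : M * (1 / M) = 1 := by field_simp
          gcongr
          linarith
        _ = (y ^ 24) ^ 4 * y ^ 7 := by ring)
    (by rw [he5]; exact hτ0) (by rw [he5]; exact hτ)
  rw [he5] at key
  have hfin : 4 * rexp (-(n * ε ^ 2 / 5)) + 2 * rexp (-(n * ε ^ 2 / K)) +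
        8 / (ε * y ^ 7) * rexp (-(n * (ε / (4496 * B * T ^ 3)) ^ 2 / 5)) ≤ 14 / ε ^ 2 * rexp (-(1 / S * (n * ε ^ 2 / T ^ 6))) := by
    have hT6 : 1 ≤ T ^ 6 := one_le_pow₀ hT
    have gen : ∀ a : ℝ, 0 < a → a ≤ S → 1 / S * (n * ε ^ 2 / T ^ 6) ≤ n * ε ^ 2 / a / T ^ 6 := by
      intro a ha haS
      have : n * ε ^ 2 / a / T ^ 6 = 1 / a * (n * ε ^ 2 / T ^ 6) := by ring
      rw [this]
      exact mul_le_mul_of_nonneg_right (one_div_le_one_div_of_le ha haS) (by positivity)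
    have g1 : rexp (-(n * ε ^ 2 / 5)) ≤ rexp (-(1 / S * (n * ε ^ 2 / T ^ 6))) := by
      refine exp_le_exp.2 (neg_le_neg ((gen 5 (by norm_num) ?_).trans (div_le_self (by positivity) hT6)))
      have : 0 ≤ 5 * (4496 * B) ^ 2 := by positivity
      linarith
    have g2 : rexp (-(n * ε ^ 2 / K)) ≤ rexp (-(1 / S * (n * ε ^ 2 / T ^ 6))) := by
      refine exp_le_exp.2 (neg_le_neg ((gen K hK0 ?_).trans (div_le_self (by positivity) hT6)))
      have : 0 ≤ 5 * (4496 * B) ^ 2 := by positivity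
      linarith
    have g3 : rexp (-(n * (ε / (4496 * B * T ^ 3)) ^ 2 / 5)) ≤ rexp (-(1 / S * (n * ε ^ 2 / T ^ 6))) := by
      refine exp_le_exp.2 (neg_le_neg ((gen (5 * (4496 * B) ^ 2) (by positivity) (by linarith)).trans_eq ?_))
      field_simp
    have hεsq : 1 ≤ 1 / ε ^ 2 := by
      rw [le_div_iff₀ (by positivity), one_mul]; exact pow_le_one₀ hε.le hε1
    have h8 : 8 / (ε * y ^ 7) ≤ 8 / ε ^ 2 := by
      refine div_le_div_of_nonneg_left (by norm_num) (by positivity) ?_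
      rw [pow_two]
      refine mul_le_mul_of_nonneg_left ?_ hε.le
      refine le_trans ?_ heq
      rw [← he5]; exact pow_le_of_le_one he.le he1 (by norm_num)
    set E := rexp (-(1 / S * (n * ε ^ 2 / T ^ 6)))
    have hE : 0 < E := exp_pos _
    calc _ ≤ 4 * E + 2 * E + 8 / ε ^ 2 * E := by gcongr
      _ ≤ 14 / ε ^ 2 * E := by
        have : 14 / ε ^ 2 = 6 * (1 / ε ^ 2) + 8 / ε ^ 2 := by ring
        rw [this]
        nlinarith
  exact ⟨key.1.trans hfin, key.2.trans hfin⟩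

end

section

lemma one_le_log_div {T ε : ℝ} (hT : 1 ≤ T) (hε : 0 < ε) (hε1 : ε ≤ 1 / 100) : 1 ≤ log (T / ε) := by
  rw [le_log_iff_exp_le (by positivity), le_div_iff₀ hε]
  nlinarith [exp_one_lt_d9, exp_pos 1]

/-- Concentration of the tails of marginals with respect to the scaled Gaussian measure. -/
lemma exists_upTail_concentration {C₀ c₀ : ℝ} (hC₀ : 0 < C₀) (hc₀ : 0 < c₀) :
    ∃ C₁ c' : ℝ, 0 < C₁ ∧ 0 < c' ∧ ∀ (n : ℕ) (μ : Measure (Euc n)), n ≠ 0 → IsProbabilityMeasure μ →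
      Measure.IsEven μ → HasPsiOneMarginals μ C₀ c₀ → ∀ T ε : ℝ, 1 ≤ T → 0 < ε → ε ≤ 1 / 100 →
      C₁ * log (T / ε) ≤ n * ε ^ 2 / T ^ 6 →
      (∀ t, 0 ≤ t → t ≤ T + ε / (2000 * T) → (1 - 6 / 5 * ε) * gaussTail t ≤ meanTail μ t ∧
        meanTail μ t ≤ (1 + 6 / 5 * ε) * gaussTail t) →
      ∀ τ, ε / (10000 * T) ≤ τ → τ ≤ T + ε / (5000 * T) →
      (gaussN n).real {z | (1 + 8 * ε) * gaussTail τ < upTail μ τ z} ≤ 30 / ε ^ 2 * rexp (-(c' * (n * ε ^ 2 / T ^ 6))) ∧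
      (gaussN n).real {z | upTail μ τ z < (1 - 8 * ε) * gaussTail τ} ≤ 30 / ε ^ 2 * rexp (-(c' * (n * ε ^ 2 / T ^ 6))) := by
  obtain ⟨D, c₂, hD, hc₂, hsmall⟩ := exists_upTail_concentration_small hC₀ hc₀
  set A := (D + 7 + 10 ^ 4 * C₀) / c₀ with hA
  have hA0 : 0 < A := by positivity
  set c₁ := 1 / (5 * 10 ^ 8 * A ^ 2) with hc₁
  have hc₁0 : 0 < c₁ := by positivity
  refine ⟨100 * A ^ 2, min c₁ c₂, by positivity, lt_min hc₁0 hc₂, ?_⟩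
  intro n μ hn hp hμ hψ T ε hT hε hε1 hm hHD τ hτ0 hτ
  have hT0 : 0 < T := by linarith
  have hT2 : 1 ≤ T ^ 2 := one_le_pow₀ hT
  have hT6 : 1 ≤ T ^ 6 := one_le_pow₀ hT
  have hL := one_le_log_div hT hε hε1
  set L := log (T / ε) with hLdef
  set m := n * ε ^ 2 / T ^ 6 with hmdef
  have hm0 : 0 ≤ m := by positivity
  have hε2 : 30 / ε ≤ 30 / ε ^ 2 := by
    refine div_le_div_of_nonneg_left (by norm_num) (by positivity) ?_
    nlinarith
  rcases le_or_gt ε (rexp (-(D * T ^ 2))) with hcase | hcase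
  · have key := hsmall n μ hn hp hμ hψ T ε hT hε hcase hHD τ hτ0 hτ
    have : 14 / ε ^ 2 * rexp (-(c₂ * m)) ≤ 30 / ε ^ 2 * rexp (-(min c₁ c₂ * m)) := by
      have h1 : rexp (-(c₂ * m)) ≤ rexp (-(min c₁ c₂ * m)) :=
        exp_le_exp.2 (neg_le_neg (mul_le_mul_of_nonneg_right (min_le_right _ _) hm0))
      have h2 : 14 / ε ^ 2 ≤ 30 / ε ^ 2 := by gcongr; norm_num
      exact mul_le_mul h2 h1 (exp_pos _).le (by positivity)
    exact ⟨key.1.trans this, key.2.trans this⟩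
  · have key := upTail_concentration_moderate (μ := μ) hn hC₀ hc₀ hψ hT hε hε1 hA0 hHD (by
      have hq : rexp (-T ^ 2) ^ 7 ≤ gaussTail (T + ε / (2000 * T)) := by
        refine gaussTail_ge_exp hT ?_
        have : ε / (2000 * T) ≤ 1 := by
          rw [div_le_one (by positivity)]; linarith
        linarith
      have h1 : c₀ * (A * T ^ 2) = (D + 7 + 10 ^ 4 * C₀) * T ^ 2 := by rw [hA]; field_simp
      have h2 : rexp (-(c₀ * (A * T ^ 2))) ≤ rexp (-(D * T ^ 2)) * rexp (-T ^ 2) ^ 7 * rexp (-(10 ^ 4 * C₀)) := by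
        rw [← exp_nat_mul, ← exp_add, ← exp_add, h1]
        refine exp_le_exp.2 ?_
        push_cast
        nlinarith
      have h3 := exp_neg_le_inv (x := 10 ^ 4 * C₀) (by positivity)
      calc C₀ * rexp (-(c₀ * (A * T ^ 2)))
          ≤ C₀ * (rexp (-(D * T ^ 2)) * rexp (-T ^ 2) ^ 7 * (1 / (10 ^ 4 * C₀))) := by
            refine mul_le_mul_of_nonneg_left (h2.trans ?_) hC₀.le
            exact mul_le_mul_of_nonneg_left h3 (by positivity)
        _ = rexp (-(D * T ^ 2)) / 10000 * rexp (-T ^ 2) ^ 7 := by field_simp; norm_num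
        _ ≤ ε / 10000 * gaussTail (T + ε / (2000 * T)) := by gcongr) (by
      have h1 : 9 + L ≤ n / (5 * A ^ 2 * T ^ 6) := by
        have h2 : n / (5 * A ^ 2 * T ^ 6) = m / ε ^ 2 / (5 * A ^ 2) := by rw [hmdef]; field_simp
        have h3 : m ≤ m / ε ^ 2 := by
          rw [le_div_iff₀ (by positivity)]
          exact mul_le_of_le_one_right hm0 (pow_le_one₀ hε.le (by linarith))
        rw [h2, le_div_iff₀ (by positivity)]
        have : 0 < A ^ 2 := by positivity
        nlinarith
      have h4 : rexp (-L) ≤ ε := by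
        rw [exp_neg, hLdef, exp_log (by positivity), inv_div, div_le_iff₀ hT0]
        nlinarith
      have h5 : (16:ℝ) ≤ rexp 3 := by
        have h6 : (2.7:ℝ) < rexp 1 := by linarith [exp_one_gt_d9]
        have h7 : rexp 3 = rexp 1 ^ 3 := by rw [← exp_nat_mul]; norm_num
        rw [h7]
        calc (16:ℝ) ≤ 2.7 ^ 3 := by norm_num
          _ ≤ _ := by gcongr
      calc 16 * rexp (6 - n / (5 * A ^ 2 * T ^ 6)) ≤ rexp 3 * rexp (6 - (9 + L)) := by gcongr
        _ = rexp (-L) := by rw [← exp_add]; congr 1; ring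
        _ ≤ ε := h4) hτ0 hτ
    have : 30 / ε * rexp (-(n * ε ^ 2 / (5 * 10 ^ 8 * A ^ 2 * T ^ 6))) ≤ 30 / ε ^ 2 * rexp (-(min c₁ c₂ * m)) := by
      have h0 : n * ε ^ 2 / (5 * 10 ^ 8 * A ^ 2 * T ^ 6) = c₁ * m := by rw [hc₁, hmdef]; field_simp
      rw [h0]
      have h1 : rexp (-(c₁ * m)) ≤ rexp (-(min c₁ c₂ * m)) :=
        exp_le_exp.2 (neg_le_neg (mul_le_mul_of_nonneg_right (min_le_left _ _) hm0))
      exact mul_le_mul hε2 h1 (exp_pos _).le (by positivity)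
    exact ⟨key.1.trans this, key.2.trans this⟩

end

section

/-- A uniform bound on the relative error of a monotone tail on `[0, T]` follows from its values on a fine net. -/
lemma tail_ratio_of_net {N : ℝ → ℝ} (hN : Antitone N) (hN0 : ∀ t, 0 < t → N 0 + N t ≤ 1) {T ε : ℝ} (hT : 1 ≤ T)
    (hε : 0 < ε) (hε1 : ε ≤ 1 / 100)
    (h : ∀ j : ℕ, 2 ≤ j → j * (ε / (10000 * T)) ≤ T + ε / (10000 * T) →
      (1 - 9 * ε) * gaussTail (j * (ε / (10000 * T))) ≤ N (j * (ε / (10000 * T))) ∧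
      N (j * (ε / (10000 * T))) ≤ (1 + 9 * ε) * gaussTail (j * (ε / (10000 * T)))) {t : ℝ} (ht0 : 0 ≤ t) (htT : t ≤ T) :
    |N t / gaussTail t - 1| ≤ 10 * ε := by
  have hT0 : 0 < T := by linarith
  set s := ε / (10000 * T) with hs
  have hs0 : 0 < s := by positivity
  have hsT : s * T = ε / 10000 := by rw [hs]; field_simp
  have hsε : s ≤ ε / 10000 := by nlinarith
  have hQt := gaussTail_pos t
  suffices (1 - 10 * ε) * gaussTail t ≤ N t ∧ N t ≤ (1 + 10 * ε) * gaussTail t by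
    rw [abs_le]
    constructor
    · have := (le_div_iff₀ hQt).2 this.1
      linarith
    · have := (div_le_iff₀ hQt).2 this.2
      linarith
  rcases lt_or_ge t (2 * s) with hlt | hge
  · have h2 := h 2 le_rfl (by push_cast; linarith)
    push_cast at h2
    have q1 := gaussTail_sub_le (s := 0) (t := 2 * s) (by linarith)
    rw [gaussTail_zero] at q1
    have q2 := gaussTail_strictAnti.antitone hlt.le
    have q3 := gaussTail_le_half ht0
    have n1 := hN hlt.le
    have n2 := hN ht0
    have n3 := hN0 (2 * s) (by linarith)
    set Q2 := gaussTail (2 * s)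
    constructor
    · have : (1 - 9 * ε) * (1 / 2 - 2 / 5 * (2 * s)) ≤ (1 - 9 * ε) * Q2 :=
        mul_le_mul_of_nonneg_left (by linarith) (by linarith)
      have h5 : (1 - 10 * ε) * gaussTail t ≤ (1 - 10 * ε) * (1 / 2) := mul_le_mul_of_nonneg_left q3 (by linarith)
      nlinarith
    · have h5 : (1 + 10 * ε) * Q2 ≤ (1 + 10 * ε) * gaussTail t := mul_le_mul_of_nonneg_left q2 (by linarith)
      nlinarith
  · have hj2 : 2 ≤ ⌊t / s⌋₊ := Nat.le_floor (by rw [le_div_iff₀ hs0]; exact_mod_cast hge)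
    have hfl := Nat.floor_le (a := t / s) (by positivity)
    rw [le_div_iff₀ hs0] at hfl
    have hfl2 := Nat.lt_floor_add_one (t / s)
    rw [div_lt_iff₀ hs0] at hfl2
    set j := ⌊t / s⌋₊
    have hj := h j hj2 (by linarith)
    have hj1 := h (j + 1) (by omega) (by push_cast; linarith)
    push_cast at hj1
    have ej : ((j:ℝ) + 1) * s - s = j * s := by ring
    have hjs : s ≤ (j + 1) * s := le_mul_of_one_le_left hs0.le (by linarith [(Nat.cast_nonneg j : (0:ℝ) ≤ j)])
    have hratio := gaussTail_sub_le_mul (t := (j + 1) * s) (u := 3 * (ε / 10000)) hs0.le hjs (by nlinarith) (by linarith)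
    rw [ej] at hratio
    have a1 := gaussTail_strictAnti.antitone hfl
    have a2 := gaussTail_strictAnti.antitone hfl2.le
    have n1 := hN hfl
    have n2 := hN hfl2.le
    have hQj := gaussTail_pos ((j + 1) * s)
    have hεε : ε * ε ≤ ε * (1 / 100) := mul_le_mul_of_nonneg_left hε1 hε.le
    set Qa := gaussTail (j * s)
    set Qb := gaussTail ((j + 1) * s)
    set Qt := gaussTail t
    constructor
    · have h5 : (1 - 10 * ε) * Qt ≤ (1 - 10 * ε) * ((1 + 2 * (3 * (ε / 10000))) * Qb) :=
        mul_le_mul_of_nonneg_left (by linarith) (by linarith)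
      have h6 : 0 ≤ ε * ε * Qb := by positivity
      have h7 : 0 ≤ ε * Qb := by positivity
      linarith [hj1.1]
    · have h5 : (1 + 9 * ε) * Qa ≤ (1 + 9 * ε) * ((1 + 2 * (3 * (ε / 10000))) * Qt) :=
        mul_le_mul_of_nonneg_left (by
          have : (1 + 2 * (3 * (ε / 10000))) * Qb ≤ (1 + 2 * (3 * (ε / 10000))) * Qt :=
            mul_le_mul_of_nonneg_left a2 (by positivity)
          linarith) (by linarith)
      have h6 : ε * ε * Qt ≤ ε * (1 / 100) * Qt := mul_le_mul_of_nonneg_right hεε hQt.le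
      have h7 : 0 ≤ ε * Qt := by positivity
      linarith [hj.2]

variable {n : ℕ} {μ σ : Measure (Euc n)}

/-- Passage from the scaled Gaussian measure to the sphere at a single level `τ`. -/
lemma sphere_upTail_dev [IsProbabilityMeasure μ] (hn : n ≠ 0) (hσ : IsUniformSphereMeasure σ) {T ε P : ℝ} (hT : 1 ≤ T)
    (hε : 0 < ε) (hε1 : ε ≤ 1 / 100)
    (hP : ∀ τ, ε / (10000 * T) ≤ τ → τ ≤ T + ε / (5000 * T) →
      (gaussN n).real {z | (1 + 8 * ε) * gaussTail τ < upTail μ τ z} ≤ P ∧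
      (gaussN n).real {z | upTail μ τ z < (1 - 8 * ε) * gaussTail τ} ≤ P)
    {τ : ℝ} (hτ0 : 2 * (ε / (10000 * T)) ≤ τ) (hτ : τ ≤ T + ε / (10000 * T)) :
    σ.real {ξ | (1 + 9 * ε) * gaussTail τ < upTail μ τ ξ} ≤ 2 * rexp (-(n * (ε / (40000 * T ^ 2)) ^ 2 / 8)) + P ∧
    σ.real {ξ | upTail μ τ ξ < (1 - 9 * ε) * gaussTail τ} ≤ 2 * rexp (-(n * (ε / (40000 * T ^ 2)) ^ 2 / 8)) + P := by
  have hT0 : 0 < T := by linarith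
  have hT2 : 1 ≤ T ^ 2 := one_le_pow₀ hT
  set s := ε / (10000 * T) with hs
  have e2 : ε / (5000 * T) = 2 * s := by rw [hs]; field_simp; norm_num
  rw [e2] at hP
  have hs0 : 0 < s := by positivity
  have hsT : s * T = ε / 10000 := by rw [hs]; field_simp
  have hsε : s ≤ ε / 10000 := by nlinarith
  set e := ε / (40000 * T ^ 2) with he
  have he0 : 0 < e := by positivity
  have heT : e * T = s / 4 := by rw [he, hs]; field_simp; norm_num
  have hes : e ≤ s / 4 := by nlinarith
  have he1 : e ≤ 1 := by linarith
  have heT2 : e * T * T = ε / 40000 := by rw [heT]; linarith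
  have hτ00 : 0 ≤ τ := by linarith
  have heτ : e * τ ≤ s / 2 := by
    calc e * τ ≤ e * (T + T) := by gcongr; linarith
      _ = s / 2 := by linarith
  have heτ2 : e * τ * (τ + 2) ≤ ε / 5000 := by
    calc e * τ * (τ + 2) ≤ e * (T + T) * ((T + T) + 2 * T) := by gcongr <;> linarith
      _ = 8 * (e * T * T) := by ring
      _ = ε / 5000 := by rw [heT2]; ring
  have hconc := gaussN_norm_conc hn he0.le he1
  have hmap : Measurable (fun z : Euc n => ‖z‖⁻¹ • z) := by fun_prop
  have hQ := gaussTail_pos τ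
  constructor
  · obtain ⟨hP1, -⟩ := hP (τ * (1 - e)) (by linarith) (by linarith [mul_nonneg he0.le hτ00])
    have hms : MeasurableSet {ξ : Euc n | (1 + 9 * ε) * gaussTail τ < upTail μ τ ξ} :=
      measurableSet_lt measurable_const (measurable_upTail τ)
    rw [sphere_eq_map_gaussN hn hσ, map_measureReal_apply hmap hms]
    refine (measureReal_mono ?_).trans ((measureReal_union_le _ _).trans (add_le_add hconc hP1))
    intro z hz
    by_contra hcon
    simp only [Set.mem_union, not_or, Set.mem_ofPred_eq, not_lt] at hcon
    have hz' : (1 + 9 * ε) * gaussTail τ < upTail μ τ (‖z‖⁻¹ • z) := hz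
    have h1 := sphere_le_upTail (μ := μ) (t := τ * (1 - e)) (mul_nonneg hτ00 (by linarith)) (by linarith) hcon.1
    rw [mul_div_cancel_right₀ _ (by linarith : (1 - e) ≠ 0)] at h1
    have h2 := gaussTail_sub_le_mul (t := τ) (h := e * τ) (u := ε / 5000) (by positivity) (by linarith)
      (by nlinarith [mul_nonneg he0.le hτ00]) (by linarith)
    rw [show τ - e * τ = τ * (1 - e) by ring] at h2
    have h3 : (1 + 8 * ε) * gaussTail (τ * (1 - e)) ≤ (1 + 8 * ε) * ((1 + 2 * (ε / 5000)) * gaussTail τ) :=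
      mul_le_mul_of_nonneg_left h2 (by linarith)
    have h4 : ε * ε * gaussTail τ ≤ ε * (1 / 100) * gaussTail τ := by gcongr
    have h5 : 0 < ε * gaussTail τ := by positivity
    linarith [hcon.2]
  · obtain ⟨-, hP2⟩ := hP (τ * (1 + e)) (by linarith [mul_nonneg hτ00 he0.le]) (by linarith)
    have hms : MeasurableSet {ξ : Euc n | upTail μ τ ξ < (1 - 9 * ε) * gaussTail τ} :=
      measurableSet_lt (measurable_upTail τ) measurable_const
    rw [sphere_eq_map_gaussN hn hσ, map_measureReal_apply hmap hms]
    refine (measureReal_mono ?_).trans ((measureReal_union_le _ _).trans (add_le_add hconc hP2))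
    intro z hz
    by_contra hcon
    simp only [Set.mem_union, not_or, Set.mem_ofPred_eq, not_lt] at hcon
    have hz' : upTail μ τ (‖z‖⁻¹ • z) < (1 - 9 * ε) * gaussTail τ := hz
    have h1 := upTail_le_sphere (μ := μ) (t := τ * (1 + e)) (mul_nonneg hτ00 (by linarith)) (by linarith) hcon.1
    rw [mul_div_cancel_right₀ _ (by linarith : (1 + e) ≠ 0)] at h1
    have h2 := gaussTail_sub_le_mul (t := τ * (1 + e)) (h := e * τ) (u := ε / 5000) (by positivity)
      (by linarith) (by nlinarith [mul_nonneg he0.le hτ00]) (by linarith)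
    rw [show τ * (1 + e) - e * τ = τ by ring] at h2
    have hQ' := gaussTail_pos (τ * (1 + e))
    have h3 : (1 - 9 * ε) * gaussTail τ ≤ (1 - 9 * ε) * ((1 + 2 * (ε / 5000)) * gaussTail (τ * (1 + e))) :=
      mul_le_mul_of_nonneg_left h2 (by linarith)
    have h4 : 0 < ε * ε * gaussTail (τ * (1 + e)) := by positivity
    have h5 : 0 < ε * gaussTail (τ * (1 + e)) := by positivity
    linarith [hcon.2]

/-- A union bound over a net of levels. -/
lemma sphere_ratio_dev [IsProbabilityMeasure μ] (hn : n ≠ 0) (hμ : Measure.IsEven μ) (hσ : IsUniformSphereMeasure σ)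
    {T ε P : ℝ} (hT : 1 ≤ T) (hε : 0 < ε) (hε1 : ε ≤ 1 / 100)
    (hP : ∀ τ, ε / (10000 * T) ≤ τ → τ ≤ T + ε / (5000 * T) →
      (gaussN n).real {z | (1 + 8 * ε) * gaussTail τ < upTail μ τ z} ≤ P ∧
      (gaussN n).real {z | upTail μ τ z < (1 - 8 * ε) * gaussTail τ} ≤ P) :
    σ.real {ξ | ∃ t ∈ Set.Icc (0:ℝ) T, 10 * ε < |upTail μ t ξ / gaussTail t - 1|} ≤
      30000 * T ^ 2 / ε * (2 * (2 * rexp (-(n * (ε / (40000 * T ^ 2)) ^ 2 / 8)) + P)) := by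
  have := hσ.prob
  have hT0 : 0 < T := by linarith
  set s := ε / (10000 * T) with hs
  have hs0 : 0 < s := by positivity
  set J := ⌊T / s + 1⌋₊ with hJ
  set I := (Finset.range (J + 1)).filter fun j : ℕ => 2 ≤ j ∧ j * s ≤ T + s with hI
  set R := 2 * rexp (-(n * (ε / (40000 * T ^ 2)) ^ 2 / 8)) + P with hR
  have hR0 : 0 ≤ R := by
    have := (measureReal_nonneg.trans (hP T (by
      have : s ≤ 1 := by rw [hs, div_le_one (by positivity)]; linarith
      linarith) (by
      have : 0 ≤ ε / (5000 * T) := by positivity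
      linarith)).1)
    positivity
  have hsub : {ξ | ∃ t ∈ Set.Icc (0:ℝ) T, 10 * ε < |upTail μ t ξ / gaussTail t - 1|} ⊆
      ⋃ j ∈ I, ({ξ | (1 + 9 * ε) * gaussTail (j * s) < upTail μ (j * s) ξ} ∪
        {ξ | upTail μ (j * s) ξ < (1 - 9 * ε) * gaussTail (j * s)}) := by
    rintro ξ ⟨t, ht, hbad⟩
    by_contra hcon
    simp only [Set.mem_iUnion, Set.mem_union, Set.mem_ofPred_eq, not_exists, not_or, not_lt] at hcon
    refine absurd hbad (not_lt.2 (tail_ratio_of_net (N := fun t => upTail μ t ξ) (fun _ _ h => upTail_antitone ξ h)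
      (fun t ht => upTail_zero_add_le hμ ht ξ) hT hε hε1 (fun j hj2 hjT => ?_) ht.1 ht.2))
    have hjI : j ∈ I := by
      rw [hI, Finset.mem_filter, Finset.mem_range]
      refine ⟨Nat.lt_succ_of_le (Nat.le_floor ?_), hj2, hjT⟩
      rw [← sub_le_iff_le_add, le_div_iff₀ hs0]
      linarith
    exact ⟨(hcon j hjI).2, (hcon j hjI).1⟩
  have hcard : (I.card : ℝ) ≤ 30000 * T ^ 2 / ε := by
    have h1 : I.card ≤ J + 1 := (Finset.card_filter_le _ _).trans_eq (Finset.card_range _)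
    have h2 : (J : ℝ) ≤ T / s + 1 := Nat.floor_le (by positivity)
    have h3 : T / s = 10000 * (T ^ 2 / ε) := by rw [hs]; field_simp
    have h4 : 1 ≤ T ^ 2 / ε := by rw [le_div_iff₀ hε]; nlinarith
    have h5 : (I.card : ℝ) ≤ J + 1 := by exact_mod_cast h1
    have h6 : 30000 * T ^ 2 / ε = 30000 * (T ^ 2 / ε) := by ring
    rw [h6]; linarith
  calc _ ≤ σ.real (⋃ j ∈ I, ({ξ | (1 + 9 * ε) * gaussTail (j * s) < upTail μ (j * s) ξ} ∪
        {ξ | upTail μ (j * s) ξ < (1 - 9 * ε) * gaussTail (j * s)})) := measureReal_mono hsub (measure_ne_top _ _)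
    _ ≤ ∑ j ∈ I, σ.real ({ξ | (1 + 9 * ε) * gaussTail (j * s) < upTail μ (j * s) ξ} ∪
        {ξ | upTail μ (j * s) ξ < (1 - 9 * ε) * gaussTail (j * s)}) := measureReal_biUnion_finset_le _ _
    _ ≤ ∑ j ∈ I, 2 * R := by
        refine Finset.sum_le_sum fun j hj => ?_
        rw [hI, Finset.mem_filter] at hj
        have h2j : (2:ℝ) ≤ j := by exact_mod_cast hj.2.1
        obtain ⟨h1, h2⟩ := sphere_upTail_dev hn hσ hT hε hε1 hP (τ := j * s)
          (mul_le_mul_of_nonneg_right h2j hs0.le) hj.2.2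
        exact (measureReal_union_le _ _).trans (by linarith)
    _ = I.card * (2 * R) := by rw [Finset.sum_const, nsmul_eq_mul]
    _ ≤ _ := mul_le_mul_of_nonneg_right hcard (by positivity)

end

/-- The deviation bound on the sphere when `n ε² / T⁶` is large compared with `log (T / ε)`. -/
lemma exists_sphere_ratio_dev {C₀ c₀ : ℝ} (hC₀ : 0 < C₀) (hc₀ : 0 < c₀) :
    ∃ C₁ c' : ℝ, 0 < C₁ ∧ 0 < c' ∧ ∀ (n : ℕ) (μ σ : Measure (Euc n)), n ≠ 0 → IsProbabilityMeasure μ →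
      Measure.IsEven μ → HasPsiOneMarginals μ C₀ c₀ → IsUniformSphereMeasure σ → ∀ T ε : ℝ, 1 ≤ T → 0 < ε → ε ≤ 1 / 100 →
      C₁ * log (T / ε) ≤ n * ε ^ 2 / T ^ 6 →
      (∀ t ∈ Set.Icc (0:ℝ) T,
        (1 - ε) * (1 - gaussCDF t) ≤ (∫ η, (1 - marginalCDF μ η t) ∂σ) ∧
        (∫ η, (1 - marginalCDF μ η t) ∂σ) ≤ (1 + ε) * (1 - gaussCDF t)) →
      σ.real {ξ | ∃ t ∈ Set.Icc (0:ℝ) T, 10 * ε < |upTail μ t ξ / gaussTail t - 1|} ≤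
        1920000 * T ^ 2 / ε ^ 3 * rexp (-(c' * (n * ε ^ 2 / T ^ 6))) := by
  obtain ⟨C₁, c₁, hC₁, hc₁, h⟩ := exists_upTail_concentration hC₀ hc₀
  set c₂ : ℝ := 1 / (8 * 40000 ^ 2) with hc₂
  have hc₂0 : 0 < c₂ := by positivity
  refine ⟨max C₁ (30 / c₂), min c₁ c₂, lt_max_of_lt_left hC₁, lt_min hc₁ hc₂0, ?_⟩
  intro n μ σ hn _ hμ hψ hσ T ε hT hε hε1 hm hS
  have hT0 : 0 < T := by linarith
  have hT2 : 1 ≤ T ^ 2 := one_le_pow₀ hT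
  have hL := one_le_log_div hT hε hε1
  set L := log (T / ε) with hLdef
  have hLε : rexp (-L) ≤ ε := by
    rw [exp_neg, hLdef, exp_log (by positivity), inv_div, div_le_iff₀ hT0]
    nlinarith
  set m := n * ε ^ 2 / T ^ 6 with hmdef
  have hm0 : 0 ≤ m := by positivity
  have hm1 : C₁ * L ≤ m := (mul_le_mul_of_nonneg_right (le_max_left _ _) (by linarith)).trans hm
  have hm2 : 30 * L ≤ c₂ * m := by
    have h1 := (mul_le_mul_of_nonneg_right (le_max_right C₁ (30 / c₂)) (by linarith)).trans hm
    rw [div_mul_eq_mul_div, div_le_iff₀ hc₂0] at h1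
    linarith
  have hmid : 2 * rexp (-(n * (ε / (40000 * T ^ 2)) ^ 2 / 8)) = 2 * rexp (-(c₂ * m * T ^ 2)) := by
    congr 3; rw [hc₂, hmdef]; field_simp
  have hHD := meanTail_bounds hn hσ hT hε hε1 hS (by
    have he1 : ε / (10000 * T ^ 2) ≤ 1 := by rw [div_le_one (by positivity)]; linarith
    refine (gaussN_norm_conc hn (by positivity) he1).trans ?_
    have hq := gaussTail_ge_exp hT (le_refl (2 * T))
    have h1 : n * (ε / (10000 * T ^ 2)) ^ 2 / 8 = 16 * (c₂ * m * T ^ 2) := by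
      rw [hc₂, hmdef]; field_simp; norm_num
    have h2 : 7 * T ^ 2 + 12 + L ≤ 16 * (c₂ * m * T ^ 2) := by nlinarith
    have h3 : (20000 : ℝ) ≤ rexp 12 := by
      have h4 : (2.7:ℝ) < rexp 1 := by linarith [exp_one_gt_d9]
      have h5 : rexp 12 = rexp 1 ^ 12 := by rw [← exp_nat_mul]; norm_num
      rw [h5]
      calc (20000:ℝ) ≤ 2.7 ^ 12 := by norm_num
        _ ≤ _ := by gcongr
    have h6 : 20000 * rexp (-(n * (ε / (10000 * T ^ 2)) ^ 2 / 8)) ≤ ε * gaussTail (2 * T) := by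
      calc 20000 * rexp (-(n * (ε / (10000 * T ^ 2)) ^ 2 / 8)) ≤ rexp 12 * rexp (-(7 * T ^ 2 + 12 + L)) := by
            rw [h1]; exact mul_le_mul h3 (exp_le_exp.2 (neg_le_neg h2)) (exp_pos _).le (exp_pos _).le
        _ = rexp (-L) * rexp (-T ^ 2) ^ 7 := by
            rw [← exp_nat_mul, ← exp_add, ← exp_add]; congr 1; push_cast; ring
        _ ≤ ε * gaussTail (2 * T) := by gcongr
    linarith)
  have key := sphere_ratio_dev hn hμ hσ hT hε hε1 (h n μ hn ‹_› hμ hψ T ε hT hε hε1 hm1 hHD)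
  refine key.trans ?_
  rw [hmid]
  set E := rexp (-(min c₁ c₂ * m))
  have hE : 0 < E := exp_pos _
  have e1 : rexp (-(c₁ * m)) ≤ E :=
    exp_le_exp.2 (neg_le_neg (mul_le_mul_of_nonneg_right (min_le_left _ _) hm0))
  have e2 : rexp (-(c₂ * m * T ^ 2)) ≤ E := by
    refine exp_le_exp.2 (neg_le_neg ((mul_le_mul_of_nonneg_right (min_le_right _ _) hm0).trans ?_))
    exact le_mul_of_one_le_right (by positivity) hT2
  have hεsq : 1 ≤ 1 / ε ^ 2 := by
    rw [le_div_iff₀ (by positivity), one_mul]; exact pow_le_one₀ hε.le (by linarith)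
  calc 30000 * T ^ 2 / ε * (2 * (2 * rexp (-(c₂ * m * T ^ 2)) + 30 / ε ^ 2 * rexp (-(c₁ * m))))
      ≤ 30000 * T ^ 2 / ε * (2 * (2 * (1 / ε ^ 2 * E) + 30 / ε ^ 2 * E)) := by
        have : rexp (-(c₂ * m * T ^ 2)) ≤ 1 / ε ^ 2 * E := e2.trans (le_mul_of_one_le_left hE.le hεsq)
        gcongr
    _ = _ := by field_simp; norm_num

end

theorem stmt10 (C₀ c₀ : ℝ) (hC₀ : 0 < C₀) (hc₀ : 0 < c₀) :
    ∃ ε₀ C c : ℝ, 0 < ε₀ ∧ 0 < C ∧ 0 < c ∧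
      ∀ (n : ℕ), 2 ≤ n →
        ∀ (μ : Measure (EuclideanSpace ℝ (Fin n))), IsProbabilityMeasure μ →
          Measure.IsEven μ → HasPsiOneMarginals μ C₀ c₀ →
          ∀ (σ : Measure (EuclideanSpace ℝ (Fin n))), IsUniformSphereMeasure σ →
            ∀ T ε : ℝ, 1 ≤ T → 0 < ε → ε < ε₀ →
              (∀ t ∈ Set.Icc (0:ℝ) T,
                (1 - ε) * (1 - gaussCDF t) ≤ (∫ η, (1 - marginalCDF μ η t) ∂σ) ∧
                (∫ η, (1 - marginalCDF μ η t) ∂σ) ≤ (1 + ε) * (1 - gaussCDF t)) →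
              (σ {ξ | ∃ t ∈ Set.Icc (0:ℝ) T,
                  10 * ε < |(1 - marginalCDF μ ξ t) / (1 - gaussCDF t) - 1|}).toReal ≤
                C * T ^ 8 / (n * ε ^ 4) * Real.exp (-c * n * ε ^ 2 / T ^ 6) := by
  obtain ⟨C₁, c', hC₁, hc', h⟩ := exists_sphere_ratio_dev hC₀ hc₀
  set C₂ := max C₁ (4 / c') with hC₂def
  have hC₂ : 0 < C₂ := lt_max_of_lt_left hC₁
  refine ⟨1 / 100, C₂ + 1920000 * (4 / c'), min (c' / 2) (1 / C₂), by norm_num, by positivity, by positivity, ?_⟩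
  intro n hn μ hp hμ hψ σ hσ T ε hT hε hε1 hS
  have hσp := hσ.prob
  have hn0 : n ≠ 0 := by omega
  have hnpos : (0:ℝ) < n := by positivity
  have hT0 : 0 < T := by linarith
  simp_rw [one_sub_marginalCDF]
  set c := min (c' / 2) (1 / C₂) with hc
  set m := n * ε ^ 2 / T ^ 6 with hmdef
  have hm0 : 0 < m := by positivity
  have hL := one_le_log_div hT hε hε1.le
  have hrhs : (C₂ + 1920000 * (4 / c')) * T ^ 8 / (n * ε ^ 4) * Real.exp (-c * n * ε ^ 2 / T ^ 6) =
      (C₂ + 1920000 * (4 / c')) * (T ^ 2 / (m * ε ^ 2)) * rexp (-(c * m)) := by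
    have h1 : -c * n * ε ^ 2 / T ^ 6 = -(c * m) := by rw [hmdef]; ring
    rw [h1, hmdef]
    field_simp
  rw [hrhs]
  rcases le_or_gt (C₂ * log (T / ε)) m with hm | hm
  · have hm1 : C₁ * log (T / ε) ≤ m := (mul_le_mul_of_nonneg_right (le_max_left _ _) (by linarith)).trans hm
    refine (h n μ σ hn0 hp hμ hψ hσ T ε hT hε hε1.le hm1 hS).trans ?_
    have hm2 : log (T / ε) ≤ c' / 4 * m := by
      have h1 := (mul_le_mul_of_nonneg_right (le_max_right C₁ (4 / c')) (by linarith)).trans hm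
      rw [div_mul_eq_mul_div, div_le_iff₀ hc'] at h1
      linarith
    have e1 : rexp (-(c' / 4 * m)) ≤ ε := by
      calc rexp (-(c' / 4 * m)) ≤ rexp (-log (T / ε)) := exp_le_exp.2 (neg_le_neg hm2)
        _ = ε / T := by rw [exp_neg, exp_log (by positivity), inv_div]
        _ ≤ ε := div_le_self hε.le hT
    have e2 : rexp (-(c' / 4 * m)) ≤ 4 / c' / m := by
      refine (exp_neg_le_inv (by positivity)).trans_eq ?_
      field_simp
    have e3 : rexp (-(c' / 2 * m)) ≤ rexp (-(c * m)) :=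
      exp_le_exp.2 (neg_le_neg (mul_le_mul_of_nonneg_right (min_le_left _ _) hm0.le))
    have e4 : rexp (-(c' * m)) = rexp (-(c' / 4 * m)) * rexp (-(c' / 4 * m)) * rexp (-(c' / 2 * m)) := by
      rw [← exp_add, ← exp_add]; congr 1; ring
    calc 1920000 * T ^ 2 / ε ^ 3 * rexp (-(c' * m))
        ≤ 1920000 * T ^ 2 / ε ^ 3 * (ε * (4 / c' / m) * rexp (-(c * m))) := by
          rw [e4]
          refine mul_le_mul_of_nonneg_left ?_ (by positivity)
          exact mul_le_mul (mul_le_mul e1 e2 (exp_pos _).le hε.le) e3 (exp_pos _).le (by positivity)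
      _ = 1920000 * (4 / c') * (T ^ 2 / (m * ε ^ 2)) * rexp (-(c * m)) := by field_simp
      _ ≤ _ := by
          refine mul_le_mul_of_nonneg_right (mul_le_mul_of_nonneg_right ?_ (by positivity)) (exp_pos _).le
          linarith
  · refine (measureReal_le_one (μ := σ)).trans ?_
    have h1 : c * m ≤ log (T / ε) := by
      calc c * m ≤ 1 / C₂ * (C₂ * log (T / ε)) :=
            mul_le_mul (min_le_right _ _) hm.le hm0.le (by positivity)
        _ = log (T / ε) := by field_simp
    have h2 : ε / T ≤ rexp (-(c * m)) := by
      calc ε / T = rexp (-log (T / ε)) := by rw [exp_neg, exp_log (by positivity), inv_div]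
        _ ≤ _ := exp_le_exp.2 (neg_le_neg h1)
    have h3 : m ≤ C₂ * (T / ε) :=
      hm.le.trans (mul_le_mul_of_nonneg_left (log_le_self (by positivity)) hC₂.le)
    calc (1:ℝ) ≤ C₂ * (T ^ 2 / (m * ε ^ 2)) * (ε / T) := by
          have : C₂ * (T ^ 2 / (m * ε ^ 2)) * (ε / T) = C₂ * (T / ε) / m := by field_simp
          rw [this, one_le_div hm0]; exact h3
      _ ≤ (C₂ + 1920000 * (4 / c')) * (T ^ 2 / (m * ε ^ 2)) * rexp (-(c * m)) := by
          refine mul_le_mul (mul_le_mul_of_nonneg_right ?_ (by positivity)) h2 (by positivity) (by positivity)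
          have : 0 < 1920000 * (4 / c') := by positivity
          linarith
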